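/- Fix ε ∈ (0,1], and for x large set y := exp((log x)^{ε/2}) and J := ⌊log log log x⌋; call n ≤ x convenient if n can be written as n = m(P_J ⋯ P_1)^k for some positive integer m and primes P_1,…,P_J with max{y, P(m)} < P_J < ⋯ < P_1, and inconvenient otherwise. Then, as x → ∞, #{n ≤ x : n inconvenient and gcd(f(n), q) = 1} = o(#{n ≤ x : gcd(f(n), q) = 1}), uniformly in k-admissible moduli q ≤ (log x)^{K_0}; i.e., for every δ > 0 there exists X(δ) such that for all x > X(δ) and all k-admissible q ≤ (log x)^{K_0}, the left-hand count is at most δ times the right-hand count. -/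

import Mathlib

open Polynomial
open scoped Classical

noncomputable section

/-- `f : ℕ → ℤ` is a multiplicative arithmetic function. -/
def IsMultFn (f : ℕ → ℤ) : Prop :=
  f 1 = 1 ∧ ∀ m n : ℕ, Nat.Coprime m n → f (m * n) = f m * f n

/-- The polynomials `F i` are multiplicatively independent over `ℤ`:
no nonzero integer tuple `c` makes `∏ i, (F i) ^ (c i)` identically constant in `ℚ(T)`. -/
def MultIndep {m : ℕ} (F : Fin m → Polynomial ℤ) : Prop :=
  ¬ ∃ c : Fin m → ℤ, c ≠ 0 ∧ ∃ r : ℚ,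
      (∏ i, (algebraMap (Polynomial ℚ) (RatFunc ℚ) ((F i).map (Int.castRingHom ℚ))) ^ (c i))
        = algebraMap ℚ (RatFunc ℚ) r

/-- `β` is the last invariant factor of the exponent matrix of the family `F`
(for some factorization of the `F i` into pairwise non-associated primitive irreducibles,
via a Smith normal form of the exponent matrix). -/
def IsLastInvFactor {m : ℕ} (F : Fin m → Polynomial ℤ) (β : ℤ) : Prop :=
  ∃ (M : ℕ) (G : Fin M → Polynomial ℤ) (c : Fin m → ℤ) (μ : Fin M → Fin m → ℕ),
    (∀ j, Irreducible (G j)) ∧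
    (∀ j, (G j).IsPrimitive) ∧
    (∀ j j', j ≠ j' → ¬ Associated (G j) (G j')) ∧
    (∀ i, F i = Polynomial.C (c i) * ∏ j, G j ^ μ j i) ∧
    (∀ j, ∃ i, 0 < μ j i) ∧
    ∃ (P : Matrix (Fin M) (Fin M) ℤ) (Q : Matrix (Fin m) (Fin m) ℤ),
      IsUnit P.det ∧ IsUnit Q.det ∧
      (∀ (s : Fin M) (t : Fin m), (s : ℕ) ≠ (t : ℕ) →
        (P * (Matrix.of fun u v => (μ u v : ℤ)) * Q) s t = 0) ∧
      (∀ (s s' : Fin M) (t t' : Fin m), (s : ℕ) = (t : ℕ) → (s' : ℕ) = (t' : ℕ) →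
        (s : ℕ) + 1 = (s' : ℕ) →
        (P * (Matrix.of fun u v => (μ u v : ℤ)) * Q) s t ∣
          (P * (Matrix.of fun u v => (μ u v : ℤ)) * Q) s' t') ∧
      (∀ (s : Fin M) (t : Fin m), (s : ℕ) = (t : ℕ) → (s : ℕ) + 1 = min M m →
        β = (P * (Matrix.of fun u v => (μ u v : ℤ)) * Q) s t)

/-- Invariant Factor Hypothesis `IFH(F; B₀)` for the modulus `q`. -/
def IFH {m : ℕ} (F : Fin m → Polynomial ℤ) (B₀ : ℝ) (q : ℕ) : Prop :=
  ∀ β : ℤ, IsLastInvFactor F β →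
    ∀ ℓ : ℕ, ℓ.Prime → ℓ ∣ q → B₀ < (ℓ : ℝ) → Int.gcd ((ℓ : ℤ) - 1) β = 1

/-- `alphaRatio q P`: the proportion of units `u` mod `q` with `P(u)` a unit mod `q`. -/
def alphaRatio (q : ℕ) (P : Polynomial ℤ) : ℝ :=
  (Nat.card {u : (ZMod q)ˣ // IsUnit (Polynomial.aeval ((u : ZMod q)) P)} : ℝ)
    / (Nat.totient q : ℝ)

/-- `q` is `k`-admissible with respect to the family of products `Wprod v`. -/
def KAdmissible (Wprod : ℕ → Polynomial ℤ) (k q : ℕ) : Prop :=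
  (∃ u : (ZMod q)ˣ, IsUnit (Polynomial.aeval ((u : ZMod q)) (Wprod k))) ∧
  ∀ v, 1 ≤ v → v < k → ¬ ∃ u : (ZMod q)ˣ, IsUnit (Polynomial.aeval ((u : ZMod q)) (Wprod v))

/-- Narkiewicz's set `Q(k; f_1, …, f_K)`. -/
def NarkSet {K : ℕ} (k : ℕ) (f : Fin K → ℕ → ℤ) (W : Fin K → ℕ → Polynomial ℤ) : Set ℕ :=
  {q | KAdmissible (fun v => ∏ i, W i v) k q ∧
    ∀ χ : Fin K → DirichletCharacter ℂ q, χ ≠ (fun _ => 1) →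
      (∀ u : (ZMod q)ˣ, IsUnit (Polynomial.aeval ((u : ZMod q)) (∏ i, W i k)) →
          (∏ i, (χ i) (Polynomial.aeval ((u : ZMod q)) (W i k))) = 1) →
      ∃ p : ℕ, p.Prime ∧
        (∑' j : ℕ, (∏ i, (χ i) ((f i (p ^ j) : ZMod q))) *
            ((((p : ℝ) ^ (-(j : ℝ) / (k : ℝ))) : ℝ) : ℂ)) = 0}

/-- `Pj j n`: the `j`-th largest prime factor of `n` counted with multiplicity,
equal to `1` if `Ω(n) < j`. -/
def Pj (j n : ℕ) : ℕ := (n.primeFactorsList.reverse).getD (j - 1) 1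

/-- `nPart k n` is `n_k`, the largest positive integer whose `k`-th power is a
unitary divisor of `n`. -/
def nPart (k n : ℕ) : ℕ :=
  ∏ p ∈ n.primeFactors, if k ∣ n.factorization p then p ^ (n.factorization p / k) else 1

/-- A polynomial is squarefull in `ℤ[T]` iff every complex root has multiplicity at least 2. -/
def SquarefullPoly (F : Polynomial ℤ) : Prop :=
  ∀ z : ℂ, (F.map (Int.castRingHom ℂ)).IsRoot z →
    2 ≤ (F.map (Int.castRingHom ℂ)).rootMultiplicity z

/-- `n` is convenient (with respect to exponent `k`, threshold `y` and length `J`). -/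
def Convenient (k : ℕ) (y : ℝ) (J : ℕ) (n : ℕ) : Prop :=
  ∃ (m : ℕ) (P : Fin J → ℕ), 0 < m ∧ (∀ t, (P t).Prime) ∧
    (∀ s t : Fin J, s < t → P t < P s) ∧
    (∀ t, y < (P t : ℝ) ∧ Pj 1 m < P t) ∧
    n = m * (∏ t, P t) ^ k

/-- The solution count `Ṽ_{N,K}(q; (w_i))`. -/
def VNK {K N : ℕ} (F : Fin K → Fin N → Polynomial ℤ) (q : ℕ) (w : Fin K → ZMod q) : ℕ :=
  Nat.card {v : Fin N → (ZMod q)ˣ //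
    ∀ i, (∏ j, Polynomial.aeval ((v j : ZMod q)) (F i j)) = w i}

/-- `α*_N(q) = ∏_j α̃_j(q)`. -/
def alphaStarN {K N : ℕ} (F : Fin K → Fin N → Polynomial ℤ) (q : ℕ) : ℝ :=
  ∏ j, alphaRatio q (∏ i, F i j)

/-- `n` is `r`-full: every prime dividing `n` divides it to the `r`-th power. -/
def IsRFull (r n : ℕ) : Prop := ∀ p : ℕ, p.Prime → p ∣ n → p ^ r ∣ n

/-- The `k`-free part of `n`. -/
def kfreePart (k n : ℕ) : ℕ :=
  ∏ p ∈ n.primeFactors, if n.factorization p < k then p ^ n.factorization p else 1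

namespace Nark

open ArithmeticFunction

/-- The integers in the half-open real interval `(s, t]`. -/
def win (s t : ℝ) : Finset ℕ := Finset.Ioc ⌊s⌋₊ ⌊t⌋₊

lemma mem_win {s t : ℝ} (hs : 0 ≤ s) (n : ℕ) : n ∈ win s t ↔ s < n ∧ (n : ℝ) ≤ t := by
  rw [win, Finset.mem_Ioc, Nat.floor_lt hs]
  constructor
  · rintro ⟨h1, h2⟩
    have hn : n ≠ 0 := by
      rintro rfl
      simp at h1
      linarith
    exact ⟨h1, (Nat.le_floor_iff' hn).1 h2⟩
  · rintro ⟨h1, h2⟩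
    exact ⟨h1, Nat.le_floor h2⟩

lemma pos_of_mem_win {s t : ℝ} {n : ℕ} (h : n ∈ win s t) : 0 < n := by
  rw [win, Finset.mem_Ioc] at h
  omega

lemma mul_mem_win_iff {s t : ℝ} (d m : ℕ) :
    d * m ∈ win s t ↔ (d ≠ 0 ∧ m ∈ win (s / d) (t / d)) := by
  rcases Nat.eq_zero_or_pos d with rfl | hd
  · simp [win]
  · rw [win, win, Finset.mem_Ioc, Finset.mem_Ioc, Nat.floor_div_natCast, Nat.floor_div_natCast,
      Nat.div_lt_iff_lt_mul hd, Nat.le_div_iff_mul_le hd]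
    simp [mul_comm, hd.ne']

lemma win_subset_win {s t s' t' : ℝ} (h1 : s' ≤ s) (h2 : t ≤ t') : win s t ⊆ win s' t' := by
  apply Finset.Ioc_subset_Ioc (Nat.floor_mono h1) (Nat.floor_mono h2)

lemma sum_log_Ioc_le (N : ℕ) : ∑ n ∈ Finset.Ioc 0 N, Real.log n ≤ N * Real.log N := by
  have : ∀ n ∈ Finset.Ioc 0 N, Real.log n ≤ Real.log N := by
    intro n hn
    rw [Finset.mem_Ioc] at hn
    exact Real.log_le_log (by exact_mod_cast hn.1) (by exact_mod_cast hn.2)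
  simpa using Finset.sum_le_card_nsmul _ _ _ this

lemma le_sum_log_Ioc (N : ℕ) : N * Real.log N - N ≤ ∑ n ∈ Finset.Ioc 0 N, Real.log n := by
  induction N with
  | zero => simp
  | succ N ih =>
    rw [Finset.sum_Ioc_succ_top (Nat.zero_le N)]
    rcases Nat.eq_zero_or_pos N with rfl | hN
    · simp
    have hN' : (0 : ℝ) < N := by exact_mod_cast hN
    have h1 : Real.log ((N + 1 : ℝ) / N) ≤ (N + 1 : ℝ) / N - 1 :=
      Real.log_le_sub_one_of_pos (by positivity)
    rw [Real.log_div (by positivity) (by positivity)] at h1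
    have h2 : (N + 1 : ℝ) / N - 1 = 1 / N := by field_simp; ring
    rw [h2] at h1
    have h3 : N * (Real.log (N + 1 : ℝ) - Real.log N) ≤ 1 := by
      calc _ ≤ N * (1 / (N : ℝ)) := by gcongr
        _ = 1 := by field_simp
    push_cast
    nlinarith

lemma sum_log_eq (N : ℕ) :
    ∑ n ∈ Finset.Ioc 0 N, Real.log n = ∑ d ∈ Finset.Ioc 0 N, Λ d * ((N / d : ℕ) : ℝ) := by
  rw [← sum_Ioc_mul_zeta_eq_sum, vonMangoldt_mul_zeta]
  simp [log_apply]

lemma sum_vonMangoldt_div_le (N : ℕ) (hN : 1 ≤ N) :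
    ∑ n ∈ Finset.Ioc 0 N, Λ n / n ≤ Real.log N + 6 := by
  have hN' : (0 : ℝ) < N := by exact_mod_cast hN
  have h1 : ∑ n ∈ Finset.Ioc 0 N, Λ n * ((N : ℝ) / n - 1) ≤ ∑ n ∈ Finset.Ioc 0 N, Real.log n := by
    rw [sum_log_eq]
    apply Finset.sum_le_sum
    intro n hn
    have : 0 < n := (Finset.mem_Ioc.1 hn).1
    apply mul_le_mul_of_nonneg_left _ vonMangoldt_nonneg
    have h := Nat.lt_floor_add_one ((N : ℝ) / n)
    rw [Nat.floor_div_natCast, Nat.floor_natCast] at h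
    linarith
  have h2 := sum_log_Ioc_le N
  have h3 := Chebyshev.psi_le_const_mul_self (x := N) hN'.le
  have h4 : ∑ n ∈ Finset.Ioc 0 N, Λ n * ((N : ℝ) / n - 1)
      = N * ∑ n ∈ Finset.Ioc 0 N, Λ n / n - Chebyshev.psi N := by
    rw [Chebyshev.psi, Nat.floor_natCast, Finset.mul_sum, ← Finset.sum_sub_distrib]
    apply Finset.sum_congr rfl
    intros
    ring
  have h5 : Real.log 4 ≤ 2 := by
    have : (4 : ℝ) = 2 ^ 2 := by norm_num
    rw [this, Real.log_pow]
    have := Real.log_two_lt_d9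
    push_cast
    linarith
  have h6 : (N : ℝ) * ∑ n ∈ Finset.Ioc 0 N, Λ n / n ≤ N * (Real.log N + 6) := by
    nlinarith
  exact le_of_mul_le_mul_left h6 hN'

lemma le_sum_vonMangoldt_div (N : ℕ) (hN : 1 ≤ N) :
    Real.log N - 1 ≤ ∑ n ∈ Finset.Ioc 0 N, Λ n / n := by
  have hN' : (0 : ℝ) < N := by exact_mod_cast hN
  have h1 : ∑ n ∈ Finset.Ioc 0 N, Real.log n ≤ ∑ n ∈ Finset.Ioc 0 N, Λ n * ((N : ℝ) / n) := by
    rw [sum_log_eq]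
    apply Finset.sum_le_sum
    intro n hn
    exact mul_le_mul_of_nonneg_left Nat.cast_div_le vonMangoldt_nonneg
  have h2 := le_sum_log_Ioc N
  have h4 : ∑ n ∈ Finset.Ioc 0 N, Λ n * ((N : ℝ) / n)
      = N * ∑ n ∈ Finset.Ioc 0 N, Λ n / n := by
    rw [Finset.mul_sum]
    apply Finset.sum_congr rfl
    intros
    ring
  have h6 : (N : ℝ) * (Real.log N - 1) ≤ N * ∑ n ∈ Finset.Ioc 0 N, Λ n / n := by
    nlinarith
  exact le_of_mul_le_mul_left h6 hN'

lemma sum_win_eq_sub {s t : ℝ} (hst : s ≤ t) (g : ℕ → ℝ) :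
    ∑ n ∈ win s t, g n = ∑ n ∈ Finset.Ioc 0 ⌊t⌋₊, g n - ∑ n ∈ Finset.Ioc 0 ⌊s⌋₊, g n := by
  rw [win, eq_sub_iff_add_eq, add_comm, Finset.sum_Ioc_consecutive _ (Nat.zero_le _)
    (Nat.floor_mono hst)]

lemma mertens_upper_floor {t : ℝ} (ht : 1 ≤ t) :
    ∑ n ∈ Finset.Ioc 0 ⌊t⌋₊, Λ n / n ≤ Real.log t + 6 := by
  have h1 : 1 ≤ ⌊t⌋₊ := Nat.le_floor (by simpa using ht)
  have := Real.log_le_log (by exact_mod_cast h1) (Nat.floor_le (zero_le_one.trans ht))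
  linarith [sum_vonMangoldt_div_le _ h1]

lemma mertens_lower_floor {t : ℝ} (ht : 1 ≤ t) :
    Real.log t - 2 ≤ ∑ n ∈ Finset.Ioc 0 ⌊t⌋₊, Λ n / n := by
  have h1 : 1 ≤ ⌊t⌋₊ := Nat.le_floor (by simpa using ht)
  have h1' : (1 : ℝ) ≤ ⌊t⌋₊ := by exact_mod_cast h1
  have h2 : t ≤ 2 * ⌊t⌋₊ := by linarith [Nat.lt_floor_add_one t]
  have := Real.log_le_log (by linarith) h2
  rw [Real.log_mul (by norm_num) (by positivity)] at this
  linarith [le_sum_vonMangoldt_div _ h1, Real.log_two_lt_d9]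

lemma mertens_win_le {s t : ℝ} (hs : 0 < s) (hst : s ≤ t) :
    ∑ n ∈ win s t, Λ n / n ≤ Real.log (t / s) + 8 := by
  rw [sum_win_eq_sub hst, Real.log_div (hs.trans_le hst).ne' hs.ne']
  rcases le_or_gt 1 s with h | h
  · linarith [mertens_upper_floor (h.trans hst), mertens_lower_floor h]
  · have h0 : ⌊s⌋₊ = 0 := Nat.floor_eq_zero.2 h
    have := Real.log_neg hs h
    rw [h0]
    rcases le_or_gt 1 t with h' | h'
    · simp
      linarith [mertens_upper_floor h']
    · have h0' : ⌊t⌋₊ = 0 := Nat.floor_eq_zero.2 h'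
      have := Real.log_le_log hs hst
      simp [h0']
      linarith

lemma le_mertens_win {s t : ℝ} (hs : 1 ≤ s) (hst : s ≤ t) :
    Real.log (t / s) - 8 ≤ ∑ n ∈ win s t, Λ n / n := by
  have hs0 : 0 < s := by linarith
  rw [sum_win_eq_sub hst, Real.log_div (hs0.trans_le hst).ne' hs0.ne']
  linarith [mertens_upper_floor hs, mertens_lower_floor (hs.trans hst)]

/-- Selberg's second von Mangoldt function. -/
def lamTwo : ArithmeticFunction ℝ := pmul Λ log + Λ * Λ

lemma lamTwo_nonneg (n : ℕ) : 0 ≤ lamTwo n := by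
  rw [lamTwo, ArithmeticFunction.add_apply, pmul_apply, mul_apply, log_apply]
  have h1 : 0 ≤ Real.log n := Real.log_natCast_nonneg n
  have h2 := @vonMangoldt_nonneg
  exact add_nonneg (mul_nonneg h2 h1) (Finset.sum_nonneg fun _ _ => mul_nonneg h2 h2)

lemma lamTwo_mul_zeta : lamTwo * (zeta : ArithmeticFunction ℝ) = pmul log log := by
  have key : pmul Λ log * (zeta : ArithmeticFunction ℝ) + Λ * log = pmul log log := by
    ext n
    have h0 : (pmul log log) n = (Λ * (zeta : ArithmeticFunction ℝ)) n * log n := by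
      rw [vonMangoldt_mul_zeta, pmul_apply]
    rw [h0, ArithmeticFunction.add_apply, mul_apply, mul_apply, ← Finset.sum_add_distrib,
      mul_apply, Finset.sum_mul]
    apply Finset.sum_congr rfl
    intro x hx
    rw [Nat.mem_divisorsAntidiagonal] at hx
    have h1 : x.1 ≠ 0 := by rintro h; simp [h] at hx; omega
    have h2 : x.2 ≠ 0 := by rintro h; simp [h] at hx; omega
    rw [← hx.1]
    simp only [pmul_apply, log_apply, natCoe_apply, zeta_apply, h2, if_false]
    push_cast
    rw [Real.log_mul (by exact_mod_cast h1) (by exact_mod_cast h2)]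
    ring
  rw [← key, lamTwo, add_mul, mul_assoc, vonMangoldt_mul_zeta]

lemma lamTwo_eq : lamTwo = (moebius : ArithmeticFunction ℝ) * pmul log log := by
  rw [← lamTwo_mul_zeta, mul_comm lamTwo, ← mul_assoc, coe_moebius_mul_coe_zeta, one_mul]

lemma sum_win_mul_apply (F G : ArithmeticFunction ℝ) (h : ℕ → ℝ) (Y X : ℝ) (N : ℕ)
    (hN : ⌊X⌋₊ ≤ N) :
    ∑ n ∈ win Y X, (F * G) n * h n =
      ∑ d ∈ Finset.Ioc 0 N, ∑ m ∈ win (Y / d) (X / d), F d * G m * h (d * m) := by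
  simp only [mul_apply, Finset.sum_mul]
  rw [Finset.sum_sigma', Finset.sum_sigma']
  refine Finset.sum_bij' (fun p _ => ⟨p.2.1, p.2.2⟩) (fun p _ => ⟨p.1 * p.2, (p.1, p.2)⟩)
    ?_ ?_ ?_ ?_ ?_
  · rintro ⟨n, d, m⟩ hp
    simp only [Finset.mem_sigma, Nat.mem_divisorsAntidiagonal] at hp ⊢
    obtain ⟨h1, h2, h3⟩ := hp
    rw [← h2, mul_mem_win_iff] at h1
    refine ⟨?_, h1.2⟩
    rw [Finset.mem_Ioc]
    refine ⟨Nat.pos_of_ne_zero h1.1, ?_⟩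
    have h4 := (mul_mem_win_iff d m).2 h1
    rw [win, Finset.mem_Ioc] at h4
    have h5 : 0 < m := pos_of_mem_win h1.2
    calc d ≤ d * m := Nat.le_mul_of_pos_right d h5
      _ ≤ _ := h4.2.trans hN
  · rintro ⟨d, m⟩ hp
    simp only [Finset.mem_sigma, Nat.mem_divisorsAntidiagonal, Finset.mem_Ioc] at hp ⊢
    refine ⟨(mul_mem_win_iff d m).2 ⟨by omega, hp.2⟩, trivial, ?_⟩
    have h5 : 0 < m := pos_of_mem_win hp.2
    exact Nat.mul_ne_zero (by omega) (by omega)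
  · rintro ⟨n, d, m⟩ hp
    simp only [Finset.mem_sigma, Nat.mem_divisorsAntidiagonal] at hp ⊢
    obtain ⟨h1, h2, h3⟩ := hp
    subst h2
    rfl
  · rintro ⟨d, m⟩ hp
    rfl
  · rintro ⟨n, d, m⟩ hp
    simp only [Finset.mem_sigma, Nat.mem_divisorsAntidiagonal] at hp ⊢
    rw [hp.2.1]

lemma abel_discrete_aux (e φ : ℕ → ℝ) (a : ℕ) (B : ℝ) (n : ℕ)
    (hE : ∀ t, a ≤ t → t ≤ a + n → |∑ i ∈ Finset.Ioc a t, e i| ≤ B)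
    (hφ : ∀ i, a + 1 ≤ i → i + 1 ≤ a + n → φ (i + 1) ≤ φ i) (hn : 1 ≤ n) :
    |∑ i ∈ Finset.Ioc a (a + n), φ i * e i - φ (a + n) * ∑ i ∈ Finset.Ioc a (a + n), e i|
      ≤ (φ (a + 1) - φ (a + n)) * B := by
  induction n, hn using Nat.le_induction with
  | base => simp
  | succ n hn ih =>
    have ih' := ih (fun t h1 h2 => hE t h1 (by omega)) (fun i h1 h2 => hφ i h1 (by omega))
    have h1 := hφ (a + n) (by omega) (by omega)
    have h2 := hE (a + n) (by omega) (by omega)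
    rw [← add_assoc, Finset.sum_Ioc_succ_top (by omega), Finset.sum_Ioc_succ_top (by omega)]
    set S := ∑ i ∈ Finset.Ioc a (a + n), φ i * e i
    set E := ∑ i ∈ Finset.Ioc a (a + n), e i
    have h3 : S + φ (a + n + 1) * e (a + n + 1) - φ (a + n + 1) * (E + e (a + n + 1))
        = (S - φ (a + n) * E) + (φ (a + n) - φ (a + n + 1)) * E := by ring
    rw [h3]
    refine (abs_add_le _ _).trans ?_
    rw [abs_mul, abs_of_nonneg (by linarith : 0 ≤ φ (a + n) - φ (a + n + 1))]
    have h4 : (φ (a + n) - φ (a + n + 1)) * |E| ≤ (φ (a + n) - φ (a + n + 1)) * B :=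
      mul_le_mul_of_nonneg_left h2 (by linarith)
    linarith

/-- Discrete partial summation: an antitone nonnegative weight against a sequence with
bounded partial sums. -/
lemma abel_discrete (e φ : ℕ → ℝ) (a b : ℕ) (B : ℝ) (hab : a < b)
    (hE : ∀ t, a ≤ t → t ≤ b → |∑ i ∈ Finset.Ioc a t, e i| ≤ B)
    (hφ : ∀ i, a + 1 ≤ i → i + 1 ≤ b → φ (i + 1) ≤ φ i) (h0 : 0 ≤ φ b) :
    |∑ i ∈ Finset.Ioc a b, φ i * e i| ≤ φ (a + 1) * B := by
  obtain ⟨n, rfl⟩ := Nat.exists_eq_add_of_lt hab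
  rw [add_assoc] at *
  have h1 := abel_discrete_aux e φ a B (n + 1) hE hφ (by omega)
  have h2 := mul_le_mul_of_nonneg_left (hE (a + (n + 1)) (by omega) le_rfl) h0
  rw [← abs_of_nonneg h0, ← abs_mul, abs_of_nonneg h0] at h2
  have h3 := abs_sub_abs_le_abs_sub (∑ i ∈ Finset.Ioc a (a + (n + 1)), φ i * e i)
    (φ (a + (n + 1)) * ∑ i ∈ Finset.Ioc a (a + (n + 1)), e i)
  linarith

lemma card_class_bounds {r : ℕ} (hr : 0 < r) (c : ZMod r) {A B : ℕ} (hAB : A ≤ B) :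
    |(((Finset.Ioc A B).filter fun n : ℕ => (n : ZMod r) = c).card : ℝ) - ((B : ℝ) - A) / r| ≤ 1 := by
  have : NeZero r := ⟨hr.ne'⟩
  obtain ⟨v, rfl⟩ := ZMod.natCast_zmod_surjective c
  have h1 := Nat.Ioc_filter_modEq_card A B hr v
  have h2 : ((Finset.Ioc A B).filter fun n : ℕ => (n : ZMod r) = v)
      = (Finset.Ioc A B).filter fun n : ℕ => n ≡ v [MOD r] := by
    ext n
    simp [ZMod.natCast_eq_natCast_iff]
  rw [h2]
  have hr' : (0 : ℚ) < r := by exact_mod_cast hr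
  have hle : ((A : ℚ) - v) / r ≤ ((B : ℚ) - v) / r := by
    have : (A : ℚ) ≤ B := by exact_mod_cast hAB
    gcongr
  have h3 : (((Finset.Ioc A B).filter fun n : ℕ => n ≡ v [MOD r]).card : ℤ) =
      ⌊((B : ℚ) - v) / r⌋ - ⌊((A : ℚ) - v) / r⌋ := by
    have h3 := Int.floor_mono hle
    convert h1.trans (max_eq_left (sub_nonneg.2 h3))
  have h4 := Int.floor_le (((B : ℚ) - v) / r)
  have h5 := Int.lt_floor_add_one (((B : ℚ) - v) / r)
  have h6 := Int.floor_le (((A : ℚ) - v) / r)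
  have h7 := Int.lt_floor_add_one (((A : ℚ) - v) / r)
  have h8 : (((Finset.Ioc A B).filter fun n : ℕ => n ≡ v [MOD r]).card : ℚ) =
      ⌊((B : ℚ) - v) / r⌋ - ⌊((A : ℚ) - v) / r⌋ := by exact_mod_cast h3
  have h9 : |(((Finset.Ioc A B).filter fun n : ℕ => n ≡ v [MOD r]).card : ℚ) -
      ((B : ℚ) - A) / r| ≤ 1 := by
    rw [h8, abs_le]
    have : ((B : ℚ) - A) / r = ((B : ℚ) - v) / r - ((A : ℚ) - v) / r := by ring
    rw [this]
    constructor <;> linarith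
  have h10 := (Rat.cast_le (K := ℝ)).2 h9
  push_cast at h10
  exact h10

/-- The weight `log² z / z`. -/
def logSqDiv (z : ℝ) : ℝ := Real.log z ^ 2 / z

lemma logSqDiv_nonneg {z : ℝ} (hz : 0 ≤ z) : 0 ≤ logSqDiv z := by
  unfold logSqDiv; positivity

lemma logSqDiv_antitone {z w : ℝ} (hz : Real.exp 2 ≤ z) (hzw : z ≤ w) :
    logSqDiv w ≤ logSqDiv z := by
  have h1 := Real.log_div_sqrt_antitoneOn (Set.mem_Ici.2 hz) (Set.mem_Ici.2 (hz.trans hzw)) hzw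
  have hz0 : 0 < z := (Real.exp_pos 2).trans_le hz
  have hz1 : 1 ≤ z := (Real.one_le_exp (by norm_num)).trans hz
  have key : ∀ u : ℝ, 0 < u → logSqDiv u = (Real.log u / √u) ^ 2 := by
    intro u hu
    rw [logSqDiv, div_pow, Real.sq_sqrt hu.le]
  rw [key z hz0, key w (hz0.trans_le hzw)]
  have : 0 ≤ Real.log w / √w := div_nonneg (Real.log_nonneg (hz1.trans hzw)) (Real.sqrt_nonneg _)
  exact pow_le_pow_left₀ this h1 2

lemma logSqDiv_le {z : ℝ} (hz : 1 ≤ z) : logSqDiv z ≤ 16 / √z := by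
  have h1 := Real.log_le_rpow_div (zero_le_one.trans hz) (by norm_num : (0 : ℝ) < 1 / 4)
  have h0 : 0 ≤ Real.log z := Real.log_nonneg hz
  have hz0 : 0 < z := by linarith
  have h2 : Real.log z ^ 2 ≤ (z ^ (1 / 4 : ℝ) / (1 / 4)) ^ 2 := pow_le_pow_left₀ h0 h1 2
  have h3 : (z ^ (1 / 4 : ℝ) / (1 / 4)) ^ 2 = 16 * √z := by
    rw [div_pow, Real.sqrt_eq_rpow, ← Real.rpow_natCast, ← Real.rpow_mul hz0.le]
    norm_num
    ring
  rw [h3] at h2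
  have hs : 0 < √z := Real.sqrt_pos.2 hz0
  rw [logSqDiv, div_le_div_iff₀ hz0 hs]
  nlinarith [Real.sq_sqrt hz0.le]

lemma sum_one_div_sqrt_le (N : ℕ) : ∑ d ∈ Finset.Ioc 0 N, 1 / √(d : ℝ) ≤ 2 * √N := by
  induction N with
  | zero => simp
  | succ N ih =>
    rw [Finset.sum_Ioc_succ_top (Nat.zero_le N)]
    have h1 : 0 < √((N + 1 : ℕ) : ℝ) := Real.sqrt_pos.2 (by positivity)
    have h2 : 0 ≤ √(N : ℝ) := Real.sqrt_nonneg _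
    have h3 : √(N : ℝ) ^ 2 = N := Real.sq_sqrt (by positivity)
    have h4 : √((N + 1 : ℕ) : ℝ) ^ 2 = N + 1 := by
      rw [Real.sq_sqrt (by positivity)]; push_cast; rfl
    have h5 : 1 / √((N + 1 : ℕ) : ℝ) ≤ 2 * √((N + 1 : ℕ) : ℝ) - 2 * √(N : ℝ) := by
      rw [div_le_iff₀ h1]
      nlinarith [sq_nonneg (√((N + 1 : ℕ) : ℝ) - √(N : ℝ))]
    linarith

lemma sum_le_sum_of_injOn {ι κ : Type*} {s : Finset ι} {t : Finset κ} {f : ι → ℝ} {g : κ → ℝ}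
    (e : ι → κ) (hmaps : ∀ i ∈ s, e i ∈ t) (hinj : Set.InjOn e s)
    (hfg : ∀ i ∈ s, f i ≤ g (e i)) (hg : ∀ j ∈ t, 0 ≤ g j) :
    ∑ i ∈ s, f i ≤ ∑ j ∈ t, g j := by
  calc ∑ i ∈ s, f i ≤ ∑ i ∈ s, g (e i) := Finset.sum_le_sum hfg
    _ = ∑ j ∈ s.image e, g j := (Finset.sum_image hinj).symm
    _ ≤ _ := by
      apply Finset.sum_le_sum_of_subset_of_nonneg
      · intro j hj
        obtain ⟨i, hi, rfl⟩ := Finset.mem_image.1 hj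
        exact hmaps i hi
      · intro j hj _
        exact hg j hj

/-- Logarithmic sum of `g` over the integers of `(Y, X]` in the residue class `a`. -/
def clsSum (r : ℕ) (g : ℕ → ℝ) (Y X : ℝ) (a : ZMod r) : ℝ :=
  ∑ n ∈ (win Y X).filter (fun n : ℕ => (n : ZMod r) = a), g n / n

lemma clsSum_nonneg {r : ℕ} {g : ℕ → ℝ} (hg : ∀ n, 0 ≤ g n) (Y X : ℝ) (a : ZMod r) :
    0 ≤ clsSum r g Y X a :=
  Finset.sum_nonneg fun n _ => div_nonneg (hg n) (Nat.cast_nonneg n)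

lemma logSq_class_diff {r : ℕ} (hr : 0 < r) (c c' : ZMod r) {s t : ℝ}
    (hs : Real.exp 2 ≤ s) (hst : s ≤ t) :
    |∑ m ∈ win s t, logSqDiv m * ((if (m : ZMod r) = c then 1 else 0) -
      (if (m : ZMod r) = c' then 1 else 0))| ≤ 32 / √s := by
  have hs0 : 0 < s := (Real.exp_pos 2).trans_le hs
  have hs1 : 1 ≤ s := (Real.one_le_exp (by norm_num)).trans hs
  rw [win]
  rcases (Nat.floor_mono hst).eq_or_lt with h | hab
  · rw [h]
    simp
    positivity
  have hlt : s < (⌊s⌋₊ + 1 : ℕ) := by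
    push_cast
    exact Nat.lt_floor_add_one s
  refine (abel_discrete _ (fun m => logSqDiv m) ⌊s⌋₊ ⌊t⌋₊ 2 hab ?_ ?_ ?_).trans ?_
  · intro u hu _
    rw [Finset.sum_sub_distrib, ← Finset.sum_filter, ← Finset.sum_filter]
    have h1 := card_class_bounds hr c hu
    have h2 := card_class_bounds hr c' hu
    simp only [Finset.sum_const, nsmul_eq_mul, mul_one]
    rw [abs_le] at *
    constructor <;> linarith
  · intro i hi _
    apply logSqDiv_antitone
    · have : ((⌊s⌋₊ + 1 : ℕ) : ℝ) ≤ i := by exact_mod_cast hi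
      linarith
    · push_cast
      linarith
  · exact logSqDiv_nonneg (Nat.cast_nonneg _)
  · have h1 := logSqDiv_le (hs1.trans hlt.le)
    have h2 : 16 / √((⌊s⌋₊ + 1 : ℕ) : ℝ) ≤ 16 / √s := by
      have := Real.sqrt_le_sqrt hlt.le
      have := Real.sqrt_pos.2 hs0
      gcongr
    have h3 : 32 / √s = 16 / √s * 2 := by ring
    rw [h3]
    exact mul_le_mul_of_nonneg_right (h1.trans h2) (by norm_num)

lemma sum_inv_class_le {r : ℕ} (hr : 0 < r) (c : ZMod r) {s t : ℝ} (hs : 0 < s) (hst : s ≤ t) :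
    ∑ m ∈ win s t, (if (m : ZMod r) = c then 1 else 0) / (m : ℝ) ≤ (t / r + 1) / s := by
  have h1 := (abs_le.1 (card_class_bounds hr c (Nat.floor_mono hst))).2
  have h2 : ∑ m ∈ win s t, (if (m : ZMod r) = c then 1 else 0) / (m : ℝ) ≤
      ∑ m ∈ win s t, (if (m : ZMod r) = c then (1 : ℝ) else 0) * (1 / s) := by
    apply Finset.sum_le_sum
    intro m hm
    rw [mem_win hs.le] at hm
    rw [mul_one_div]
    have := hm.1
    split_ifs
    · gcongr
    · simp
  refine h2.trans ?_
  rw [← Finset.sum_mul, mul_one_div, ← Finset.sum_filter, Finset.sum_const, nsmul_eq_mul, mul_one]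
  have h3 : ((⌊t⌋₊ : ℝ) - ⌊s⌋₊) / r ≤ t / r := by
    have := Nat.floor_le (hs.le.trans hst)
    have : (0 : ℝ) ≤ ⌊s⌋₊ := Nat.cast_nonneg _
    gcongr
    linarith
  rw [win]
  gcongr
  linarith

/-- Contribution of the divisor `d` to the class sum of `Λ₂`. -/
def fibSum (r : ℕ) (Y X : ℝ) (a : ZMod r) (d : ℕ) : ℝ :=
  ∑ m ∈ win (Y / d) (X / d), Real.log m ^ 2 *
    ((if ((d * m : ℕ) : ZMod r) = a then 1 else 0) / ((d * m : ℕ) : ℝ))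

lemma clsSum_lamTwo_eq {r : ℕ} (Y X : ℝ) (a : ZMod r) :
    clsSum r lamTwo Y X a = ∑ d ∈ Finset.Ioc 0 ⌊X⌋₊, (moebius d : ℝ) * fibSum r Y X a d := by
  rw [clsSum, Finset.sum_filter]
  have h := sum_win_mul_apply (moebius : ArithmeticFunction ℝ) (pmul log log)
    (fun n => (if ((n : ℕ) : ZMod r) = a then 1 else 0) / (n : ℝ)) Y X _ le_rfl
  rw [← lamTwo_eq] at h
  calc _ = ∑ n ∈ win Y X, lamTwo n * ((if ((n : ℕ) : ZMod r) = a then 1 else 0) / (n : ℝ)) := by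
        apply Finset.sum_congr rfl
        intro n _
        split_ifs <;> simp [div_eq_mul_inv]
    _ = _ := by
        rw [h]
        apply Finset.sum_congr rfl
        intro d _
        rw [fibSum, Finset.mul_sum]
        apply Finset.sum_congr rfl
        intro m _
        simp only [pmul_apply, log_apply, intCoe_apply]
        ring

lemma natCast_mul_eq_iff {r d m : ℕ} (hd : d.Coprime r) (a : ZMod r) :
    ((d * m : ℕ) : ZMod r) = a ↔ (m : ZMod r) = ((ZMod.unitOfCoprime d hd)⁻¹ : (ZMod r)ˣ) * a := by
  rw [Units.eq_inv_mul_iff_mul_eq, Nat.cast_mul, ZMod.coe_unitOfCoprime]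

lemma not_natCast_mul_eq {r d : ℕ} (hd : ¬ d.Coprime r) (m : ℕ) (a : (ZMod r)ˣ) :
    ((d * m : ℕ) : ZMod r) ≠ a := by
  intro h
  apply hd
  have h1 : IsUnit ((d * m : ℕ) : ZMod r) := h ▸ a.isUnit
  rw [ZMod.isUnit_iff_coprime] at h1
  exact Nat.Coprime.coprime_mul_right h1

lemma fibSum_eq_zero {r d : ℕ} (hd : ¬ d.Coprime r) (Y X : ℝ) (a : (ZMod r)ˣ) :
    fibSum r Y X a d = 0 := by
  apply Finset.sum_eq_zero
  intro m _
  rw [if_neg (not_natCast_mul_eq hd m a)]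
  simp

lemma fibSum_nonneg {r : ℕ} (d : ℕ) (Y X : ℝ) (a : ZMod r) : 0 ≤ fibSum r Y X a d := by
  apply Finset.sum_nonneg
  intro m _
  split_ifs <;> positivity

lemma fibSum_diff_le {r : ℕ} (hr : 0 < r) {d : ℕ} (hd : 0 < d) (Y X : ℝ) (a b : (ZMod r)ˣ)
    (hY : Real.exp 2 ≤ Y / d) (hYX : Y ≤ X) :
    |fibSum r Y X a d - fibSum r Y X b d| ≤ 32 / √Y * (1 / √(d : ℝ)) := by
  have hd' : (0 : ℝ) < d := by exact_mod_cast hd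
  by_cases hc : d.Coprime r
  · have h1 := logSq_class_diff hr (((ZMod.unitOfCoprime d hc)⁻¹ : (ZMod r)ˣ) * a)
      (((ZMod.unitOfCoprime d hc)⁻¹ : (ZMod r)ˣ) * b) hY
      (by gcongr : Y / d ≤ X / d)
    have hY0 : 0 ≤ Y := by
      have : 0 < Y / d := (Real.exp_pos 2).trans_le hY
      exact ((div_pos_iff_of_pos_right hd').1 this).le
    have h2 : fibSum r Y X a d - fibSum r Y X b d = (1 / d) *
        ∑ m ∈ win (Y / d) (X / d), logSqDiv m *
        ((if (m : ZMod r) = ((ZMod.unitOfCoprime d hc)⁻¹ : (ZMod r)ˣ) * a then 1 else 0) -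
      (if (m : ZMod r) = ((ZMod.unitOfCoprime d hc)⁻¹ : (ZMod r)ˣ) * b then 1 else 0)) := by
      rw [fibSum, fibSum, ← Finset.sum_sub_distrib, Finset.mul_sum]
      apply Finset.sum_congr rfl
      intro m _
      simp only [natCast_mul_eq_iff hc]
      rw [logSqDiv]
      push_cast
      field_simp
    rw [h2, abs_mul, abs_of_nonneg (by positivity)]
    calc _ ≤ 1 / (d : ℝ) * (32 / √(Y / d)) := by gcongr
      _ = _ := by
        rw [Real.sqrt_div hY0]
        have : 0 < √(d : ℝ) := Real.sqrt_pos.2 hd'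
        have h3 : √(d : ℝ) * √(d : ℝ) = d := Real.mul_self_sqrt hd'.le
        have h4 : 1 / (d : ℝ) = 1 / (√(d : ℝ) * √(d : ℝ)) := by rw [h3]
        rw [h4]
        field_simp
  · rw [fibSum_eq_zero hc, fibSum_eq_zero hc]
    simp
    positivity

lemma sum_inv_Ioc_le (N : ℕ) (hN : 1 ≤ N) :
    ∑ m ∈ Finset.Ioc 0 N, 1 / (m : ℝ) ≤ 1 + Real.log N := by
  have := harmonic_floor_le_one_add_log N (by exact_mod_cast hN)
  rw [Nat.floor_natCast, harmonic_eq_sum_Icc] at this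
  push_cast at this
  simpa [← Finset.Icc_add_one_left_eq_Ioc] using this

lemma sum_logSqDiv_le (T : ℝ) (hT : 1 ≤ T) :
    ∑ m ∈ Finset.Ioc 0 ⌊T⌋₊, logSqDiv m ≤ (1 + Real.log T) ^ 3 := by
  have h1 : 1 ≤ ⌊T⌋₊ := Nat.le_floor (by simpa using hT)
  have h2 := sum_inv_Ioc_le _ h1
  have h3 : Real.log ⌊T⌋₊ ≤ Real.log T :=
    Real.log_le_log (by exact_mod_cast h1) (Nat.floor_le (by linarith))
  have h0 : 0 ≤ Real.log T := Real.log_nonneg hT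
  have h4 : ∑ m ∈ Finset.Ioc 0 ⌊T⌋₊, logSqDiv m ≤
      ∑ m ∈ Finset.Ioc 0 ⌊T⌋₊, Real.log T ^ 2 * (1 / (m : ℝ)) := by
    apply Finset.sum_le_sum
    intro m hm
    rw [Finset.mem_Ioc] at hm
    rw [logSqDiv, mul_one_div]
    have h5 : Real.log m ≤ Real.log T := (Real.log_le_log (by exact_mod_cast hm.1)
      (by exact_mod_cast hm.2)).trans h3
    have h6 : 0 ≤ Real.log m := Real.log_natCast_nonneg m
    gcongr
  rw [← Finset.mul_sum] at h4
  refine h4.trans ?_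
  calc _ ≤ (1 + Real.log T) ^ 2 * (1 + Real.log T) := by
        gcongr
        · linarith
        · linarith
    _ = _ := by ring

/-- The tail divisors contribute little to each class. -/
lemma sum_fibSum_tail_le {r : ℕ} (hr : 0 < r) {Y X w : ℝ} (a : (ZMod r)ˣ) (hY : 0 < Y)
    (hYX : Y ≤ X) (hw : 1 ≤ w) :
    ∑ d ∈ (Finset.Ioc 0 ⌊X⌋₊).filter (fun d : ℕ => Y / d < w), fibSum r Y X a d ≤
      (1 + Real.log (w * (X / Y))) ^ 3 * ((X / r + w * (X / Y)) / Y) := by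
  set T := w * (X / Y) with hT
  have hT1 : 1 ≤ T := by
    have : 1 ≤ X / Y := (one_le_div hY).2 hYX
    nlinarith
  have hstep : ∑ d ∈ (Finset.Ioc 0 ⌊X⌋₊).filter (fun d : ℕ => Y / d < w), fibSum r Y X a d ≤
      ∑ m ∈ Finset.Ioc 0 ⌊T⌋₊, ∑ d ∈ win (Y / m) (X / m), Real.log m ^ 2 *
        ((if ((d * m : ℕ) : ZMod r) = a then 1 else 0) / ((d * m : ℕ) : ℝ)) := by
    simp only [fibSum]
    rw [Finset.sum_sigma', Finset.sum_sigma']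
    refine sum_le_sum_of_injOn (fun p => ⟨p.2, p.1⟩) ?_ ?_ (fun _ _ => le_rfl) ?_
    · rintro ⟨d, m⟩ hp
      simp only [Finset.mem_sigma, Finset.mem_filter, Finset.mem_Ioc] at hp ⊢
      obtain ⟨⟨⟨h1, h2⟩, h3⟩, h4⟩ := hp
      have h5 := (mul_mem_win_iff d m).2 ⟨by omega, h4⟩
      have hm := pos_of_mem_win h4
      rw [mul_comm, mul_mem_win_iff] at h5
      refine ⟨⟨hm, ?_⟩, h5.2⟩
      apply Nat.le_floor
      have hd' : (0 : ℝ) < d := by exact_mod_cast h1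
      rw [mem_win (by positivity)] at h4
      rw [div_lt_iff₀ hd'] at h3
      calc (m : ℝ) ≤ X / d := h4.2
        _ ≤ T := by
          rw [div_le_iff₀ hd', hT]
          have : X = X / Y * Y := by field_simp
          have h7 : 0 < X / Y := by have := hY.trans_le hYX; positivity
          nlinarith
    · rintro ⟨d, m⟩ _ ⟨d', m'⟩ _ h
      simp at h
      simp [h]
    · rintro ⟨m, d⟩ _
      dsimp only
      split_ifs <;> positivity
  refine hstep.trans ?_
  have hin : ∀ m ∈ Finset.Ioc 0 ⌊T⌋₊, ∑ d ∈ win (Y / m) (X / m), Real.log m ^ 2 *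
        ((if ((d * m : ℕ) : ZMod r) = a then 1 else 0) / ((d * m : ℕ) : ℝ)) ≤
        logSqDiv m * ((X / r + T) / Y) := by
    intro m hm
    rw [Finset.mem_Ioc] at hm
    have hm0 : (0 : ℝ) < m := by exact_mod_cast hm.1
    have hX : 0 < X := hY.trans_le hYX
    have hr' : (0 : ℝ) < r := by exact_mod_cast hr
    by_cases hc : m.Coprime r
    · have h1 := sum_inv_class_le hr (((ZMod.unitOfCoprime m hc)⁻¹ : (ZMod r)ˣ) * a)
        (div_pos hY hm0) (by gcongr : Y / m ≤ X / m)
      calc _ = logSqDiv m * ∑ d ∈ win (Y / m) (X / m),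
            (if (d : ZMod r) = ((ZMod.unitOfCoprime m hc)⁻¹ : (ZMod r)ˣ) * a then 1 else 0) /
              (d : ℝ) := by
            rw [Finset.mul_sum]
            apply Finset.sum_congr rfl
            intro d _
            rw [mul_comm d m]
            simp only [natCast_mul_eq_iff hc]
            rw [logSqDiv]
            push_cast
            field_simp
        _ ≤ logSqDiv m * ((X / m / r + 1) / (Y / m)) := by
            gcongr
            exact logSqDiv_nonneg hm0.le
        _ = logSqDiv m * ((X / r + m) / Y) := by
            congr 1
            field_simp
        _ ≤ _ := by
            have : (m : ℝ) ≤ T := (Nat.le_floor_iff (by linarith)).1 hm.2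
            have := logSqDiv_nonneg hm0.le
            gcongr
    · have h0 : ∑ d ∈ win (Y / m) (X / m), Real.log m ^ 2 *
        ((if ((d * m : ℕ) : ZMod r) = a then 1 else 0) / ((d * m : ℕ) : ℝ)) = 0 := by
        apply Finset.sum_eq_zero
        intro d _
        rw [mul_comm d m, if_neg (not_natCast_mul_eq hc d a)]
        simp
      rw [h0]
      have := logSqDiv_nonneg hm0.le
      positivity
  refine (Finset.sum_le_sum hin).trans ?_
  rw [← Finset.sum_mul]
  have hX : 0 < X := hY.trans_le hYX
  exact mul_le_mul_of_nonneg_right (sum_logSqDiv_le T hT1) (by positivity)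

lemma sum_fibSum_head_le {r : ℕ} (hr : 0 < r) {Y X w : ℝ} (a b : (ZMod r)ˣ) (hY : 0 < Y)
    (hYX : Y ≤ X) (hw : Real.exp 2 ≤ w) :
    ∑ d ∈ (Finset.Ioc 0 ⌊X⌋₊).filter (fun d : ℕ => ¬ Y / d < w),
      |fibSum r Y X a d - fibSum r Y X b d| ≤ 64 / √w := by
  have hw0 : 0 < w := (Real.exp_pos 2).trans_le hw
  calc _ ≤ ∑ d ∈ (Finset.Ioc 0 ⌊X⌋₊).filter (fun d : ℕ => ¬ Y / d < w),
        32 / √Y * (1 / √(d : ℝ)) := by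
        apply Finset.sum_le_sum
        intro d hd
        rw [Finset.mem_filter, Finset.mem_Ioc, not_lt] at hd
        exact fibSum_diff_le hr hd.1.1 Y X a b (hw.trans hd.2) hYX
    _ ≤ ∑ d ∈ Finset.Ioc 0 ⌊Y / w⌋₊, 32 / √Y * (1 / √(d : ℝ)) := by
        apply Finset.sum_le_sum_of_subset_of_nonneg
        · intro d hd
          rw [Finset.mem_filter, Finset.mem_Ioc, not_lt] at hd
          rw [Finset.mem_Ioc]
          refine ⟨hd.1.1, Nat.le_floor ?_⟩
          have hd' : (0 : ℝ) < d := by exact_mod_cast hd.1.1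
          rw [le_div_iff₀ hw0, mul_comm]
          exact (le_div_iff₀ hd').1 hd.2
        · intros
          positivity
    _ ≤ 32 / √Y * (2 * √(⌊Y / w⌋₊ : ℝ)) := by
        rw [← Finset.mul_sum]
        have := sum_one_div_sqrt_le ⌊Y / w⌋₊
        gcongr
    _ ≤ 32 / √Y * (2 * √(Y / w)) := by
        have := Nat.floor_le (div_pos hY hw0).le
        gcongr
    _ = _ := by
        rw [Real.sqrt_div hY.le]
        have : 0 < √Y := Real.sqrt_pos.2 hY
        field_simp
        norm_num

/-- Error term in the equidistribution of `Λ₂`. -/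
def equiErr (L : ℝ) (r : ℕ) : ℝ := 5 * Real.exp L * (4 + L) ^ 3 * (1 + Real.log r) ^ 3 / r

lemma clsSum_lamTwo_diff_le {r : ℕ} (hr : 0 < r) {Y L : ℝ} (a b : (ZMod r)ˣ)
    (hY : 9 * (r : ℝ) ^ 3 ≤ Y) (hL : 0 ≤ L) :
    |clsSum r lamTwo Y (Y * Real.exp L) a - clsSum r lamTwo Y (Y * Real.exp L) b| ≤
      equiErr L r := by
  have hr' : (1 : ℝ) ≤ r := by exact_mod_cast hr
  have hY0 : 0 < Y := lt_of_lt_of_le (by positivity) hY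
  set X := Y * Real.exp L with hX
  have hYX : Y ≤ X := by
    have := Real.one_le_exp hL
    nlinarith
  set w : ℝ := 9 * (r : ℝ) ^ 2 with hw
  have hwe : Real.exp 2 ≤ w := by
    have h1 : Real.exp 1 ≤ 3 := by linarith [Real.exp_one_lt_d9]
    have h2 : Real.exp 2 = Real.exp 1 ^ 2 := by rw [← Real.exp_nat_mul]; norm_num
    have h3 : (0 : ℝ) < Real.exp 1 := Real.exp_pos 1
    rw [h2]
    nlinarith
  have hw1 : 1 ≤ w := by nlinarith
  have hXY : X / Y = Real.exp L := by
    rw [hX]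
    field_simp
  have htail : ∀ c : (ZMod r)ˣ,
      ∑ d ∈ (Finset.Ioc 0 ⌊X⌋₊).filter (fun d : ℕ => Y / d < w), fibSum r Y X c d ≤
      ((4 + L) * (1 + Real.log r)) ^ 3 * (2 * Real.exp L / r) := by
    intro c
    refine (sum_fibSum_tail_le hr c hY0 hYX hw1).trans ?_
    rw [hXY]
    have hlog : 0 ≤ Real.log r := Real.log_nonneg hr'
    have h1 : 1 + Real.log (w * Real.exp L) ≤ (4 + L) * (1 + Real.log r) := by
      rw [Real.log_mul (by positivity) (by positivity), Real.log_exp, hw,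
        Real.log_mul (by positivity) (by positivity), Real.log_pow]
      have : Real.log 9 ≤ 3 := by
        have : (9 : ℝ) = 3 ^ 2 := by norm_num
        rw [this, Real.log_pow]
        have := Real.log_three_lt_d9
        push_cast
        linarith
      push_cast
      nlinarith [mul_nonneg hL hlog]
    have h0 : 0 ≤ 1 + Real.log (w * Real.exp L) := by
      have : 0 ≤ Real.log (w * Real.exp L) :=
        Real.log_nonneg (one_le_mul_of_one_le_of_one_le hw1 (Real.one_le_exp hL))
      linarith
    have h2 : (X / r + w * Real.exp L) / Y ≤ 2 * Real.exp L / r := by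
      rw [div_le_div_iff₀ hY0 (by positivity), hX, hw]
      have : (Y * Real.exp L / r + 9 * (r : ℝ) ^ 2 * Real.exp L) * r =
        Real.exp L * (Y + 9 * (r : ℝ) ^ 3) := by field_simp
      rw [this]
      have := Real.exp_pos L
      nlinarith
    have hXp : 0 < X := hY0.trans_le hYX
    exact mul_le_mul (pow_le_pow_left₀ h0 h1 3) h2 (by positivity) (by positivity)
  have hhead := sum_fibSum_head_le hr a b hY0 hYX hwe
  have hsq : √w = 3 * r := by
    have h9 : w = (3 * (r : ℝ)) ^ 2 := by rw [hw]; ring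
    rw [h9]
    exact Real.sqrt_sq (by positivity)
  rw [hsq] at hhead
  rw [clsSum_lamTwo_eq, clsSum_lamTwo_eq, ← Finset.sum_sub_distrib]
  have hmu : ∀ d : ℕ, |(moebius d : ℝ)| ≤ 1 := by
    intro d
    have := @abs_moebius_le_one d
    exact_mod_cast this
  calc _ ≤ ∑ d ∈ Finset.Ioc 0 ⌊X⌋₊, |fibSum r Y X a d - fibSum r Y X b d| := by
        refine (Finset.abs_sum_le_sum_abs _ _).trans (Finset.sum_le_sum fun d _ => ?_)
        rw [← mul_sub, abs_mul]
        exact mul_le_of_le_one_left (abs_nonneg _) (hmu d)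
    _ = ∑ d ∈ (Finset.Ioc 0 ⌊X⌋₊).filter (fun d : ℕ => Y / d < w),
          |fibSum r Y X a d - fibSum r Y X b d| +
        ∑ d ∈ (Finset.Ioc 0 ⌊X⌋₊).filter (fun d : ℕ => ¬ Y / d < w),
          |fibSum r Y X a d - fibSum r Y X b d| :=
        (Finset.sum_filter_add_sum_filter_not _ _ _).symm
    _ ≤ (∑ d ∈ (Finset.Ioc 0 ⌊X⌋₊).filter (fun d : ℕ => Y / d < w), fibSum r Y X a d +
        ∑ d ∈ (Finset.Ioc 0 ⌊X⌋₊).filter (fun d : ℕ => Y / d < w), fibSum r Y X b d) +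
        64 / (3 * r) := by
        gcongr
        rw [← Finset.sum_add_distrib]
        apply Finset.sum_le_sum
        intro d _
        have h1 := fibSum_nonneg d Y X (a : ZMod r)
        have h2 := fibSum_nonneg d Y X (b : ZMod r)
        rw [abs_le]
        constructor <;> linarith
    _ ≤ (((4 + L) * (1 + Real.log r)) ^ 3 * (2 * Real.exp L / r) +
        ((4 + L) * (1 + Real.log r)) ^ 3 * (2 * Real.exp L / r)) + 64 / (3 * r) := by
        gcongr
        · exact htail a
        · exact htail b
    _ ≤ _ := by
        have h1 : (64 : ℝ) ≤ Real.exp L * (4 + L) ^ 3 * (1 + Real.log r) ^ 3 := by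
          have e1 := Real.one_le_exp hL
          have e2 : (4 : ℝ) ^ 3 ≤ (4 + L) ^ 3 := by gcongr; linarith
          have e3 : (1 : ℝ) ≤ (1 + Real.log r) ^ 3 :=
            one_le_pow₀ (by linarith [Real.log_nonneg hr'])
          have e4 : (4 : ℝ) ^ 3 ≤ Real.exp L * (4 + L) ^ 3 := by nlinarith
          nlinarith
        have h2 : 64 / (3 * (r : ℝ)) ≤ Real.exp L * (4 + L) ^ 3 * (1 + Real.log r) ^ 3 / r := by
          rw [← div_div]
          gcongr
          linarith
        have h3 : equiErr L r = ((4 + L) * (1 + Real.log r)) ^ 3 * (2 * Real.exp L / r) +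
          ((4 + L) * (1 + Real.log r)) ^ 3 * (2 * Real.exp L / r) +
          Real.exp L * (4 + L) ^ 3 * (1 + Real.log r) ^ 3 / r := by
          rw [equiErr]; ring
        rw [h3]
        linarith

/-- Lower threshold for `log Y` above which the window estimates for length `L` modulo `r` hold. -/
def thr (L : ℝ) (r : ℕ) : ℝ := 10 * Real.exp L * (4 + L) ^ 3 * (1 + Real.log r) ^ 3

lemma thr_mono {L L' : ℝ} (r : ℕ) (hL : 0 ≤ L) (h : L ≤ L') : thr L r ≤ thr L' r := by
  have h0 : 0 ≤ 1 + Real.log r := by linarith [Real.log_natCast_nonneg r]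
  unfold thr
  gcongr

lemma r_mul_equiErr {L : ℝ} {r : ℕ} (hr : 0 < r) : r * equiErr L r = thr L r / 2 := by
  have hr' : (0 : ℝ) < r := by exact_mod_cast hr
  rw [equiErr, thr]
  field_simp
  ring

lemma le_thr {L : ℝ} (r : ℕ) (hL : 0 ≤ L) :
    640 * (1 + L) * (1 + Real.log r) ≤ thr L r := by
  have h1 : 1 + L ≤ Real.exp L := by linarith [Real.add_one_le_exp L]
  have h2 : (4 : ℝ) ^ 3 ≤ (4 + L) ^ 3 := by gcongr; linarith
  have h0 : 1 ≤ 1 + Real.log r := by linarith [Real.log_natCast_nonneg r]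
  have h3 : 1 + Real.log r ≤ (1 + Real.log r) ^ 3 := le_self_pow₀ h0 (by norm_num)
  unfold thr
  calc 640 * (1 + L) * (1 + Real.log r) = 10 * (1 + L) * 4 ^ 3 * (1 + Real.log r) := by ring
    _ ≤ _ := by gcongr

lemma nine_mul_cube_le {L Y : ℝ} {r : ℕ} (hr : 0 < r) (hL : 0 ≤ L) (hY0 : 0 < Y)
    (hY : thr L r ≤ Real.log Y) : 9 * (r : ℝ) ^ 3 ≤ Y := by
  have hr' : (1 : ℝ) ≤ r := by exact_mod_cast hr
  have h1 := le_thr r hL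
  have h0 := Real.log_natCast_nonneg r
  have h2 : Real.log (9 * (r : ℝ) ^ 3) ≤ Real.log Y := by
    rw [Real.log_mul (by norm_num) (by positivity), Real.log_pow]
    have : Real.log 9 ≤ 9 - 1 := Real.log_le_sub_one_of_pos (by norm_num)
    push_cast
    nlinarith [mul_nonneg hL h0]
  exact (Real.log_le_log_iff (by positivity) hY0).1 h2

lemma sum_units_clsSum {r : ℕ} (g : ℕ → ℝ) (Y X : ℝ) (T : Finset (ZMod r)ˣ) :
    ∑ a ∈ T, clsSum r g Y X a =
      ∑ n ∈ (win Y X).filter (fun n : ℕ => ∃ a ∈ T, (n : ZMod r) = ((a : (ZMod r)ˣ) : ZMod r)),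
        g n / n := by
  simp only [clsSum]
  rw [← Finset.sum_biUnion]
  · apply Finset.sum_congr _ fun _ _ => rfl
    ext n
    simp only [Finset.mem_biUnion, Finset.mem_filter]
    tauto
  · intro a _ b _ hab
    rw [Function.onFun, Finset.disjoint_left]
    intro n hn hn'
    rw [Finset.mem_filter] at hn hn'
    exact hab (Units.ext (hn.2.symm.trans hn'.2))

lemma sum_units_clsSum_univ {r : ℕ} [NeZero r] (g : ℕ → ℝ) (Y X : ℝ) :
    ∑ a : (ZMod r)ˣ, clsSum r g Y X a =
      ∑ n ∈ (win Y X).filter (fun n : ℕ => n.Coprime r), g n / n := by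
  rw [sum_units_clsSum]
  apply Finset.sum_congr _ fun _ _ => rfl
  ext n
  simp only [Finset.mem_filter, Finset.mem_univ, true_and, ← ZMod.isUnit_iff_coprime]
  constructor
  · rintro ⟨h, a, ha⟩
    exact ⟨h, ha ▸ a.isUnit⟩
  · rintro ⟨h, a, ha⟩
    exact ⟨h, a, ha.symm⟩

lemma sum_lamTwo_le {Y X : ℝ} (hY : 1 ≤ Y) (hYX : Y ≤ X) :
    ∑ n ∈ win Y X, lamTwo n / n ≤ (2 * Real.log X + 6) * (Real.log (X / Y) + 8) := by
  have hY0 : 0 < Y := by linarith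
  have hX1 : 1 ≤ X := hY.trans hYX
  have h1 : ∀ n, lamTwo n / (n : ℝ) = Λ n * Real.log n / n + (Λ * Λ) n * (1 / n) := by
    intro n
    rw [lamTwo, ArithmeticFunction.add_apply, pmul_apply, log_apply]
    ring
  simp only [h1]
  rw [Finset.sum_add_distrib, sum_win_mul_apply Λ Λ (fun n => 1 / (n : ℝ)) Y X _ le_rfl]
  have hM := mertens_win_le hY0 hYX
  have hpos : 0 ≤ Real.log (X / Y) + 8 := by
    have := Real.log_nonneg ((one_le_div hY0).2 hYX)
    linarith
  have hlogX := Real.log_nonneg hX1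
  have h2 : ∑ n ∈ win Y X, Λ n * Real.log n / n ≤ Real.log X * (Real.log (X / Y) + 8) := by
    calc _ ≤ ∑ n ∈ win Y X, Real.log X * (Λ n / n) := by
          apply Finset.sum_le_sum
          intro n hn
          have hn0 := pos_of_mem_win hn
          rw [mem_win hY0.le] at hn
          have h3 : Real.log n ≤ Real.log X := Real.log_le_log (by exact_mod_cast hn0) hn.2
          have h4 : 0 ≤ Λ n / (n : ℝ) := div_nonneg vonMangoldt_nonneg (Nat.cast_nonneg n)
          calc _ = Real.log n * (Λ n / n) := by ring
            _ ≤ _ := by gcongr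
      _ ≤ _ := by
          rw [← Finset.mul_sum]
          gcongr
  have h3 : ∑ d ∈ Finset.Ioc 0 ⌊X⌋₊, ∑ m ∈ win (Y / d) (X / d),
      Λ d * Λ m * (1 / ((d * m : ℕ) : ℝ)) ≤ (Real.log X + 6) * (Real.log (X / Y) + 8) := by
    calc _ ≤ ∑ d ∈ Finset.Ioc 0 ⌊X⌋₊, Λ d / d * (Real.log (X / Y) + 8) := by
          apply Finset.sum_le_sum
          intro d hd
          have hd0 : (0 : ℝ) < d := by exact_mod_cast (Finset.mem_Ioc.1 hd).1
          have h5 := mertens_win_le (div_pos hY0 hd0) (by gcongr : Y / d ≤ X / d)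
          have h6 : X / d / (Y / d) = X / Y := by field_simp
          rw [h6] at h5
          calc _ = Λ d / d * ∑ m ∈ win (Y / d) (X / d), Λ m / m := by
                rw [Finset.mul_sum]
                apply Finset.sum_congr rfl
                intro m _
                push_cast
                field_simp
            _ ≤ _ := mul_le_mul_of_nonneg_left h5 (div_nonneg vonMangoldt_nonneg hd0.le)
      _ ≤ _ := by
          rw [← Finset.sum_mul]
          exact mul_le_mul_of_nonneg_right (mertens_upper_floor hX1) hpos
  linarith

lemma clsSum_lamTwo_ge {r : ℕ} {Y X : ℝ} (hY : 1 ≤ Y) (a : ZMod r) :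
    Real.log Y * clsSum r Λ Y X a ≤ clsSum r lamTwo Y X a := by
  rw [clsSum, clsSum, Finset.mul_sum]
  apply Finset.sum_le_sum
  intro n hn
  rw [Finset.mem_filter, mem_win (by linarith)] at hn
  have h1 : Real.log Y ≤ Real.log n := Real.log_le_log (by linarith) hn.1.1.le
  have h2 : Λ n * Real.log n ≤ lamTwo n := by
    rw [lamTwo, ArithmeticFunction.add_apply, pmul_apply, log_apply, mul_apply]
    have : 0 ≤ ∑ x ∈ n.divisorsAntidiagonal, Λ x.1 * Λ x.2 :=
      Finset.sum_nonneg fun _ _ => mul_nonneg vonMangoldt_nonneg vonMangoldt_nonneg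
    linarith
  have h3 : Real.log Y * Λ n ≤ lamTwo n := by
    have := @vonMangoldt_nonneg n
    nlinarith
  rw [← mul_div_assoc]
  gcongr

/-- Average form of the equidistribution of `Λ₂`. -/
lemma abs_totient_mul_clsSum_sub_le {r : ℕ} [NeZero r] {Y L : ℝ} (a : (ZMod r)ˣ)
    (hY : 9 * (r : ℝ) ^ 3 ≤ Y) (hL : 0 ≤ L) :
    |r.totient * clsSum r lamTwo Y (Y * Real.exp L) a -
      ∑ b : (ZMod r)ˣ, clsSum r lamTwo Y (Y * Real.exp L) b| ≤ r.totient * equiErr L r := by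
  have h1 : (r.totient : ℝ) * clsSum r lamTwo Y (Y * Real.exp L) a =
      ∑ b : (ZMod r)ˣ, clsSum r lamTwo Y (Y * Real.exp L) a := by
    rw [Finset.sum_const, Finset.card_univ, ZMod.card_units_eq_totient, nsmul_eq_mul]
  rw [h1, ← Finset.sum_sub_distrib]
  refine (Finset.abs_sum_le_sum_abs _ _).trans ?_
  refine (Finset.sum_le_sum fun b _ => clsSum_lamTwo_diff_le (NeZero.pos r) a b hY hL).trans ?_
  rw [Finset.sum_const, Finset.card_univ, ZMod.card_units_eq_totient, nsmul_eq_mul]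

/-- A Brun–Titchmarsh inequality for logarithmic windows. -/
lemma brun_titchmarsh_window {r : ℕ} (hr : 0 < r) {Y L : ℝ} (a : (ZMod r)ˣ) (hL : 1 ≤ L)
    (hY0 : 0 < Y) (hY : thr L r ≤ Real.log Y) :
    clsSum r Λ Y (Y * Real.exp L) a ≤ 40 * L / r.totient := by
  have : NeZero r := ⟨hr.ne'⟩
  have hr' : (1 : ℝ) ≤ r := by exact_mod_cast hr
  have hL0 : 0 ≤ L := by linarith
  have h9 := nine_mul_cube_le hr hL0 hY0 hY
  have hY1 : 1 ≤ Y := by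
    have : (1 : ℝ) ≤ (r : ℝ) ^ 3 := one_le_pow₀ hr'
    linarith
  have hYX : Y ≤ Y * Real.exp L := by nlinarith [Real.one_le_exp hL0]
  have h1 := (abs_le.1 (abs_totient_mul_clsSum_sub_le a h9 hL0)).2
  have h2 : ∑ b : (ZMod r)ˣ, clsSum r lamTwo Y (Y * Real.exp L) b ≤
      (2 * (Real.log Y + L) + 6) * (L + 8) := by
    rw [sum_units_clsSum_univ]
    have h3 := sum_lamTwo_le hY1 hYX
    rw [Real.log_mul hY0.ne' (Real.exp_pos L).ne', Real.log_exp,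
      mul_div_cancel_left₀ _ hY0.ne', Real.log_exp] at h3
    refine le_trans ?_ h3
    exact Finset.sum_le_sum_of_subset_of_nonneg (Finset.filter_subset _ _)
      fun n _ _ => div_nonneg (lamTwo_nonneg n) (Nat.cast_nonneg n)
  have h4 := clsSum_lamTwo_ge hY1 (X := Y * Real.exp L) (a : ZMod r)
  have hφ : (0 : ℝ) < r.totient := by exact_mod_cast Nat.totient_pos.2 hr
  have hφr : (r.totient : ℝ) ≤ r := by exact_mod_cast Nat.totient_le r
  have herr : (r.totient : ℝ) * equiErr L r ≤ Real.log Y := by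
    have h5 : 0 ≤ equiErr L r := by
      have := Real.log_natCast_nonneg r
      unfold equiErr; positivity
    have h6 := @r_mul_equiErr L r hr
    have h7 : 0 ≤ thr L r := by
      have := Real.log_natCast_nonneg r
      unfold thr; positivity
    nlinarith
  have hthr : 640 * (1 + L) ≤ Real.log Y := by
    have := le_thr r hL0
    have h0 := Real.log_natCast_nonneg r
    nlinarith
  have hlY : 0 < Real.log Y := by linarith
  rw [le_div_iff₀ hφ]
  set S := clsSum r Λ Y (Y * Real.exp L) a
  have h5 : Real.log Y * (S * r.totient) ≤ Real.log Y * (40 * L) := by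
    calc Real.log Y * (S * r.totient) = r.totient * (Real.log Y * S) := by ring
      _ ≤ r.totient * clsSum r lamTwo Y (Y * Real.exp L) a := by gcongr
      _ ≤ (2 * (Real.log Y + L) + 6) * (L + 8) + Real.log Y := by linarith
      _ ≤ (4 * Real.log Y) * (9 * L) + Real.log Y := by
        gcongr
        · linarith
        · linarith
      _ ≤ _ := by nlinarith
  exact le_of_mul_le_mul_left h5 hlY

/-- Indicator of a set of unit residue classes. -/
def ind {r : ℕ} (R : Finset (ZMod r)ˣ) (z : ZMod r) : ℝ := ∑ a ∈ R, if z = (a : ZMod r) then 1 else 0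

/-- Density of a set of unit residue classes. -/
def dens {r : ℕ} (R : Finset (ZMod r)ˣ) : ℝ := (R.card : ℝ) / r.totient

/-- Indicator of `R` minus its density on the units. -/
def bal {r : ℕ} (R : Finset (ZMod r)ˣ) (z : ZMod r) : ℝ :=
  ind R z - dens R * (if IsUnit z then 1 else 0)

lemma ind_unit {r : ℕ} (R : Finset (ZMod r)ˣ) (u : (ZMod r)ˣ) :
    ind R (u : ZMod r) = if u ∈ R then 1 else 0 := by
  simp [ind, Units.ext_iff.symm]

lemma ind_of_not_isUnit {r : ℕ} (R : Finset (ZMod r)ˣ) {z : ZMod r} (hz : ¬ IsUnit z) :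
    ind R z = 0 := by
  apply Finset.sum_eq_zero
  intro a _
  rw [if_neg]
  rintro rfl
  exact hz a.isUnit

lemma ind_nonneg {r : ℕ} (R : Finset (ZMod r)ˣ) (z : ZMod r) : 0 ≤ ind R z :=
  Finset.sum_nonneg fun a _ => by split_ifs <;> norm_num

lemma dens_nonneg {r : ℕ} (R : Finset (ZMod r)ˣ) : 0 ≤ dens R := by unfold dens; positivity

lemma bal_of_not_isUnit {r : ℕ} (R : Finset (ZMod r)ˣ) {z : ZMod r} (hz : ¬ IsUnit z) :
    bal R z = 0 := by
  rw [bal, ind_of_not_isUnit R hz, if_neg hz]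
  simp

lemma sum_units_clsSum_mul {r : ℕ} [NeZero r] (g : ℕ → ℝ) (Y X : ℝ) (F : ZMod r → ℝ)
    (hF : ∀ z, ¬ IsUnit z → F z = 0) :
    ∑ a : (ZMod r)ˣ, clsSum r g Y X a * F a = ∑ n ∈ win Y X, g n / n * F n := by
  simp only [clsSum, Finset.sum_filter, Finset.sum_mul]
  rw [Finset.sum_comm]
  apply Finset.sum_congr rfl
  intro n _
  by_cases hn : IsUnit (n : ZMod r)
  · obtain ⟨u, hu⟩ := hn
    rw [← hu, Finset.sum_eq_single u]
    · simp
    · intro b _ hb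
      rw [if_neg, zero_mul]
      exact fun h => hb (Units.ext h).symm
    · simp
  · rw [hF _ hn, mul_zero]
    apply Finset.sum_eq_zero
    intro a _
    rw [if_neg, zero_mul]
    intro h
    exact hn (h ▸ a.isUnit)

/-- Logarithmic mass of the `Λ`-weighted `m ∈ (s, t]` with `d * m` landing in `R`. -/
def hitSum {r : ℕ} (R : Finset (ZMod r)ˣ) (d : ℕ) (s t : ℝ) : ℝ :=
  ∑ m ∈ win s t, Λ m / m * ind R ((d : ZMod r) * m)

/-- Logarithmic sum over `m ∈ (s, t]` weighted by the balanced indicator at `d * m`. -/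
def balSum {r : ℕ} (R : Finset (ZMod r)ˣ) (d : ℕ) (s t : ℝ) : ℝ :=
  ∑ m ∈ win s t, Λ m / m * bal R ((d : ZMod r) * m)

lemma vonMangoldt_div_nonneg (m : ℕ) : 0 ≤ Λ m / (m : ℝ) :=
  div_nonneg vonMangoldt_nonneg (Nat.cast_nonneg m)

lemma hitSum_mono {r : ℕ} (R : Finset (ZMod r)ˣ) (d : ℕ) {s t s' t' : ℝ} (h1 : s' ≤ s)
    (h2 : t ≤ t') : hitSum R d s t ≤ hitSum R d s' t' :=
  Finset.sum_le_sum_of_subset_of_nonneg (win_subset_win h1 h2)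
    fun m _ _ => mul_nonneg (vonMangoldt_div_nonneg m) (ind_nonneg _ _)

lemma hitSum_le {r : ℕ} [NeZero r] (R : Finset (ZMod r)ˣ) (d : ℕ) {Z L : ℝ} (hL : 1 ≤ L)
    (hZ0 : 0 < Z) (hZ : thr L r ≤ Real.log Z) :
    hitSum R d Z (Z * Real.exp L) ≤ dens R * (40 * L) := by
  have hD := dens_nonneg R
  by_cases hd : d.Coprime r
  · have h1 : hitSum R d Z (Z * Real.exp L) = ∑ a ∈ R, clsSum r Λ Z (Z * Real.exp L)
        (((ZMod.unitOfCoprime d hd)⁻¹ * a : (ZMod r)ˣ) : ZMod r) := by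
      simp only [hitSum, ind, clsSum, Finset.mul_sum, Finset.sum_filter]
      rw [Finset.sum_comm]
      refine Finset.sum_congr rfl fun a _ => Finset.sum_congr rfl fun m _ => ?_
      have := natCast_mul_eq_iff (m := m) hd (a : ZMod r)
      rw [Nat.cast_mul] at this
      simp only [this, Units.val_mul]
      split_ifs <;> simp
    rw [h1]
    refine (Finset.sum_le_sum fun a _ => brun_titchmarsh_window (NeZero.pos r) _ hL hZ0 hZ).trans ?_
    rw [Finset.sum_const, nsmul_eq_mul, dens]
    apply le_of_eq
    ring
  · have h1 : hitSum R d Z (Z * Real.exp L) = 0 := by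
      apply Finset.sum_eq_zero
      intro m _
      rw [ind_of_not_isUnit, mul_zero]
      intro h
      exact hd ((ZMod.isUnit_iff_coprime d r).1 (isUnit_of_mul_isUnit_left h))
    rw [h1]
    positivity

lemma balSum_le_hitSum {r : ℕ} (R : Finset (ZMod r)ˣ) (d : ℕ) (s t : ℝ) :
    balSum R d s t ≤ hitSum R d s t := by
  apply Finset.sum_le_sum
  intro m _
  apply mul_le_mul_of_nonneg_left _ (vonMangoldt_div_nonneg m)
  rw [bal]
  have : 0 ≤ dens R * (if IsUnit ((d : ZMod r) * m) then 1 else 0) :=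
    mul_nonneg (dens_nonneg R) (by split_ifs <;> norm_num)
  linarith

lemma neg_balSum_le {r : ℕ} (R : Finset (ZMod r)ˣ) (d : ℕ) {s t : ℝ} (hs : 0 < s) (hst : s ≤ t) :
    -balSum R d s t ≤ dens R * (Real.log (t / s) + 8) := by
  have h := mertens_win_le hs hst
  have hD := dens_nonneg R
  refine le_trans ?_ (mul_le_mul_of_nonneg_left h hD)
  rw [balSum, ← Finset.sum_neg_distrib, Finset.mul_sum]
  apply Finset.sum_le_sum
  intro m _
  have h1 : -bal R ((d : ZMod r) * m) ≤ dens R := by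
    rw [bal]
    have := ind_nonneg R ((d : ZMod r) * m)
    split_ifs <;> linarith
  have := mul_le_mul_of_nonneg_left h1 (vonMangoldt_div_nonneg m)
  linarith

lemma balSum_le_shift {r : ℕ} [NeZero r] (R : Finset (ZMod r)ˣ) {d : ℕ} {Y h L c : ℝ} (hh : 1 ≤ h)
    (hL : 0 ≤ L) (hY : 0 < Y) (hd1 : Real.exp c ≤ d) (hd2 : d ≤ Real.exp (c + h))
    (hthr : thr h r + c + h ≤ Real.log Y) :
    balSum R d (Y / d) (Y * Real.exp L / d) ≤
      balSum R d (Y * Real.exp (-c)) (Y * Real.exp (-c) * Real.exp L) + dens R * (49 * h) := by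
  have hd0 : (0 : ℝ) < d := (Real.exp_pos c).trans_le hd1
  set Y' := Y * Real.exp (-c) with hY'
  have hY'0 : 0 < Y' := by positivity
  have h1 : Y / d ≤ Y' := by
    rw [div_le_iff₀ hd0, hY', Real.exp_neg]
    have := Real.exp_pos c
    calc Y = Y * (Real.exp c)⁻¹ * Real.exp c := by field_simp
      _ ≤ _ := by gcongr
  have h2 : Y' * Real.exp (-h) ≤ Y / d := by
    rw [le_div_iff₀ hd0, hY']
    calc _ ≤ Y * Real.exp (-c) * Real.exp (-h) * Real.exp (c + h) := by gcongr
      _ = Y := by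
        have : Real.exp (-c) * Real.exp (-h) * Real.exp (c + h) = 1 := by
          rw [← Real.exp_add, ← Real.exp_add, show -c + -h + (c + h) = 0 by ring, Real.exp_zero]
        linear_combination Y * this
  have hE := Real.exp_pos L
  have hE1 := Real.one_le_exp hL
  have h1' : Y * Real.exp L / d ≤ Y' * Real.exp L := by
    have := mul_le_mul_of_nonneg_right h1 hE.le
    linarith [mul_div_right_comm Y (Real.exp L) (d : ℝ)]
  have h2' : Y' * Real.exp (-h) * Real.exp L ≤ Y * Real.exp L / d := by
    have := mul_le_mul_of_nonneg_right h2 hE.le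
    linarith [mul_div_right_comm Y (Real.exp L) (d : ℝ)]
  have hYd : 0 < Y / d := by positivity
  have h3 : balSum R d (Y / d) (Y * Real.exp L / d) = balSum R d Y' (Y' * Real.exp L) +
      balSum R d (Y / d) Y' - balSum R d (Y * Real.exp L / d) (Y' * Real.exp L) := by
    have e1 : Y / d ≤ Y * Real.exp L / d := by
      gcongr
      nlinarith
    have e2 : Y' ≤ Y' * Real.exp L := by nlinarith
    rw [balSum, balSum, balSum, balSum, sum_win_eq_sub e1, sum_win_eq_sub e2, sum_win_eq_sub h1,
      sum_win_eq_sub h1']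
    ring
  have h4 : balSum R d (Y / d) Y' ≤ dens R * (40 * h) := by
    refine (balSum_le_hitSum R d _ _).trans ((hitSum_mono R d h2 le_rfl).trans ?_)
    have e1 : Y' = Y' * Real.exp (-h) * Real.exp h := by
      rw [mul_assoc, ← Real.exp_add]; simp
    have e2 : thr h r ≤ Real.log (Y' * Real.exp (-h)) := by
      rw [hY', Real.log_mul (by positivity) (by positivity), Real.log_mul (by positivity)
        (by positivity), Real.log_exp, Real.log_exp]
      linarith
    calc _ = hitSum R d (Y' * Real.exp (-h)) (Y' * Real.exp (-h) * Real.exp h) := by rw [← e1]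
      _ ≤ _ := hitSum_le R d hh (by positivity) e2
  have h5 : -balSum R d (Y * Real.exp L / d) (Y' * Real.exp L) ≤ dens R * (h + 8) := by
    refine (neg_balSum_le R d (by positivity) h1').trans ?_
    apply mul_le_mul_of_nonneg_left _ (dens_nonneg R)
    have : Real.log (Y' * Real.exp L / (Y * Real.exp L / d)) ≤ h := by
      rw [← Real.log_exp h]
      apply Real.log_le_log (by positivity)
      rw [div_le_iff₀ (by positivity)]
      calc Y' * Real.exp L = Real.exp h * (Y' * Real.exp (-h) * Real.exp L) := by
            have : Real.exp h * Real.exp (-h) = 1 := by rw [← Real.exp_add]; simp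
            linear_combination (-Y' * Real.exp L) * this
        _ ≤ _ := by gcongr
    linarith
  have hD := dens_nonneg R
  have h6 : dens R * (40 * h) + dens R * (h + 8) ≤ dens R * (49 * h) := by
    rw [← mul_add]
    gcongr
    linarith
  linarith

lemma sum_win_add_sum_win {s t u : ℝ} (h1 : s ≤ t) (h2 : t ≤ u) (g : ℕ → ℝ) :
    ∑ n ∈ win s t, g n + ∑ n ∈ win t u, g n = ∑ n ∈ win s u, g n := by
  rw [sum_win_eq_sub h1, sum_win_eq_sub h2, sum_win_eq_sub (h1.trans h2)]
  ring

lemma sum_win_blocks {h : ℝ} (hh : 0 ≤ h) (i₀ i₁ : ℕ) (hi : i₀ ≤ i₁) (g : ℕ → ℝ) :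
    ∑ i ∈ Finset.Ico i₀ i₁, ∑ n ∈ win (Real.exp (i * h)) (Real.exp (i * h + h)), g n =
      ∑ n ∈ win (Real.exp (i₀ * h)) (Real.exp (i₁ * h)), g n := by
  induction i₁, hi using Nat.le_induction with
  | base => simp [win]
  | succ i hi ih =>
    rw [Finset.sum_Ico_succ_top hi, ih]
    have h1 : Real.exp (i₀ * h) ≤ Real.exp (i * h) := by gcongr
    have h2 : Real.exp (i * h) ≤ Real.exp (i * h + h) := by gcongr; linarith
    rw [sum_win_add_sum_win h1 h2]
    push_cast
    rw [add_mul, one_mul]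

/-- Bilinear block: `m` in a window of length `h`, `n` in the complementary window of length `L`. -/
def blockSum {r : ℕ} [NeZero r] (R : Finset (ZMod r)ˣ) (Y h L : ℝ) (i : ℕ) : ℝ :=
  ∑ a : (ZMod r)ˣ, ∑ b : (ZMod r)ˣ,
    clsSum r Λ (Real.exp (i * h)) (Real.exp (i * h + h)) a *
    clsSum r Λ (Y * Real.exp (-(i * h))) (Y * Real.exp (-(i * h)) * Real.exp L) b *
    bal R ((a * b : (ZMod r)ˣ) : ZMod r)

lemma sum_block_balSum {r : ℕ} [NeZero r] (R : Finset (ZMod r)ˣ) (s t s' t' : ℝ) :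
    ∑ d ∈ win s t, Λ d / d * balSum R d s' t' =
      ∑ a : (ZMod r)ˣ, ∑ b : (ZMod r)ˣ, clsSum r Λ s t a * clsSum r Λ s' t' b *
        bal R ((a * b : (ZMod r)ˣ) : ZMod r) := by
  have h0 : ∀ d : ℕ, balSum R d s' t' =
      ∑ b : (ZMod r)ˣ, clsSum r Λ s' t' b * bal R ((d : ZMod r) * b) := by
    intro d
    rw [balSum, sum_units_clsSum_mul Λ s' t' (fun z => bal R ((d : ZMod r) * z))]
    intro z hz
    exact bal_of_not_isUnit R fun h => hz (isUnit_of_mul_isUnit_right h)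
  have h1 := sum_units_clsSum_mul Λ s t (fun z : ZMod r => ∑ b : (ZMod r)ˣ, clsSum r Λ s' t' b *
    bal R (z * b)) (by
      intro z hz
      apply Finset.sum_eq_zero
      intro b _
      rw [bal_of_not_isUnit R fun h => hz (isUnit_of_mul_isUnit_left h), mul_zero])
  simp only [h0]
  rw [← h1]
  refine Finset.sum_congr rfl fun a _ => ?_
  rw [Finset.mul_sum]
  refine Finset.sum_congr rfl fun b _ => ?_
  rw [Units.val_mul]
  ring

lemma sum_high_balSum_le {r : ℕ} [NeZero r] (R : Finset (ZMod r)ˣ) {Y L D : ℝ} (hL : 1 ≤ L)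
    (hY : 0 < Y) (hD : 0 < D) (hDX : D ≤ Y * Real.exp L) (hthr : thr L r + L ≤ Real.log D) :
    ∑ d ∈ win D (Y * Real.exp L), Λ d / d * balSum R d (Y / d) (Y * Real.exp L / d) ≤
      dens R * (40 * L) * (Real.log Y + L - Real.log D + 6) := by
  set X := Y * Real.exp L with hX
  have hX0 : 0 < X := by positivity
  have hXD : 1 ≤ X / D := (one_le_div hD).2 hDX
  have hdens := dens_nonneg R
  calc _ ≤ ∑ d ∈ win D X, ∑ m ∈ win (Y / d) (X / d),
        Λ d / d * (Λ m / m * ind R ((d : ZMod r) * m)) := by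
        apply Finset.sum_le_sum
        intro d _
        rw [← Finset.mul_sum]
        exact mul_le_mul_of_nonneg_left (balSum_le_hitSum R d _ _) (vonMangoldt_div_nonneg d)
    _ ≤ ∑ m ∈ Finset.Ioc 0 ⌊X / D⌋₊, ∑ d ∈ win (Y / m) (X / m),
        Λ d / d * (Λ m / m * ind R ((d : ZMod r) * m)) := by
        rw [Finset.sum_sigma', Finset.sum_sigma']
        refine sum_le_sum_of_injOn (fun p => ⟨p.2, p.1⟩) ?_ ?_ (fun _ _ => le_rfl) ?_
        · rintro ⟨d, m⟩ hp
          simp only [Finset.mem_sigma, Finset.mem_Ioc] at hp ⊢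
          obtain ⟨h1, h2⟩ := hp
          have hd := pos_of_mem_win h1
          have hm := pos_of_mem_win h2
          have h3 := (mul_mem_win_iff d m).2 ⟨by omega, h2⟩
          have h3' := h3
          rw [mul_comm, mul_mem_win_iff] at h3
          refine ⟨⟨hm, Nat.le_floor ?_⟩, h3.2⟩
          rw [mem_win hY.le] at h3'
          rw [mem_win hD.le] at h1
          rw [le_div_iff₀ hD]
          have h4 := h3'.2
          push_cast at h4
          have : (0 : ℝ) ≤ m := by positivity
          nlinarith
        · rintro ⟨d, m⟩ _ ⟨d', m'⟩ _ h
          simp at h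
          simp [h]
        · rintro ⟨m, d⟩ _
          exact mul_nonneg (vonMangoldt_div_nonneg d)
            (mul_nonneg (vonMangoldt_div_nonneg m) (ind_nonneg _ _))
    _ ≤ ∑ m ∈ Finset.Ioc 0 ⌊X / D⌋₊, Λ m / m * (dens R * (40 * L)) := by
        apply Finset.sum_le_sum
        intro m hm
        rw [Finset.mem_Ioc, Nat.le_floor_iff (by positivity)] at hm
        have hm0 : (0 : ℝ) < m := by exact_mod_cast hm.1
        have h1 : thr L r ≤ Real.log (Y / m) := by
          have : Real.log D - L ≤ Real.log (Y / m) := by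
            rw [← Real.log_exp L, ← Real.log_div hD.ne' (Real.exp_pos L).ne']
            apply Real.log_le_log (by positivity)
            have h2 := hm.2
            rw [le_div_iff₀ hD, hX] at h2
            rw [div_le_div_iff₀ (Real.exp_pos L) hm0]
            linarith
          linarith
        have h2 := hitSum_le R m hL (by positivity : 0 < Y / m) h1
        have h3 : ∑ d ∈ win (Y / m) (X / m), Λ d / d * (Λ m / m * ind R ((d : ZMod r) * m)) =
            Λ m / m * hitSum R m (Y / m) (Y / m * Real.exp L) := by
          rw [hitSum, Finset.mul_sum, hX, mul_div_right_comm]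
          apply Finset.sum_congr rfl
          intro d _
          rw [mul_comm (d : ZMod r)]
          ring
        rw [h3]
        exact mul_le_mul_of_nonneg_left h2 (vonMangoldt_div_nonneg m)
    _ ≤ _ := by
        rw [← Finset.sum_mul, mul_comm]
        apply mul_le_mul_of_nonneg_left _ (by positivity)
        have := mertens_upper_floor hXD
        rw [Real.log_div hX0.ne' hD.ne', hX, Real.log_mul hY.ne' (Real.exp_pos L).ne',
          Real.log_exp] at this
        linarith

/-- Upper bound for the balanced sum of `Λ * Λ` over a window. -/
lemma sum_balSum_le {r : ℕ} [NeZero r] (R : Finset (ZMod r)ˣ) {Y h L Eb : ℝ} {i₀ i₁ : ℕ}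
    (hh : 1 ≤ h) (hhL : h ≤ L) (hY : 0 < Y) (hi : i₀ ≤ i₁)
    (hlow : thr L r + L ≤ i₁ * h) (hhigh : thr L r + (i₁ * h + h) ≤ Real.log Y)
    (hEb : ∀ i, i₀ ≤ i → i < i₁ → blockSum R Y h L i ≤ dens R * Eb) :
    ∑ d ∈ Finset.Ioc 0 ⌊Y * Real.exp L⌋₊, Λ d / d * balSum R d (Y / d) (Y * Real.exp L / d) ≤
      dens R * (40 * L * (i₀ * h + 6) + (i₁ - i₀) * (441 * h ^ 2 + Eb) +
        40 * L * (Real.log Y + L - i₁ * h + 6)) := by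
  have hL : 1 ≤ L := hh.trans hhL
  have hdens := dens_nonneg R
  have hmono : thr h r ≤ thr L r := thr_mono r (by linarith) hhL
  set X := Y * Real.exp L with hX
  set G : ℕ → ℝ := fun d => Λ d / d * balSum R d (Y / d) (X / d) with hG
  have hi' : (i₀ : ℝ) * h ≤ i₁ * h := by gcongr
  have hDX : Real.exp (i₁ * h) ≤ X := by
    rw [← Real.exp_log hY, ← Real.exp_add] at hX
    rw [hX]
    have : 0 ≤ thr L r := by
      have := Real.log_natCast_nonneg r
      unfold thr; positivity
    gcongr
    linarith
  have hdX : ∀ d : ℕ, X / d = Y / d * Real.exp L := fun d => by rw [hX, mul_div_right_comm]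
  have hsplit : ∑ d ∈ Finset.Ioc 0 ⌊X⌋₊, G d = ∑ d ∈ win 0 (Real.exp (i₀ * h)), G d +
      ∑ i ∈ Finset.Ico i₀ i₁, ∑ d ∈ win (Real.exp (i * h)) (Real.exp (i * h + h)), G d +
      ∑ d ∈ win (Real.exp (i₁ * h)) X, G d := by
    rw [sum_win_blocks (by linarith) i₀ i₁ hi, sum_win_add_sum_win (Real.exp_pos _).le
      (by gcongr), sum_win_add_sum_win (Real.exp_pos _).le hDX, win, Nat.floor_zero]
  have hlowsum : ∑ d ∈ win 0 (Real.exp (i₀ * h)), G d ≤ dens R * (40 * L) * (i₀ * h + 6) := by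
    calc _ ≤ ∑ d ∈ win 0 (Real.exp (i₀ * h)), Λ d / d * (dens R * (40 * L)) := by
          apply Finset.sum_le_sum
          intro d hd
          have hd0 : (0 : ℝ) < d := by exact_mod_cast pos_of_mem_win hd
          apply mul_le_mul_of_nonneg_left _ (vonMangoldt_div_nonneg d)
          refine (balSum_le_hitSum R d _ _).trans ?_
          rw [hdX]
          apply hitSum_le R d hL (by positivity)
          rw [Real.log_div hY.ne' hd0.ne']
          rw [mem_win le_rfl] at hd
          have := Real.log_le_log hd0 hd.2
          rw [Real.log_exp] at this
          linarith
      _ ≤ _ := by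
          rw [← Finset.sum_mul, mul_comm]
          apply mul_le_mul_of_nonneg_left _ (by positivity)
          have := mertens_upper_floor (Real.one_le_exp (by positivity : 0 ≤ i₀ * h))
          rw [Real.log_exp] at this
          rw [win, Nat.floor_zero]
          exact this
  have hblock : ∀ i ∈ Finset.Ico i₀ i₁,
      ∑ d ∈ win (Real.exp (i * h)) (Real.exp (i * h + h)), G d ≤
        dens R * (441 * h ^ 2 + Eb) := by
    intro i hi2
    rw [Finset.mem_Ico] at hi2
    have hi3 : (i : ℝ) * h + h ≤ i₁ * h := by
      have : (i : ℝ) + 1 ≤ i₁ := by exact_mod_cast hi2.2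
      nlinarith
    have hM := mertens_win_le (Real.exp_pos (i * h))
      (by gcongr; linarith : Real.exp (i * h) ≤ Real.exp (i * h + h))
    rw [← Real.exp_sub, Real.log_exp] at hM
    calc _ ≤ ∑ d ∈ win (Real.exp (i * h)) (Real.exp (i * h + h)), (Λ d / d *
          balSum R d (Y * Real.exp (-(i * h))) (Y * Real.exp (-(i * h)) * Real.exp L) +
          Λ d / d * (dens R * (49 * h))) := by
          apply Finset.sum_le_sum
          intro d hd
          rw [mem_win (Real.exp_pos _).le] at hd
          rw [← mul_add]
          apply mul_le_mul_of_nonneg_left _ (vonMangoldt_div_nonneg d)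
          exact balSum_le_shift R hh (by linarith) hY hd.1.le hd.2 (by linarith)
      _ ≤ dens R * Eb + (h + 8) * (dens R * (49 * h)) := by
          rw [Finset.sum_add_distrib, ← Finset.sum_mul, sum_block_balSum]
          refine add_le_add (hEb i hi2.1 hi2.2) ?_
          apply mul_le_mul_of_nonneg_right _ (by positivity)
          linarith
      _ ≤ dens R * Eb + (9 * h) * (dens R * (49 * h)) := by
          gcongr
          linarith
      _ = _ := by ring
  have hhighsum := sum_high_balSum_le R hL hY (Real.exp_pos (i₁ * h)) hDX
    (by rw [Real.log_exp]; exact hlow)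
  rw [Real.log_exp] at hhighsum
  have hmid := Finset.sum_le_sum hblock
  rw [Finset.sum_const, Nat.card_Ico, nsmul_eq_mul, Nat.cast_sub hi] at hmid
  rw [hsplit]
  calc _ ≤ _ := add_le_add (add_le_add hlowsum hmid) hhighsum
    _ = _ := by ring

lemma sum_not_coprime_le_one {r : ℕ} (hr : 0 < r) {Y L : ℝ} (hL : 0 ≤ L) (hY0 : 0 < Y)
    (hthr : thr L r ≤ Real.log Y) :
    ∑ n ∈ (win Y (Y * Real.exp L)).filter (fun n : ℕ => ¬ n.Coprime r), Λ n / n ≤ 1 := by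
  set X := Y * Real.exp L with hX
  set v := Real.log Y with hv
  have hlogX : Real.log X = v + L := by
    rw [hX, Real.log_mul hY0.ne' (Real.exp_pos L).ne', Real.log_exp]
  have h1 := le_thr r hL
  have hlr := Real.log_natCast_nonneg r
  have hv640 : 640 * (1 + L) ≤ v := by nlinarith
  have hvr : 640 * Real.log r ≤ v := by nlinarith
  set S := ((win Y X).filter (fun n : ℕ => ¬ n.Coprime r)).filter (fun n : ℕ => IsPrimePow n) with hS
  have hsum : ∑ n ∈ (win Y X).filter (fun n : ℕ => ¬ n.Coprime r), Λ n / (n : ℝ) =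
      ∑ n ∈ S, Λ n / (n : ℝ) := by
    rw [hS, Finset.sum_filter (p := fun n : ℕ => IsPrimePow n)]
    refine Finset.sum_congr rfl fun n _ => ?_
    split_ifs with h
    · rfl
    · rw [vonMangoldt_eq_zero_iff.2 h, zero_div]
  have hcard : S.card ≤ r * (⌊2 * Real.log X⌋₊ + 1) := by
    have : S.card ≤ (r.primeFactors ×ˢ Finset.range (⌊2 * Real.log X⌋₊ + 1)).card := by
      apply Finset.card_le_card_of_injOn (fun n => (n.minFac, n.factorization n.minFac))
      · intro n hn
        simp only [hS, Finset.coe_filter, Finset.mem_filter, Set.mem_ofPred_eq] at hn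
        obtain ⟨⟨hn1, hn2⟩, hn3⟩ := hn
        have hpp := hn3.minFac_pow_factorization_eq
        have hp : n.minFac.Prime := Nat.minFac_prime hn3.ne_one
        simp only [Finset.coe_product, Set.mem_prod, Finset.mem_coe, Nat.mem_primeFactors,
          Finset.mem_range]
        refine ⟨⟨hp, ?_, hr.ne'⟩, ?_⟩
        · by_contra hd
          apply hn2
          rw [← hpp]
          exact Nat.Coprime.pow_left _ ((Nat.Prime.coprime_iff_not_dvd hp).2 hd)
        · rw [Nat.lt_succ_iff]
          apply Nat.le_floor
          rw [mem_win hY0.le] at hn1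
          set j := n.factorization n.minFac
          have h2 : (2 : ℝ) ^ j ≤ X := by
            refine le_trans ?_ hn1.2
            rw [← hpp]
            push_cast
            gcongr
            exact_mod_cast hp.two_le
          have h3 := Real.log_le_log (by positivity) h2
          rw [Real.log_pow] at h3
          have := Real.log_two_gt_d9
          have : (0 : ℝ) ≤ j := by positivity
          nlinarith
      · intro n hn m hm h
        simp only [hS, Finset.coe_filter, Finset.mem_filter, Set.mem_ofPred_eq] at hn hm
        simp only [Prod.mk.injEq] at h
        rw [← hn.2.minFac_pow_factorization_eq, ← hm.2.minFac_pow_factorization_eq, h.2, h.1]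
    refine this.trans ?_
    rw [Finset.card_product, Finset.card_range]
    refine Nat.mul_le_mul_right _ ?_
    calc r.primeFactors.card ≤ (Finset.Icc 1 r).card := by
          apply Finset.card_le_card
          intro p hp
          rw [Finset.mem_Icc]
          exact ⟨(Nat.prime_of_mem_primeFactors hp).one_le, Nat.le_of_mem_primeFactors hp⟩
      _ = r := by simp
  have hterm : ∀ n ∈ S, Λ n / (n : ℝ) ≤ (v + L) / Y := by
    intro n hn
    simp only [hS, Finset.mem_filter] at hn
    have h2 := (mem_win hY0.le n).1 hn.1.1
    have hn0 : (0 : ℝ) < n := hY0.trans h2.1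
    have h3 := Real.log_le_log hn0 h2.2
    rw [hlogX] at h3
    have h4 : Λ n ≤ Real.log n := vonMangoldt_le_log
    calc Λ n / (n : ℝ) ≤ (v + L) / n := by gcongr; linarith
      _ ≤ (v + L) / Y := div_le_div_of_nonneg_left (by linarith) hY0 h2.1.le
  rw [hsum]
  refine (Finset.sum_le_card_nsmul _ _ _ hterm).trans ?_
  rw [nsmul_eq_mul]
  have hc : (S.card : ℝ) ≤ r * (2 * (v + L) + 1) := by
    calc (S.card : ℝ) ≤ ((r * (⌊2 * Real.log X⌋₊ + 1) : ℕ) : ℝ) := by exact_mod_cast hcard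
      _ ≤ _ := by
        push_cast
        gcongr
        rw [hlogX]
        exact Nat.floor_le (by linarith)
  have hr0 : (0 : ℝ) < r := by exact_mod_cast hr
  have hrv : (r : ℝ) ≤ Real.exp (v / 2) := by
    rw [← Real.log_le_iff_le_exp hr0]
    linarith
  have h4 : (v / 2) ^ 4 / (Nat.factorial 4 : ℕ) ≤ Real.exp (v / 2) :=
    Real.pow_div_factorial_le_exp _ (by linarith) 4
  have h24 : ((Nat.factorial 4 : ℕ) : ℝ) = 24 := by norm_num [Nat.factorial]
  rw [h24] at h4
  have hYe : Y = Real.exp (v / 2) * Real.exp (v / 2) := by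
    rw [← Real.exp_add, add_halves, hv, Real.exp_log hY0]
  have h5 : (2 * (v + L) + 1) * (v + L) ≤ Real.exp (v / 2) := by
    refine le_trans ?_ h4
    have : (2 * (v + L) + 1) * (v + L) ≤ 12 * v ^ 2 := by nlinarith
    have hv2 : 4608 * v ^ 2 ≤ v ^ 2 * v ^ 2 := by
      gcongr
      nlinarith
    have : (v / 2) ^ 4 / 24 = v ^ 2 * v ^ 2 / 384 := by ring
    linarith
  calc (S.card : ℝ) * ((v + L) / Y) ≤ r * (2 * (v + L) + 1) * ((v + L) / Y) := by
        have : 0 ≤ (v + L) / Y := div_nonneg (by linarith) hY0.le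
        gcongr
    _ = r * ((2 * (v + L) + 1) * (v + L)) / Y := by ring
    _ ≤ Real.exp (v / 2) * Real.exp (v / 2) / Y := by
        have : 0 ≤ (2 * (v + L) + 1) * (v + L) := mul_nonneg (by linarith) (by linarith)
        gcongr
    _ = 1 := by rw [← hYe, div_self hY0.ne']

lemma sum_lamTwo_bal_ge {r : ℕ} [NeZero r] (R : Finset (ZMod r)ˣ) {Y L : ℝ} (hL : 0 ≤ L)
    (hY0 : 0 < Y) (hthr : thr L r ≤ Real.log Y) :
    -(dens R * (thr L r / 2)) ≤ ∑ n ∈ win Y (Y * Real.exp L), lamTwo n / n * bal R n := by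
  have hr := NeZero.pos r
  have h9 := nine_mul_cube_le hr hL hY0 hthr
  set X := Y * Real.exp L
  have htot : (0 : ℝ) < r.totient := by exact_mod_cast Nat.totient_pos.2 hr
  rw [← sum_units_clsSum_mul lamTwo Y X (bal R) fun z hz => bal_of_not_isUnit R hz]
  set S := ∑ b : (ZMod r)ˣ, clsSum r lamTwo Y X b with hS
  have h1 : ∑ a : (ZMod r)ˣ, clsSum r lamTwo Y X a * bal R a =
      ∑ a ∈ R, (clsSum r lamTwo Y X a - S / r.totient) := by
    simp only [bal, ind_unit, Units.isUnit, if_true, mul_sub, Finset.sum_sub_distrib]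
    rw [← Finset.sum_mul, ← hS]
    simp only [mul_ite, mul_one, mul_zero, Finset.sum_ite_mem, Finset.univ_inter,
      Finset.sum_const, nsmul_eq_mul, dens]
    ring
  rw [h1]
  have h2 : ∀ a ∈ R, -equiErr L r ≤ clsSum r lamTwo Y X a - S / r.totient := by
    intro a _
    have h3 := (abs_le.1 (abs_totient_mul_clsSum_sub_le a h9 hL)).1
    have h4 : clsSum r lamTwo Y X a - S / r.totient =
      (r.totient * clsSum r lamTwo Y X a - S) / r.totient := by field_simp
    rw [h4, le_div_iff₀ htot]
    linarith
  have h5 := Finset.card_nsmul_le_sum R _ _ h2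
  rw [nsmul_eq_mul] at h5
  refine le_trans ?_ h5
  have h6 := r_mul_equiErr (L := L) hr
  have he : 0 ≤ equiErr L r := by
    have := Real.log_natCast_nonneg r
    unfold equiErr
    positivity
  have h7 : (r.totient : ℝ) ≤ r := by exact_mod_cast Nat.totient_le r
  rw [mul_neg, neg_le_neg_iff, ← h6, dens, div_mul_eq_mul_div, le_div_iff₀ htot]
  have h8 : (0 : ℝ) ≤ R.card := by positivity
  nlinarith [mul_le_mul_of_nonneg_left h7 (mul_nonneg h8 he)]

lemma sum_clsSum_ge {r : ℕ} [NeZero r] (R : Finset (ZMod r)ˣ) {Y L E : ℝ} (hL : 0 ≤ L)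
    (hY0 : 0 < Y) (hthr : thr L r ≤ Real.log Y)
    (hE : ∑ d ∈ Finset.Ioc 0 ⌊Y * Real.exp L⌋₊,
      Λ d / d * balSum R d (Y / d) (Y * Real.exp L / d) ≤ dens R * E) :
    dens R * (Real.log Y * (L - 9) - Real.log Y / 2 - E) ≤
      (Real.log Y + L) * ∑ a ∈ R, clsSum r Λ Y (Y * Real.exp L) a := by
  have hr := NeZero.pos r
  have hdens := dens_nonneg R
  have h640 := le_thr r hL
  have hlr := Real.log_natCast_nonneg r
  have hv1 : 1 ≤ Real.log Y := by nlinarith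
  have hY1 : 1 ≤ Y := by
    by_contra h
    have := Real.log_nonpos hY0.le (by linarith)
    linarith
  set X := Y * Real.exp L with hX
  have hXY : Y ≤ X := by
    have := Real.one_le_exp hL
    nlinarith
  have hlogX : Real.log X = Real.log Y + L := by
    rw [hX, Real.log_mul hY0.ne' (Real.exp_pos L).ne', Real.log_exp]
  have h1 := sum_lamTwo_bal_ge R hL hY0 hthr
  have h2 : ∑ n ∈ win Y X, lamTwo n / n * bal R n =
      ∑ n ∈ win Y X, Λ n / n * Real.log n * bal R n +
      ∑ d ∈ Finset.Ioc 0 ⌊X⌋₊, Λ d / d * balSum R d (Y / d) (X / d) := by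
    have h3 := sum_win_mul_apply Λ Λ (fun n : ℕ => 1 / (n : ℝ) * bal R (n : ZMod r)) Y X _ le_rfl
    have h4 : ∑ d ∈ Finset.Ioc 0 ⌊X⌋₊, Λ d / d * balSum R d (Y / d) (X / d) =
        ∑ n ∈ win Y X, (Λ * Λ) n * (1 / (n : ℝ) * bal R (n : ZMod r)) := by
      rw [h3]
      refine Finset.sum_congr rfl fun d _ => ?_
      rw [balSum, Finset.mul_sum]
      refine Finset.sum_congr rfl fun m _ => ?_
      push_cast
      rw [one_div, mul_inv]
      ring
    rw [h4, ← Finset.sum_add_distrib]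
    refine Finset.sum_congr rfl fun n _ => ?_
    rw [lamTwo, ArithmeticFunction.add_apply, pmul_apply, log_apply]
    ring
  have hind : ∑ a ∈ R, clsSum r Λ Y X a = ∑ n ∈ win Y X, Λ n / n * ind R n := by
    rw [← sum_units_clsSum_mul Λ Y X (ind R) fun z hz => ind_of_not_isUnit R hz]
    simp only [ind_unit, mul_ite, mul_one, mul_zero, Finset.sum_ite_mem, Finset.univ_inter]
  have hcop : L - 9 ≤ ∑ n ∈ win Y X, Λ n / n * (if IsUnit (n : ZMod r) then 1 else 0) := by
    have h5 := le_mertens_win hY1 hXY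
    rw [hX, mul_div_cancel_left₀ _ hY0.ne', Real.log_exp, ← hX] at h5
    have h6 := sum_not_coprime_le_one hr hL hY0 hthr
    rw [← hX, Finset.sum_filter] at h6
    have h7 : ∑ n ∈ win Y X, Λ n / (n : ℝ) =
        ∑ n ∈ win Y X, Λ n / n * (if IsUnit (n : ZMod r) then 1 else 0) +
        ∑ n ∈ win Y X, if ¬ n.Coprime r then Λ n / (n : ℝ) else 0 := by
      rw [← Finset.sum_add_distrib]
      refine Finset.sum_congr rfl fun n _ => ?_
      have := ZMod.isUnit_iff_coprime n r
      by_cases hc : n.Coprime r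
      · rw [if_pos (this.2 hc), if_neg (not_not.2 hc)]
        ring
      · rw [if_neg fun h => hc (this.1 h), if_pos hc]
        ring
    linarith
  have hlow : ∀ n ∈ win Y X, Λ n / n * Real.log n * bal R n ≤
      (Real.log Y + L) * (Λ n / n * ind R n) -
      dens R * Real.log Y * (Λ n / n * (if IsUnit (n : ZMod r) then 1 else 0)) := by
    intro n hn
    rw [mem_win hY0.le] at hn
    have hn0 : (0 : ℝ) < n := hY0.trans hn.1
    have h8 := Real.log_le_log hn0 hn.2
    have h9 := Real.log_le_log hY0 hn.1.le
    have h10 := ind_nonneg R (n : ZMod r)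
    have h11 := vonMangoldt_div_nonneg n
    have h12 : (0 : ℝ) ≤ if IsUnit (n : ZMod r) then 1 else 0 := by split_ifs <;> norm_num
    rw [hlogX] at h8
    have h18 : Λ n / n * Real.log n * bal R n = Real.log n * (Λ n / n * ind R n) - Real.log n *
        (dens R * (Λ n / n * (if IsUnit (n : ZMod r) then 1 else 0))) := by
      rw [bal]
      ring_nf
    rw [h18]
    have h13 := mul_le_mul_of_nonneg_right h8 (mul_nonneg h11 h10)
    have h14 := mul_le_mul_of_nonneg_right h9 (mul_nonneg hdens (mul_nonneg h11 h12))
    linarith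
  have h15 := Finset.sum_le_sum hlow
  rw [Finset.sum_sub_distrib, ← Finset.mul_sum, ← Finset.mul_sum, ← hind] at h15
  have h16 : dens R * Real.log Y * (L - 9) ≤ dens R * Real.log Y *
      ∑ n ∈ win Y X, Λ n / n * (if IsUnit (n : ZMod r) then 1 else 0) := by
    gcongr
  have h17 : dens R * (thr L r / 2) ≤ dens R * (Real.log Y / 2) := by gcongr
  rw [h2] at h1
  linarith

/-- If the bilinear block sums are small, the residue classes in `R` receive their fair share
of primes in the window `(Y, Y * exp L]`. -/
lemma sum_clsSum_ge_of_blockSum_le {r : ℕ} [NeZero r] (R : Finset (ZMod r)ˣ) {Y h L Eb : ℝ}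
    (hh : 1 ≤ h) (hL : 7056 * h ≤ L) (hY0 : 0 < Y) (hthr : 960 * thr L r ≤ Real.log Y)
    (hEb0 : Eb ≤ h * L / 16)
    (hEb : ∀ i : ℕ, thr h r ≤ i * h → thr L r + (i * h + h) ≤ Real.log Y →
      blockSum R Y h L i ≤ dens R * Eb) :
    dens R * (L / 2) ≤ ∑ a ∈ R, clsSum r Λ Y (Y * Real.exp L) a := by
  have hdens := dens_nonneg R
  have hL0 : 0 ≤ L := by linarith
  have h640 := le_thr r hL0
  have hlr := Real.log_natCast_nonneg r
  have hthrL : 640 * (1 + L) ≤ thr L r := by nlinarith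
  have hmono : thr h r ≤ thr L r := thr_mono r (by linarith) (by linarith)
  have hth0 : 0 ≤ thr h r := by unfold thr; positivity
  set v := Real.log Y with hv
  set i₀ := ⌈thr h r / h⌉₊ with hi₀
  set i₁ := ⌊(v - thr L r - h) / h⌋₊ with hi₁
  have hh0 : 0 < h := by linarith
  have a1 : thr h r ≤ i₀ * h := by
    have := Nat.le_ceil (thr h r / h)
    rwa [div_le_iff₀ hh0] at this
  have a2 : i₀ * h ≤ thr h r + h := by
    have := (Nat.ceil_lt_add_one (div_nonneg hth0 hh0.le)).le
    rw [← hi₀] at this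
    calc (i₀ : ℝ) * h ≤ (thr h r / h + 1) * h := by gcongr
      _ = _ := by field_simp
  have a3 : i₁ * h ≤ v - thr L r - h := by
    have := Nat.floor_le (div_nonneg (by linarith) hh0.le : 0 ≤ (v - thr L r - h) / h)
    rwa [le_div_iff₀ hh0] at this
  have a4 : v - thr L r - 2 * h ≤ i₁ * h := by
    have := (Nat.lt_floor_add_one ((v - thr L r - h) / h)).le
    rw [← hi₁, div_le_iff₀ hh0] at this
    linarith
  have a5 : (i₀ : ℝ) * h ≤ i₁ * h := by linarith
  have a6 : i₀ ≤ i₁ := by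
    have := le_of_mul_le_mul_right a5 hh0
    exact_mod_cast this
  have h1 := sum_balSum_le (L := L) (Eb := Eb) R hh (by linarith) hY0 a6 (by linarith)
    (by linarith)
    (fun i hi1 hi2 => by
      have b1 : (i₀ : ℝ) ≤ i := by exact_mod_cast hi1
      have b2 : (i : ℝ) + 1 ≤ i₁ := by exact_mod_cast hi2
      apply hEb i
      · nlinarith
      · nlinarith)
  have h2 := sum_clsSum_ge R hL0 hY0 (by linarith) h1
  have h3 : (i₁ - i₀ : ℝ) * (441 * h ^ 2 + Eb) ≤ v * (L / 8) := by
    have b1 : 441 * h ^ 2 + Eb ≤ h * (L / 8) := by nlinarith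
    have b2 : (0 : ℝ) ≤ i₁ - i₀ := by
      have : (i₀ : ℝ) ≤ i₁ := by exact_mod_cast a6
      linarith
    have b3 : (i₁ - i₀ : ℝ) * h ≤ v := by nlinarith
    calc _ ≤ (i₁ - i₀ : ℝ) * (h * (L / 8)) := by gcongr
      _ = ((i₁ - i₀ : ℝ) * h) * (L / 8) := by ring
      _ ≤ _ := by gcongr
  have h4 : 40 * L * (i₀ * h + 6) + 40 * L * (v + L - i₁ * h + 6) ≤ v * (L / 8) := by
    have b1 : (i₀ * h + 6) + (v + L - i₁ * h + 6) ≤ v / 320 := by linarith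
    have := mul_le_mul_of_nonneg_left b1 (by linarith : 0 ≤ 40 * L)
    linarith
  set S := ∑ a ∈ R, clsSum r Λ Y (Y * Real.exp L) a
  have h5 : (v + L) * (dens R * (L / 2)) ≤ (v + L) * S := by
    refine le_trans ?_ h2
    have b1 : (v + L) * (L / 2) ≤ v * (L - 9) - v / 2 -
        (40 * L * (i₀ * h + 6) + (i₁ - i₀) * (441 * h ^ 2 + Eb) +
        40 * L * (v + L - i₁ * h + 6)) := by
      have c1 : v * 7056 ≤ v * L := by
        apply mul_le_mul_of_nonneg_left _ (by linarith)
        linarith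
      have c2 : L * L * 100 ≤ v * L := by nlinarith
      nlinarith
    calc (v + L) * (dens R * (L / 2)) = dens R * ((v + L) * (L / 2)) := by ring
      _ ≤ _ := mul_le_mul_of_nonneg_left b1 hdens
  exact le_of_mul_le_mul_left h5 (by linarith)

/-- Fourier transform on the unit group modulo `r`. -/
def hat {r : ℕ} [NeZero r] (F : (ZMod r)ˣ → ℝ) (χ : DirichletCharacter ℂ r) : ℂ :=
  ∑ a : (ZMod r)ˣ, (F a : ℂ) * χ (a : ZMod r)

lemma conj_char_unit {r : ℕ} (χ : DirichletCharacter ℂ r) (a : (ZMod r)ˣ) :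
    (starRingEnd ℂ) (χ (a : ZMod r)) = χ ((a⁻¹ : (ZMod r)ˣ) : ZMod r) := by
  have h1 : χ (a : ZMod r) * χ ((a⁻¹ : (ZMod r)ˣ) : ZMod r) = 1 := by
    rw [← map_mul, ← Units.val_mul, mul_inv_cancel, Units.val_one, map_one]
  have h2 : χ (a : ZMod r) * (starRingEnd ℂ) (χ (a : ZMod r)) = 1 := by
    rw [Complex.mul_conj, Complex.normSq_eq_norm_sq, χ.unit_norm_eq_one]
    simp
  have h3 : χ (a : ZMod r) ≠ 0 := by
    intro h
    simp [h] at h1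
  exact mul_left_cancel₀ h3 (h2.trans h1.symm)

lemma sum_char_unit {r : ℕ} [NeZero r] (u : (ZMod r)ˣ) :
    ∑ χ : DirichletCharacter ℂ r, χ (u : ZMod r) = if u = 1 then (r.totient : ℂ) else 0 := by
  rw [DirichletCharacter.sum_characters_eq]
  simp only [Units.val_eq_one]

lemma sum_hat_mul_hat_mul {r : ℕ} [NeZero r] (A B G : (ZMod r)ˣ → ℝ) :
    ∑ χ : DirichletCharacter ℂ r, hat A χ * hat B χ * (starRingEnd ℂ) (hat G χ) =
      ((r.totient * ∑ a : (ZMod r)ˣ, ∑ b : (ZMod r)ˣ, A a * B b * G (a * b) : ℝ) : ℂ) := by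
  have h1 : ∀ χ : DirichletCharacter ℂ r, hat A χ * hat B χ * (starRingEnd ℂ) (hat G χ) =
      ∑ a : (ZMod r)ˣ, ∑ b : (ZMod r)ˣ, ∑ c : (ZMod r)ˣ,
        ((A a * B b * G c : ℝ) : ℂ) * χ ((a * b * c⁻¹ : (ZMod r)ˣ) : ZMod r) := by
    intro χ
    simp only [hat, map_sum, map_mul, conj_char_unit, Complex.conj_ofReal]
    rw [Finset.sum_mul_sum, Finset.sum_mul]
    refine Finset.sum_congr rfl fun a _ => ?_
    rw [Finset.sum_mul]
    refine Finset.sum_congr rfl fun b _ => ?_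
    rw [Finset.mul_sum]
    refine Finset.sum_congr rfl fun c _ => ?_
    push_cast
    rw [map_mul, map_mul]
    ring
  simp only [h1]
  rw [Finset.sum_comm]
  simp only [Complex.ofReal_mul, Complex.ofReal_sum, Complex.ofReal_natCast]
  rw [Finset.mul_sum]
  refine Finset.sum_congr rfl fun a _ => ?_
  rw [Finset.sum_comm, Finset.mul_sum]
  refine Finset.sum_congr rfl fun b _ => ?_
  rw [Finset.sum_comm]
  simp only [← Finset.mul_sum, sum_char_unit]
  rw [Finset.sum_eq_single (a * b)]
  · rw [if_pos (mul_inv_cancel _)]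
    ring
  · intro c _ hc
    rw [if_neg, mul_zero]
    rw [mul_inv_eq_one]
    exact fun h => hc h.symm
  · simp

lemma sum_norm_sq_hat {r : ℕ} [NeZero r] (F : (ZMod r)ˣ → ℝ) :
    ∑ χ : DirichletCharacter ℂ r, ‖hat F χ‖ ^ 2 = r.totient * ∑ a : (ZMod r)ˣ, F a ^ 2 := by
  have h1 := sum_hat_mul_hat_mul F (fun b => if b = 1 then 1 else 0) F
  have h2 : ∀ χ : DirichletCharacter ℂ r, hat (fun b => if b = 1 then 1 else 0) χ = 1 := by
    intro χ
    rw [hat, Finset.sum_eq_single 1]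
    · simp
    · intro b _ hb
      simp [hb]
    · simp
  simp only [h2, mul_one, Complex.mul_conj, Complex.normSq_eq_norm_sq] at h1
  rw [← Complex.ofReal_sum] at h1
  rw [Complex.ofReal_inj.1 h1]
  congr 1
  refine Finset.sum_congr rfl fun a _ => ?_
  rw [Finset.sum_eq_single 1]
  · simp
    ring
  · intro b _ hb
    simp [hb]
  · simp

lemma norm_hat_le {r : ℕ} [NeZero r] {F : (ZMod r)ˣ → ℝ} {M : ℝ} (χ : DirichletCharacter ℂ r)
    (h0 : ∀ a, 0 ≤ F a) (hM : ∀ a, F a ≤ M / r.totient) : ‖hat F χ‖ ≤ M := by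
  have htot : (0 : ℝ) < r.totient := by exact_mod_cast Nat.totient_pos.2 (NeZero.pos r)
  calc ‖hat F χ‖ ≤ ∑ a : (ZMod r)ˣ, ‖(F a : ℂ) * χ (a : ZMod r)‖ := norm_sum_le _ _
    _ ≤ ∑ a : (ZMod r)ˣ, M / r.totient := by
      refine Finset.sum_le_sum fun a _ => ?_
      rw [norm_mul, χ.unit_norm_eq_one, mul_one, Complex.norm_real, Real.norm_of_nonneg (h0 a)]
      exact hM a
    _ = M := by
      rw [Finset.sum_const, Finset.card_univ, ZMod.card_units_eq_totient, nsmul_eq_mul]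
      field_simp

lemma sum_norm_sq_hat_le {r : ℕ} [NeZero r] {F : (ZMod r)ˣ → ℝ} {M : ℝ}
    (h0 : ∀ a, 0 ≤ F a) (hM : ∀ a, F a ≤ M / r.totient) :
    ∑ χ : DirichletCharacter ℂ r, ‖hat F χ‖ ^ 2 ≤ M ^ 2 := by
  have htot : (0 : ℝ) < r.totient := by exact_mod_cast Nat.totient_pos.2 (NeZero.pos r)
  rw [sum_norm_sq_hat]
  calc (r.totient : ℝ) * ∑ a : (ZMod r)ˣ, F a ^ 2 ≤
        r.totient * ∑ a : (ZMod r)ˣ, (M / r.totient) ^ 2 := by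
        gcongr with a _
        · exact h0 a
        · exact hM a
    _ = M ^ 2 := by
      rw [Finset.sum_const, Finset.card_univ, ZMod.card_units_eq_totient, nsmul_eq_mul]
      field_simp

/-- Character sum over a set of unit residue classes. -/
def setSum {r : ℕ} (R : Finset (ZMod r)ˣ) (χ : DirichletCharacter ℂ r) : ℂ :=
  ∑ u ∈ R, χ (u : ZMod r)

lemma norm_setSum_le {r : ℕ} (R : Finset (ZMod r)ˣ) (χ : DirichletCharacter ℂ r) :
    ‖setSum R χ‖ ≤ R.card := by
  refine (norm_sum_le _ _).trans ?_
  simp [χ.unit_norm_eq_one]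

lemma sum_char_units_eq_zero {r : ℕ} [NeZero r] {χ : DirichletCharacter ℂ r} (hχ : χ ≠ 1) :
    ∑ a : (ZMod r)ˣ, χ (a : ZMod r) = 0 := by
  obtain ⟨u, hu⟩ := MulChar.ne_one_iff.1 hχ
  have h1 : χ (u : ZMod r) * ∑ a : (ZMod r)ˣ, χ (a : ZMod r) = ∑ a : (ZMod r)ˣ, χ (a : ZMod r) := by
    rw [Finset.mul_sum]
    refine Fintype.sum_bijective (fun a => u * a) (Group.mulLeft_bijective u) _ _ fun a => ?_
    rw [Units.val_mul, map_mul]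
  exact eq_zero_of_mul_eq_self_left hu h1

lemma hat_bal {r : ℕ} [NeZero r] (R : Finset (ZMod r)ˣ) (χ : DirichletCharacter ℂ r) :
    hat (fun u => bal R (u : ZMod r)) χ = if χ = 1 then 0 else setSum R χ := by
  have h1 : hat (fun u => bal R (u : ZMod r)) χ =
      setSum R χ - (dens R : ℂ) * ∑ a : (ZMod r)ˣ, χ (a : ZMod r) := by
    simp only [hat, bal, ind_unit, Units.isUnit, if_true, mul_one, setSum]
    simp only [Complex.ofReal_sub, sub_mul, Finset.sum_sub_distrib, ← Finset.mul_sum]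
    congr 1
    simp [ite_mul, apply_ite]
  rw [h1]
  split_ifs with h
  · subst h
    have htot : (r.totient : ℂ) ≠ 0 := by exact_mod_cast (Nat.totient_pos.2 (NeZero.pos r)).ne'
    simp only [setSum, MulChar.one_apply_coe, Finset.sum_const, Finset.card_univ,
      ZMod.card_units_eq_totient, nsmul_eq_mul, mul_one, dens]
    push_cast
    field_simp
    simp
  · rw [sum_char_units_eq_zero h, mul_zero, sub_zero]

/-- Bilinear sums against the balanced indicator of `R`, in terms of character sums over `R`. -/
lemma bilinear_bal_le {r : ℕ} [NeZero r] (R : Finset (ZMod r)ˣ) (A B : (ZMod r)ˣ → ℝ)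
    {α β κ C : ℝ} (hA0 : ∀ a, 0 ≤ A a) (hA : ∀ a, A a ≤ α / r.totient)
    (hB0 : ∀ a, 0 ≤ B a) (hB : ∀ a, B a ≤ β / r.totient) (hα : 0 ≤ α) (hβ : 0 ≤ β) (hκ : 0 ≤ κ)
    (hC : 0 ≤ C) (S : Finset (DirichletCharacter ℂ r)) (hS : ∀ χ ∈ S, χ ≠ 1 → ‖hat A χ‖ ≤ C)
    (hT : ∀ χ : DirichletCharacter ℂ r, χ ≠ 1 → χ ∉ S → ‖setSum R χ‖ ≤ κ * R.card) :
    ∑ a : (ZMod r)ˣ, ∑ b : (ZMod r)ˣ, A a * B b * bal R ((a * b : (ZMod r)ˣ) : ZMod r) ≤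
      dens R * (κ * (α * β) + S.card * (C * β)) := by
  have htot : (0 : ℝ) < r.totient := by exact_mod_cast Nat.totient_pos.2 (NeZero.pos r)
  have h1 := sum_hat_mul_hat_mul A B (fun u => bal R (u : ZMod r))
  set Q := ∑ a : (ZMod r)ˣ, ∑ b : (ZMod r)ˣ, A a * B b * bal R ((a * b : (ZMod r)ˣ) : ZMod r)
  have h2 : r.totient * Q ≤ ∑ χ : DirichletCharacter ℂ r,
      ‖hat A χ * hat B χ * (starRingEnd ℂ) (hat (fun u => bal R (u : ZMod r)) χ)‖ := by
    calc (r.totient * Q : ℝ) ≤ ‖((r.totient * Q : ℝ) : ℂ)‖ := by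
          rw [Complex.norm_real]
          exact Real.le_norm_self _
      _ ≤ _ := by
          rw [← h1]
          exact norm_sum_le _ _
  have h3 : ∀ χ : DirichletCharacter ℂ r,
      ‖hat A χ * hat B χ * (starRingEnd ℂ) (hat (fun u => bal R (u : ZMod r)) χ)‖ ≤
      κ * R.card * (‖hat A χ‖ * ‖hat B χ‖) + (if χ ∈ S then C * β * R.card else 0) := by
    intro χ
    have hc0 : (0 : ℝ) ≤ R.card := by positivity
    rw [norm_mul, norm_mul, RCLike.norm_conj, hat_bal]
    have p1 : 0 ≤ κ * R.card * (‖hat A χ‖ * ‖hat B χ‖) := by positivity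
    have p2 : (0 : ℝ) ≤ if χ ∈ S then C * β * R.card else 0 := by split_ifs <;> positivity
    by_cases hχ : χ = 1
    · rw [if_pos hχ, norm_zero, mul_zero]
      exact add_nonneg p1 p2
    · rw [if_neg hχ]
      by_cases hχS : χ ∈ S
      · rw [if_pos hχS]
        refine le_trans ?_ (le_add_of_nonneg_left p1)
        have := hS χ hχS hχ
        have := norm_hat_le χ hB0 hB
        have := norm_setSum_le R χ
        gcongr
      · rw [if_neg hχS, add_zero]
        have := hT χ hχ hχS
        calc ‖hat A χ‖ * ‖hat B χ‖ * ‖setSum R χ‖ ≤ ‖hat A χ‖ * ‖hat B χ‖ * (κ * R.card) := by gcongr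
          _ = _ := by ring
  have h4 : ∑ χ : DirichletCharacter ℂ r, ‖hat A χ‖ * ‖hat B χ‖ ≤ α * β := by
    have := Finset.sum_mul_sq_le_sq_mul_sq Finset.univ (fun χ : DirichletCharacter ℂ r => ‖hat A χ‖)
      (fun χ => ‖hat B χ‖)
    refine (sq_le_sq₀ (by positivity) (by positivity)).1 ?_
    refine this.trans ?_
    rw [mul_pow]
    have := sum_norm_sq_hat_le hA0 hA
    have := sum_norm_sq_hat_le hB0 hB
    gcongr
  have h5 := h2.trans (Finset.sum_le_sum fun χ _ => h3 χ)
  rw [Finset.sum_add_distrib, ← Finset.mul_sum, Finset.sum_ite_mem, Finset.univ_inter,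
    Finset.sum_const, nsmul_eq_mul] at h5
  have h6 : r.totient * Q ≤ κ * R.card * (α * β) + S.card * (C * β * R.card) :=
    h5.trans (by gcongr)
  rw [dens, div_mul_eq_mul_div, le_div_iff₀ htot]
  linarith

lemma abel_discrete_complex (e : ℕ → ℂ) (φ : ℕ → ℝ) (a b : ℕ) (B : ℝ) (hab : a < b)
    (hE : ∀ t, a ≤ t → t ≤ b → ‖∑ i ∈ Finset.Ioc a t, e i‖ ≤ B)
    (hφ : ∀ i, a + 1 ≤ i → i + 1 ≤ b → φ (i + 1) ≤ φ i) (h0 : 0 ≤ φ b) :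
    ‖∑ i ∈ Finset.Ioc a b, (φ i : ℂ) * e i‖ ≤ 2 * (φ (a + 1) * B) := by
  have h1 := abel_discrete (fun i => (e i).re) φ a b B hab (fun t h1 h2 => by
    rw [← Complex.re_sum]
    exact (Complex.abs_re_le_norm _).trans (hE t h1 h2)) hφ h0
  have h2 := abel_discrete (fun i => (e i).im) φ a b B hab (fun t h1 h2 => by
    rw [← Complex.im_sum]
    exact (Complex.abs_im_le_norm _).trans (hE t h1 h2)) hφ h0
  refine (Complex.norm_le_abs_re_add_abs_im _).trans ?_
  rw [Complex.re_sum, Complex.im_sum]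
  simp only [Complex.re_ofReal_mul, Complex.im_ofReal_mul]
  linarith

lemma norm_sum_char_Ioc_le {M : ℕ} [NeZero M] {ψ : DirichletCharacter ℂ M} (hψ : ψ ≠ 1) {a b : ℕ}
    (hab : a ≤ b) : ‖∑ n ∈ Finset.Ioc a b, ψ (n : ZMod M)‖ ≤ M := by
  have h1 : ∑ n ∈ Finset.Ioc a b, ψ (n : ZMod M) = ∑ c : ZMod M,
      ((((Finset.Ioc a b).filter fun n : ℕ => (n : ZMod M) = c).card : ℝ) - ((b : ℝ) - a) / M : ℝ)
        * ψ c := by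
    simp only [Complex.ofReal_sub, sub_mul, Finset.sum_sub_distrib, ← Finset.mul_sum]
    rw [MulChar.sum_eq_zero_of_ne_one hψ, mul_zero, sub_zero]
    rw [← Finset.sum_fiberwise (Finset.Ioc a b) (fun n : ℕ => (n : ZMod M))]
    refine Finset.sum_congr rfl fun c _ => ?_
    rw [Finset.sum_congr rfl (g := fun _ => ψ c) (by
      intro n hn
      rw [(Finset.mem_filter.1 hn).2])]
    simp
  rw [h1]
  refine (norm_sum_le _ _).trans ?_
  calc _ ≤ ∑ c : ZMod M, (1 : ℝ) := by
        refine Finset.sum_le_sum fun c _ => ?_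
        rw [norm_mul, Complex.norm_real]
        have h2 := card_class_bounds (NeZero.pos M) c hab
        have h3 := ψ.norm_le_one c
        rw [← Real.norm_eq_abs] at h2
        exact mul_le_one₀ h2 (norm_nonneg _) h3
    _ = M := by simp [ZMod.card]

lemma norm_sum_char_rpow_le {M : ℕ} [NeZero M] {ψ : DirichletCharacter ℂ M} (hψ : ψ ≠ 1) {s : ℝ}
    (hs : 1 ≤ s) {a b : ℕ} (hab : a ≤ b) :
    ‖∑ n ∈ Finset.Ioc a b, (((n : ℝ) ^ (-s) : ℝ) : ℂ) * ψ (n : ZMod M)‖ ≤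
      2 * (M / ((a : ℝ) + 1)) := by
  rcases hab.eq_or_lt with rfl | hab
  · simp
    positivity
  · refine (abel_discrete_complex (fun n : ℕ => ψ (n : ZMod M)) (fun n => (n : ℝ) ^ (-s)) a b M hab
      (fun t h1 _ => norm_sum_char_Ioc_le hψ h1) (fun i hi _ => ?_) (by positivity)).trans ?_
    · have hi0 : (0 : ℝ) < i := by exact_mod_cast (by omega : 0 < i)
      apply Real.rpow_le_rpow_of_nonpos hi0 _ (by linarith)
      push_cast
      linarith
    · rw [div_eq_mul_inv, mul_comm (M : ℝ)]
      gcongr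
      rw [Real.rpow_neg (by positivity)]
      push_cast
      gcongr
      exact Real.self_le_rpow_of_one_le (by linarith [Nat.cast_nonneg (α := ℝ) a]) hs

lemma norm_LFunction_sub_le_of_one_lt {M : ℕ} [NeZero M] {ψ : DirichletCharacter ℂ M} (hψ : ψ ≠ 1)
    {s : ℝ} (hs : 1 < s) (a : ℕ) :
    ‖ψ.LFunction s - ∑ n ∈ Finset.Ioc 0 a, (((n : ℝ) ^ (-s) : ℝ) : ℂ) * ψ (n : ZMod M)‖ ≤
      2 * (M / ((a : ℝ) + 1)) := by
  have hs' : 1 < (s : ℂ).re := by simpa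
  have h1 : LSeriesSummable (fun n : ℕ => ψ (n : ZMod M)) s :=
    ψ.LSeriesSummable_of_one_lt_re hs'
  have h2 := h1.hasSum.tendsto_sum_nat
  have h3 : ∑' n, LSeries.term (fun n : ℕ => ψ (n : ZMod M)) s n = ψ.LFunction s := by
    rw [DirichletCharacter.LFunction_eq_LSeries ψ hs']
    rfl
  rw [h3] at h2
  have h4 : ∀ N : ℕ, ∑ n ∈ Finset.range (N + 1), LSeries.term (fun n : ℕ => ψ (n : ZMod M)) s n =
      ∑ n ∈ Finset.Ioc 0 N, (((n : ℝ) ^ (-s) : ℝ) : ℂ) * ψ (n : ZMod M) := by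
    intro N
    rw [Finset.sum_range_succ', LSeries.term_zero, add_zero]
    have : Finset.Ioc 0 N = (Finset.range N).map ⟨fun i => i + 1, add_left_injective 1⟩ := by
      ext x
      simp only [Finset.mem_Ioc, Finset.mem_map, Finset.mem_range, Function.Embedding.coeFn_mk]
      constructor
      · rintro ⟨h1, h2⟩
        exact ⟨x - 1, by omega, by omega⟩
      · rintro ⟨i, h1, rfl⟩
        omega
    rw [this, Finset.sum_map]
    refine Finset.sum_congr rfl fun n _ => ?_
    rw [LSeries.term_of_ne_zero (by omega), Function.Embedding.coeFn_mk, Complex.ofReal_cpow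
      (by positivity), Complex.ofReal_neg, Complex.cpow_neg, Complex.ofReal_natCast, mul_comm]
    rfl
  have h5 := (h2.comp (Filter.tendsto_add_atTop_nat 1)).sub_const
    (∑ n ∈ Finset.Ioc 0 a, (((n : ℝ) ^ (-s) : ℝ) : ℂ) * ψ (n : ZMod M))
  refine le_of_tendsto h5.norm ?_
  filter_upwards [Filter.eventually_ge_atTop a] with N hN
  simp only [Function.comp]
  rw [h4, ← Finset.sum_Ioc_consecutive _ (Nat.zero_le a) hN, add_sub_cancel_left]
  exact norm_sum_char_rpow_le hψ hs.le hN

lemma norm_LFunction_one_sub_le {M : ℕ} [NeZero M] {ψ : DirichletCharacter ℂ M} (hψ : ψ ≠ 1)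
    (a : ℕ) :
    ‖ψ.LFunction 1 - ∑ n ∈ Finset.Ioc 0 a, ψ (n : ZMod M) / n‖ ≤ 2 * (M / ((a : ℝ) + 1)) := by
  have h1 : Filter.Tendsto (fun s : ℝ => ‖ψ.LFunction s - ∑ n ∈ Finset.Ioc 0 a,
      (((n : ℝ) ^ (-s) : ℝ) : ℂ) * ψ (n : ZMod M)‖) (nhdsWithin 1 (Set.Ioi 1))
      (nhds ‖ψ.LFunction 1 - ∑ n ∈ Finset.Ioc 0 a, ψ (n : ZMod M) / n‖) := by
    have hc : Continuous fun s : ℝ => ψ.LFunction s :=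
      (DirichletCharacter.differentiable_LFunction hψ).continuous.comp Complex.continuous_ofReal
    have hd : Continuous fun s : ℝ => ∑ n ∈ Finset.Ioc 0 a,
        (((n : ℝ) ^ (-s) : ℝ) : ℂ) * ψ (n : ZMod M) := by
      refine continuous_finsetSum _ fun n hn => ?_
      have hn0 : (0 : ℝ) < n := by exact_mod_cast (Finset.mem_Ioc.1 hn).1
      have : Continuous fun s : ℝ => (n : ℝ) ^ (-s) :=
        Continuous.rpow continuous_const continuous_neg fun _ => Or.inl hn0.ne'
      fun_prop
    have he := ((hc.sub hd).norm.tendsto 1).mono_left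
      (nhdsWithin_le_nhds (s := Set.Ioi (1 : ℝ)))
    convert! he using 3
    simp only [Pi.sub_apply, Complex.ofReal_one]
    congr 1
    refine Finset.sum_congr rfl fun n _ => ?_
    rw [Real.rpow_neg_one, div_eq_mul_inv, mul_comm]
    push_cast
    rfl
  refine le_of_tendsto h1 ?_
  filter_upwards [self_mem_nhdsWithin] with s hs
  exact norm_LFunction_sub_le_of_one_lt hψ hs a

/-- Partial sums of `ψ(n) log n / n` are bounded. -/
lemma norm_sum_char_log_div_le {M : ℕ} [NeZero M] {ψ : DirichletCharacter ℂ M} (hψ : ψ ≠ 1)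
    (N : ℕ) : ‖∑ n ∈ Finset.Ioc 0 N, ((Real.log n / n : ℝ) : ℂ) * ψ (n : ZMod M)‖ ≤
      3 + 2 * M := by
  have hterm : ∀ n : ℕ, ‖((Real.log n / n : ℝ) : ℂ) * ψ (n : ZMod M)‖ ≤ 1 := by
    intro n
    rw [norm_mul, Complex.norm_real]
    refine mul_le_one₀ ?_ (norm_nonneg _) (ψ.norm_le_one _)
    rw [Real.norm_of_nonneg (div_nonneg (Real.log_natCast_nonneg n) (Nat.cast_nonneg n))]
    exact div_le_one_of_le₀ (Real.log_le_self (Nat.cast_nonneg n)) (Nat.cast_nonneg n)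
  have hM : (0 : ℝ) ≤ M := Nat.cast_nonneg M
  rcases le_or_gt N 3 with h | h
  · refine (norm_sum_le _ _).trans ((Finset.sum_le_card_nsmul _ _ 1 fun n _ => hterm n).trans ?_)
    rw [Nat.card_Ioc, nsmul_eq_mul, Nat.sub_zero, mul_one]
    have : (N : ℝ) ≤ 3 := by exact_mod_cast h
    linarith
  · rw [← Finset.sum_Ioc_consecutive _ (Nat.zero_le 3) h.le]
    refine (norm_add_le _ _).trans (add_le_add ?_ ?_)
    · refine (norm_sum_le _ _).trans ((Finset.sum_le_card_nsmul _ _ 1 fun n _ => hterm n).trans ?_)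
      simp
    · refine (abel_discrete_complex (fun n : ℕ => ψ (n : ZMod M)) (fun n => Real.log n / n) 3 N M h
        (fun t h1 _ => norm_sum_char_Ioc_le hψ h1) (fun i hi _ => ?_) ?_).trans ?_
      · have hi3 : (4 : ℝ) ≤ i := by exact_mod_cast hi
        have he := Real.exp_one_lt_d9
        push_cast
        exact Real.log_div_self_antitoneOn (Set.mem_Ici.2 (by linarith))
          (Set.mem_Ici.2 (by linarith)) (by linarith)
      · exact div_nonneg (Real.log_natCast_nonneg N) (Nat.cast_nonneg N)
      · have : Real.log ((3 + 1 : ℕ) : ℝ) / ((3 + 1 : ℕ) : ℝ) ≤ 1 :=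
          div_le_one_of_le₀ (Real.log_le_self (Nat.cast_nonneg _)) (Nat.cast_nonneg _)
        nlinarith

/-- `ψ` twisted by a real arithmetic function and divided by `n`. -/
def twist {M : ℕ} (ψ : DirichletCharacter ℂ M) (F : ArithmeticFunction ℝ) :
    ArithmeticFunction ℂ :=
  ⟨fun n => ψ (n : ZMod M) * ((F n / n : ℝ) : ℂ), by simp⟩

lemma twist_mul {M : ℕ} (ψ : DirichletCharacter ℂ M) (F G : ArithmeticFunction ℝ) :
    twist ψ F * twist ψ G = twist ψ (F * G) := by
  ext n
  rw [mul_apply]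
  simp only [twist, ArithmeticFunction.coe_mk, mul_apply]
  rw [Finset.sum_div, Complex.ofReal_sum, Finset.mul_sum]
  refine Finset.sum_congr rfl fun p hp => ?_
  rw [← (Nat.mem_divisorsAntidiagonal.1 hp).1]
  push_cast
  rw [map_mul]
  ring

/-- Partial sums of `ψ(n) Λ(n) / n` are bounded, for a nontrivial character `ψ`. -/
theorem exists_norm_sum_char_vonMangoldt_le {M : ℕ} [NeZero M] {ψ : DirichletCharacter ℂ M}
    (hψ : ψ ≠ 1) : ∃ C : ℝ, ∀ N : ℕ,
      ‖∑ n ∈ Finset.Ioc 0 N, ψ (n : ZMod M) * ((Λ n / n : ℝ) : ℂ)‖ ≤ C := by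
  have hℓ := DirichletCharacter.LFunction_apply_one_ne_zero hψ
  set ℓ := ψ.LFunction 1
  refine ⟨(3 + 2 * M + 2 * M * (Real.log 4 + 4)) / ‖ℓ‖, fun N => ?_⟩
  rw [le_div_iff₀ (norm_pos_iff.2 hℓ), ← norm_mul, Finset.sum_mul]
  rcases Nat.eq_zero_or_pos N with rfl | hN
  · simp
    positivity
  have hN0 : (0 : ℝ) < N := by exact_mod_cast hN
  have h1 := sum_Ioc_mul_eq_sum_sum (twist ψ Λ) (twist ψ (zeta : ArithmeticFunction ℝ)) N
  rw [twist_mul, vonMangoldt_mul_zeta] at h1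
  have h2 := norm_sum_char_log_div_le hψ N
  have h3 : ∑ n ∈ Finset.Ioc 0 N, ψ (n : ZMod M) * ((Λ n / n : ℝ) : ℂ) * ℓ =
      ∑ n ∈ Finset.Ioc 0 N, ((Real.log n / n : ℝ) : ℂ) * ψ (n : ZMod M) +
      ∑ n ∈ Finset.Ioc 0 N, ψ (n : ZMod M) * ((Λ n / n : ℝ) : ℂ) *
        (ℓ - ∑ m ∈ Finset.Ioc 0 (N / n), ψ (m : ZMod M) / m) := by
    have h4 : ∑ n ∈ Finset.Ioc 0 N, ((Real.log n / n : ℝ) : ℂ) * ψ (n : ZMod M) =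
        ∑ n ∈ Finset.Ioc 0 N, ψ (n : ZMod M) * ((Λ n / n : ℝ) : ℂ) *
          ∑ m ∈ Finset.Ioc 0 (N / n), ψ (m : ZMod M) / m := by
      rw [← Finset.sum_congr rfl (s₁ := Finset.Ioc 0 N) (f := fun n => (twist ψ log) n) (by
        intro n _
        simp only [twist, ArithmeticFunction.coe_mk, log_apply]
        ring), h1]
      refine Finset.sum_congr rfl fun n _ => ?_
      simp only [twist, ArithmeticFunction.coe_mk]
      congr 1
      refine Finset.sum_congr rfl fun m hm => ?_
      have := (Finset.mem_Ioc.1 hm).1.ne'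
      rw [natCoe_apply, zeta_apply_ne this]
      push_cast
      ring
    rw [h4, ← Finset.sum_add_distrib]
    refine Finset.sum_congr rfl fun n _ => ?_
    ring
  rw [h3]
  refine (norm_add_le _ _).trans (add_le_add h2 ?_)
  calc _ ≤ ∑ n ∈ Finset.Ioc 0 N, Λ n * (2 * M / N) := by
        refine (norm_sum_le _ _).trans (Finset.sum_le_sum fun n hn => ?_)
        have hn0 : (0 : ℝ) < n := by exact_mod_cast (Finset.mem_Ioc.1 hn).1
        have h5 := norm_LFunction_one_sub_le hψ (N / n)
        have h6 : (N : ℝ) ≤ n * (((N / n : ℕ) : ℝ) + 1) := by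
          have := Nat.lt_mul_div_succ N (Finset.mem_Ioc.1 hn).1
          exact_mod_cast this.le
        rw [norm_mul, norm_mul, Complex.norm_real, Real.norm_of_nonneg (vonMangoldt_div_nonneg n)]
        calc _ ≤ 1 * (Λ n / n) * (2 * (M / (((N / n : ℕ) : ℝ) + 1))) := by
              have := ψ.norm_le_one (n : ZMod M)
              have := vonMangoldt_div_nonneg n
              gcongr
          _ = Λ n * (2 * M / (n * (((N / n : ℕ) : ℝ) + 1))) := by field_simp
          _ ≤ _ := by
              have := vonMangoldt_nonneg (n := n)
              gcongr
    _ = Chebyshev.psi N * (2 * M / N) := by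
        rw [← Finset.sum_mul, Chebyshev.psi, Nat.floor_natCast]
    _ ≤ (Real.log 4 + 4) * N * (2 * M / N) := by
        gcongr
        exact Chebyshev.psi_le_const_mul_self hN0.le
    _ = _ := by field_simp

lemma hat_clsSum {r : ℕ} [NeZero r] (g : ℕ → ℝ) (Y X : ℝ) (χ : DirichletCharacter ℂ r) :
    hat (fun a => clsSum r g Y X (a : ZMod r)) χ =
      ∑ n ∈ win Y X, χ (n : ZMod r) * ((g n / n : ℝ) : ℂ) := by
  have hre := sum_units_clsSum_mul g Y X (fun z : ZMod r => (χ z).re) (fun z hz => by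
    simp [χ.map_nonunit hz])
  have him := sum_units_clsSum_mul g Y X (fun z : ZMod r => (χ z).im) (fun z hz => by
    simp [χ.map_nonunit hz])
  unfold hat
  apply Complex.ext
  · simp only [Complex.re_sum, Complex.mul_re, Complex.ofReal_re, Complex.ofReal_im, zero_mul,
      mul_zero, sub_zero]
    rw [hre]
    exact Finset.sum_congr rfl fun n _ => mul_comm _ _
  · simp only [Complex.im_sum, Complex.mul_im, Complex.ofReal_re, Complex.ofReal_im, zero_mul,
      mul_zero, add_zero, zero_add]
    rw [him]
    exact Finset.sum_congr rfl fun n _ => mul_comm _ _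

lemma norm_hat_changeLevel_le {M r : ℕ} [NeZero r] (hMr : M ∣ r) (ψ : DirichletCharacter ℂ M)
    {C Y L : ℝ} (hC : ∀ N : ℕ, ‖∑ n ∈ Finset.Ioc 0 N, ψ (n : ZMod M) * ((Λ n / n : ℝ) : ℂ)‖ ≤ C)
    (hL : 0 ≤ L) (hY0 : 0 < Y) (hthr : thr L r ≤ Real.log Y) :
    ‖hat (fun a => clsSum r Λ Y (Y * Real.exp L) (a : ZMod r))
      (DirichletCharacter.changeLevel hMr ψ)‖ ≤ 2 * C + 1 := by
  have hle : Y ≤ Y * Real.exp L := le_mul_of_one_le_right hY0.le (Real.one_le_exp hL)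
  have h1 : hat (fun a => clsSum r Λ Y (Y * Real.exp L) (a : ZMod r))
      (DirichletCharacter.changeLevel hMr ψ) =
      (∑ n ∈ Finset.Ioc 0 ⌊Y * Real.exp L⌋₊, ψ (n : ZMod M) * ((Λ n / n : ℝ) : ℂ) -
        ∑ n ∈ Finset.Ioc 0 ⌊Y⌋₊, ψ (n : ZMod M) * ((Λ n / n : ℝ) : ℂ)) -
      ∑ n ∈ (win Y (Y * Real.exp L)).filter (fun n : ℕ => ¬ n.Coprime r),
        ψ (n : ZMod M) * ((Λ n / n : ℝ) : ℂ) := by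
    rw [hat_clsSum, eq_sub_iff_add_eq, Finset.sum_filter, ← Finset.sum_add_distrib,
      eq_sub_iff_add_eq', ← Finset.sum_Ioc_consecutive _ (Nat.zero_le _) (Nat.floor_le_floor hle)]
    congr 1
    refine Finset.sum_congr rfl fun n _ => ?_
    by_cases hn : n.Coprime r
    · have := DirichletCharacter.changeLevel_eq_cast_of_dvd ψ hMr (ZMod.unitOfCoprime n hn)
      rw [ZMod.coe_unitOfCoprime] at this
      rw [this, if_neg (not_not.2 hn), add_zero, ZMod.cast_natCast hMr]
    · rw [if_pos hn, MulChar.map_nonunit _ (by rwa [ZMod.isUnit_iff_coprime]), zero_mul, zero_add]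
  rw [h1]
  have h2 : ‖∑ n ∈ (win Y (Y * Real.exp L)).filter (fun n : ℕ => ¬ n.Coprime r),
        ψ (n : ZMod M) * ((Λ n / n : ℝ) : ℂ)‖ ≤ 1 := by
    refine le_trans (norm_sum_le _ _) (le_trans (Finset.sum_le_sum fun n _ => ?_)
      (sum_not_coprime_le_one (NeZero.pos r) hL hY0 hthr))
    rw [norm_mul, Complex.norm_real, Real.norm_of_nonneg (vonMangoldt_div_nonneg n)]
    exact mul_le_of_le_one_left (vonMangoldt_div_nonneg n) (ψ.norm_le_one _)
  refine (norm_sub_le _ _).trans (add_le_add ((norm_sub_le _ _).trans ?_) h2)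
  rw [two_mul]
  exact add_le_add (hC _) (hC _)

lemma exists_forall_norm_sum_char_le (M : ℕ) [NeZero M] : ∃ C : ℝ, 0 ≤ C ∧
    ∀ ψ : DirichletCharacter ℂ M, ψ ≠ 1 → ∀ N : ℕ,
      ‖∑ n ∈ Finset.Ioc 0 N, ψ (n : ZMod M) * ((Λ n / n : ℝ) : ℂ)‖ ≤ C := by
  have h : ∀ ψ : DirichletCharacter ℂ M, ∃ C : ℝ, 0 ≤ C ∧ (ψ ≠ 1 → ∀ N : ℕ,
      ‖∑ n ∈ Finset.Ioc 0 N, ψ (n : ZMod M) * ((Λ n / n : ℝ) : ℂ)‖ ≤ C) := by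
    intro ψ
    by_cases hψ : ψ = 1
    · exact ⟨0, le_rfl, fun h => absurd hψ h⟩
    · obtain ⟨C, hC⟩ := exists_norm_sum_char_vonMangoldt_le hψ
      exact ⟨C, (norm_nonneg _).trans (hC 0), fun _ => hC⟩
  choose C hC0 hC using h
  exact ⟨∑ ψ, C ψ, Finset.sum_nonneg fun ψ _ => hC0 ψ, fun ψ hψ N => (hC ψ hψ N).trans
    (Finset.single_le_sum (fun ψ _ => hC0 ψ) (Finset.mem_univ ψ))⟩

/-- Primes in windows hit a set `R` of residue classes with the expected density as soon as `R`
is uncorrelated with all characters which do not come from the fixed modulus `M`. -/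
theorem exists_sum_clsSum_ge (M : ℕ) [NeZero M] : ∃ L : ℝ, 1 ≤ L ∧
    ∀ (r : ℕ) [NeZero r] (hMr : M ∣ r) (R : Finset (ZMod r)ˣ),
      (∀ χ : DirichletCharacter ℂ r, (∀ ψ, χ ≠ DirichletCharacter.changeLevel hMr ψ) →
        ‖setSum R χ‖ ≤ 1 / 51200 * R.card) →
      ∀ Y : ℝ, 0 < Y → 960 * thr L r ≤ Real.log Y →
        dens R * (L / 2) ≤ ∑ a ∈ R, clsSum r Λ Y (Y * Real.exp L) a := by
  obtain ⟨C, hC0, hC⟩ := exists_forall_norm_sum_char_le M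
  set N : ℕ := Fintype.card (DirichletCharacter ℂ M)
  set h : ℝ := 1 + 1280 * N * (2 * C + 1) with hh
  have hh1 : 1 ≤ h := by
    have : 0 ≤ 1280 * N * (2 * C + 1) := by positivity
    linarith
  refine ⟨7056 * h, by linarith, fun r _ hMr R hR Y hY0 hY => ?_⟩
  have hL0 : 0 ≤ 7056 * h := by linarith
  refine sum_clsSum_ge_of_blockSum_le (Eb := h * (7056 * h) / 16) R hh1 le_rfl hY0 hY le_rfl
    fun i hi1 hi2 => ?_
  set L := 7056 * h with hL
  set S : Finset (DirichletCharacter ℂ r) :=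
    Finset.univ.image (DirichletCharacter.changeLevel hMr)
  have hS : S.card ≤ N := Finset.card_image_le
  have hthr : thr h r ≤ thr L r := thr_mono r (by linarith) (by linarith)
  have hlogB : thr L r ≤ Real.log (Y * Real.exp (-(i * h))) := by
    rw [Real.log_mul hY0.ne' (Real.exp_pos _).ne', Real.log_exp]
    linarith
  have hA : ∀ a : (ZMod r)ˣ, clsSum r Λ (Real.exp (i * h)) (Real.exp (i * h + h)) a ≤
      40 * h / r.totient := by
    intro a
    rw [Real.exp_add]
    exact brun_titchmarsh_window (NeZero.pos r) a hh1 (Real.exp_pos _) (by rwa [Real.log_exp])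
  have hB : ∀ a : (ZMod r)ˣ, clsSum r Λ (Y * Real.exp (-(i * h)))
      (Y * Real.exp (-(i * h)) * Real.exp L) a ≤ 40 * L / r.totient := fun a =>
    brun_titchmarsh_window (NeZero.pos r) a (by linarith) (by positivity) hlogB
  have hχ : ∀ χ ∈ S, χ ≠ 1 → ‖hat (fun a => clsSum r Λ (Real.exp (i * h))
      (Real.exp (i * h + h)) (a : ZMod r)) χ‖ ≤ 2 * C + 1 := by
    intro χ hχ hne
    obtain ⟨ψ, -, rfl⟩ := Finset.mem_image.1 hχ
    have hψ : ψ ≠ 1 := by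
      rintro rfl
      exact hne (DirichletCharacter.changeLevel_one hMr)
    rw [Real.exp_add]
    exact norm_hat_changeLevel_le hMr ψ (hC ψ hψ) (by linarith) (Real.exp_pos _)
      (by rwa [Real.log_exp])
  have hT : ∀ χ : DirichletCharacter ℂ r, χ ≠ 1 → χ ∉ S → ‖setSum R χ‖ ≤ 1 / 51200 * R.card :=
    fun χ _ hχS => hR χ fun ψ hψ => hχS (Finset.mem_image.2 ⟨ψ, Finset.mem_univ _, hψ.symm⟩)
  have key := bilinear_bal_le R _ _ (fun a => clsSum_nonneg (fun n => vonMangoldt_nonneg) _ _ _) hA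
    (fun a => clsSum_nonneg (fun n => vonMangoldt_nonneg) _ _ _) hB (by linarith) (by linarith)
    (by norm_num) (by linarith) S hχ hT
  refine key.trans (mul_le_mul_of_nonneg_left ?_ (dens_nonneg R))
  have h1 : (S.card : ℝ) * ((2 * C + 1) * (40 * L)) ≤ N * ((2 * C + 1) * (40 * L)) := by
    have : (S.card : ℝ) ≤ N := by exact_mod_cast hS
    gcongr
  have h2 : (N : ℝ) * ((2 * C + 1) * (40 * L)) ≤ h * L / 32 := by
    rw [show (N : ℝ) * ((2 * C + 1) * (40 * L)) = (1280 * N * (2 * C + 1)) * L / 32 by ring]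
    gcongr
    linarith
  calc _ ≤ 1 / 51200 * (40 * h * (40 * L)) + h * L / 32 := by linarith
    _ = _ := by ring

lemma dvd_eval_congr (W : ℤ[X]) {ℓ m n : ℕ} (h : m ≡ n [MOD ℓ]) :
    (ℓ : ℤ) ∣ W.eval (m : ℤ) ↔ (ℓ : ℤ) ∣ W.eval (n : ℤ) := by
  have h1 : (ℓ : ℤ) ∣ (n : ℤ) - m := Nat.modEq_iff_dvd.1 h
  have h2 : (ℓ : ℤ) ∣ W.eval (n : ℤ) - W.eval (m : ℤ) := h1.trans (W.sub_dvd_eval_sub _ _)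
  constructor
  · intro h3
    simpa using dvd_add h2 h3
  · intro h3
    simpa using dvd_sub h3 h2

/-- Units modulo `r` where `W` is nonzero modulo every common prime factor of `q` and `r`. -/
def good (W : ℤ[X]) (q r : ℕ) [NeZero r] : Finset (ZMod r)ˣ :=
  Finset.univ.filter fun u => ∀ ℓ : ℕ, ℓ.Prime → ℓ ∣ q → ℓ ∣ r →
    ¬ (ℓ : ℤ) ∣ W.eval (((u : ZMod r).val : ℕ) : ℤ)

lemma mem_good {W : ℤ[X]} {q r : ℕ} [NeZero r] {u : (ZMod r)ˣ} :
    u ∈ good W q r ↔ ∀ ℓ : ℕ, ℓ.Prime → ℓ ∣ q → ℓ ∣ r →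
      ¬ (ℓ : ℤ) ∣ W.eval (((u : ZMod r).val : ℕ) : ℤ) := by
  simp [good]

/-- The Chinese remainder isomorphism on unit groups. -/
def crtUnits {a b : ℕ} (h : a.Coprime b) : (ZMod (a * b))ˣ ≃* (ZMod a)ˣ × (ZMod b)ˣ :=
  (Units.mapEquiv (ZMod.chineseRemainder h).toMulEquiv).trans MulEquiv.prodUnits

lemma crtUnits_fst {a b : ℕ} (h : a.Coprime b) (u : (ZMod (a * b))ˣ) :
    ((crtUnits h u).1 : ZMod a) = ((u : ZMod (a * b)).cast : ZMod a) := by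
  have : ZMod.chineseRemainder h (u : ZMod (a * b)) = ((u : ZMod (a * b)).cast : ZMod a × ZMod b) := rfl
  change (ZMod.chineseRemainder h (u : ZMod (a * b))).1 = _
  rw [this, Prod.fst_zmod_cast]

lemma crtUnits_snd {a b : ℕ} (h : a.Coprime b) (u : (ZMod (a * b))ˣ) :
    ((crtUnits h u).2 : ZMod b) = ((u : ZMod (a * b)).cast : ZMod b) := by
  have : ZMod.chineseRemainder h (u : ZMod (a * b)) = ((u : ZMod (a * b)).cast : ZMod a × ZMod b) := rfl
  change (ZMod.chineseRemainder h (u : ZMod (a * b))).2 = _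
  rw [this, Prod.snd_zmod_cast]

lemma val_cast_modEq {n a ℓ : ℕ} [NeZero n] (hℓ : ℓ ∣ a) (x : ZMod n) :
    (x.cast : ZMod a).val ≡ x.val [MOD ℓ] := by
  rw [ZMod.cast_eq_val, ZMod.val_natCast]
  exact (Nat.mod_modEq _ _).of_dvd hℓ

lemma mem_good_mul {W : ℤ[X]} {q a b : ℕ} [NeZero a] [NeZero b] (h : a.Coprime b)
    (u : (ZMod (a * b))ˣ) :
    u ∈ good W q (a * b) ↔ (crtUnits h u).1 ∈ good W q a ∧ (crtUnits h u).2 ∈ good W q b := by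
  simp only [mem_good, crtUnits_fst, crtUnits_snd]
  constructor
  · intro H
    refine ⟨fun ℓ h1 h2 h3 => ?_, fun ℓ h1 h2 h3 => ?_⟩
    · rw [dvd_eval_congr W (val_cast_modEq h3 _)]
      exact H ℓ h1 h2 (h3.mul_right b)
    · rw [dvd_eval_congr W (val_cast_modEq h3 _)]
      exact H ℓ h1 h2 (h3.mul_left a)
  · rintro ⟨H1, H2⟩ ℓ h1 h2 h3
    rcases h1.dvd_mul.1 h3 with h4 | h4
    · rw [← dvd_eval_congr W (val_cast_modEq h4 _)]
      exact H1 ℓ h1 h2 h4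
    · rw [← dvd_eval_congr W (val_cast_modEq h4 _)]
      exact H2 ℓ h1 h2 h4

lemma sum_good_mul {W : ℤ[X]} {q a b : ℕ} [NeZero a] [NeZero b] (h : a.Coprime b)
    {E : Type*} [AddCommMonoid E] (F : (ZMod (a * b))ˣ → E) :
    ∑ u ∈ good W q (a * b), F u =
      ∑ u ∈ good W q a ×ˢ good W q b, F ((crtUnits h).symm u) := by
  refine Finset.sum_nbij' (fun u => crtUnits h u) (fun u => (crtUnits h).symm u) ?_ ?_ ?_ ?_ ?_
  · intro u hu
    rw [Finset.mem_product]
    exact (mem_good_mul h u).1 hu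
  · intro u hu
    rw [mem_good_mul h, MulEquiv.apply_symm_apply]
    exact Finset.mem_product.1 hu
  · intro u _
    exact (crtUnits h).symm_apply_apply u
  · intro u _
    exact (crtUnits h).apply_symm_apply u
  · intro u _
    rw [(crtUnits h).symm_apply_apply]

lemma card_good_mul {W : ℤ[X]} {q a b : ℕ} [NeZero a] [NeZero b] (h : a.Coprime b) :
    (good W q (a * b)).card = (good W q a).card * (good W q b).card := by
  rw [← Finset.card_product, Finset.card_eq_sum_ones, Finset.card_eq_sum_ones,
    sum_good_mul h]

lemma card_compl_good_le {W : ℤ[X]} {q ℓ : ℕ} [NeZero ℓ] (hℓ : ℓ.Prime) {n : ℕ}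
    (hn : ¬ (ℓ : ℤ) ∣ W.eval (n : ℤ)) : (good W q ℓ)ᶜ.card ≤ W.natDegree := by
  have : Fact ℓ.Prime := ⟨hℓ⟩
  set P := W.map (Int.castRingHom (ZMod ℓ)) with hP
  have hev : ∀ m : ℕ, P.eval (m : ZMod ℓ) = ((W.eval (m : ℤ) : ℤ) : ZMod ℓ) := by
    intro m
    have := Polynomial.eval_intCast_map (Int.castRingHom (ZMod ℓ)) W m
    rw [Int.cast_natCast] at this
    exact this
  have hP0 : P ≠ 0 := by
    intro h0
    apply hn
    rw [← ZMod.intCast_zmod_eq_zero_iff_dvd, ← hev, h0, eval_zero]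
  calc (good W q ℓ)ᶜ.card ≤ P.roots.toFinset.card := by
        refine Finset.card_le_card_of_injOn (fun u => (u : ZMod ℓ)) (fun u hu => ?_)
          (fun u _ v _ huv => Units.ext huv)
        simp only [Finset.coe_compl, Set.mem_compl_iff, Finset.mem_coe, mem_good] at hu
        push Not at hu
        obtain ⟨ℓ', h1, -, h3, h4⟩ := hu
        obtain rfl := (Nat.prime_dvd_prime_iff_eq h1 hℓ).1 h3
        rw [← ZMod.intCast_zmod_eq_zero_iff_dvd, ← hev, ZMod.natCast_zmod_val] at h4
        simp only [Finset.mem_coe, Multiset.mem_toFinset]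
        exact (mem_roots hP0).2 h4
    _ ≤ Multiset.card P.roots := P.roots.toFinset_card_le
    _ ≤ P.natDegree := P.card_roots'
    _ ≤ W.natDegree := natDegree_map_le

lemma le_card_good {W : ℤ[X]} {q ℓ : ℕ} [NeZero ℓ] (hℓ : ℓ.Prime) {n : ℕ}
    (hn : ¬ (ℓ : ℤ) ∣ W.eval (n : ℤ)) : ℓ - 1 ≤ (good W q ℓ).card + W.natDegree := by
  have h1 := card_compl_good_le (q := q) hℓ hn
  have h2 := Finset.card_add_card_compl (good W q ℓ)
  rw [ZMod.card_units_eq_totient, Nat.totient_prime hℓ] at h2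
  omega

/-- A character nontrivial on the `a`-component has small sum over the good units. -/
lemma norm_setSum_good_le {W : ℤ[X]} {q a b : ℕ} [NeZero a] [NeZero b] (ha : a.Prime)
    (h : a.Coprime b) {n : ℕ} (hn : ¬ (a : ℤ) ∣ W.eval (n : ℤ)) (χ : DirichletCharacter ℂ (a * b))
    {v : (ZMod a)ˣ} (hv : χ ((crtUnits h).symm (v, 1) : (ZMod (a * b))ˣ) ≠ 1) :
    ‖setSum (good W q (a * b)) χ‖ ≤ W.natDegree * (good W q b).card := by
  let χ₁ : (ZMod a)ˣ →* ℂ := (χ.toMonoidHom.comp (Units.coeHom _)).comp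
    ((crtUnits h).symm.toMonoidHom.comp (MonoidHom.inl _ _))
  let χ₂ : (ZMod b)ˣ →* ℂ := (χ.toMonoidHom.comp (Units.coeHom _)).comp
    ((crtUnits h).symm.toMonoidHom.comp (MonoidHom.inr _ _))
  have hχ : ∀ u : (ZMod a)ˣ × (ZMod b)ˣ,
      χ ((crtUnits h).symm u : (ZMod (a * b))ˣ) = χ₁ u.1 * χ₂ u.2 := by
    intro u
    change _ = χ (((crtUnits h).symm (u.1, 1) : (ZMod (a * b))ˣ) : ZMod (a * b)) *
      χ (((crtUnits h).symm (1, u.2) : (ZMod (a * b))ˣ) : ZMod (a * b))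
    rw [← map_mul, ← Units.val_mul, ← map_mul, Prod.mk_mul_mk, mul_one, one_mul]
  have h1 : χ₁ ≠ 1 := fun h0 => hv (by
    have := DFunLike.congr_fun h0 v
    exact this)
  have h2 := sum_hom_units_eq_zero χ₁ h1
  have hn1 : ∀ u, ‖χ₁ u‖ ≤ 1 := fun u => χ.norm_le_one _
  have hn2 : ∀ u, ‖χ₂ u‖ ≤ 1 := fun u => χ.norm_le_one _
  have h3 : ‖∑ u ∈ good W q a, χ₁ u‖ ≤ W.natDegree := by
    rw [← Finset.sum_add_sum_compl (good W q a), add_eq_zero_iff_eq_neg] at h2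
    rw [h2, norm_neg]
    refine (norm_sum_le _ _).trans ((Finset.sum_le_card_nsmul _ _ 1 fun u _ => hn1 u).trans ?_)
    rw [nsmul_eq_mul, mul_one]
    exact_mod_cast card_compl_good_le ha hn
  have h4 : ‖∑ u ∈ good W q b, χ₂ u‖ ≤ (good W q b).card := by
    refine (norm_sum_le _ _).trans ((Finset.sum_le_card_nsmul _ _ 1 fun u _ => hn2 u).trans ?_)
    rw [nsmul_eq_mul, mul_one]
  unfold setSum
  rw [sum_good_mul h, Finset.sum_congr rfl fun u _ => hχ u, Finset.sum_product,
    ← Finset.sum_mul_sum, norm_mul]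
  exact mul_le_mul h3 h4 (norm_nonneg _) (Nat.cast_nonneg _)

lemma exists_prime_not_factorsThrough {M r : ℕ} [NeZero r] (hr : Squarefree r) (hMr : M ∣ r)
    (χ : DirichletCharacter ℂ r) (hχ : ∀ ψ, χ ≠ DirichletCharacter.changeLevel hMr ψ) :
    ∃ ℓ b : ℕ, ℓ.Prime ∧ r = ℓ * b ∧ ¬ ℓ ∣ M ∧ ¬ χ.FactorsThrough b := by
  by_contra! H
  have hcond : ∀ ℓ : ℕ, ℓ.Prime → ℓ ∣ χ.conductor → ℓ ∣ M := by
    intro ℓ hℓ hdvd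
    by_contra hM
    obtain ⟨b, hb⟩ := hdvd.trans χ.conductor_dvd_level
    have h1 := H ℓ b hℓ hb hM
    have h2 : χ.conductor ∣ b := (χ.mem_conductorSet_iff_conductor_dvd (by
      exact ⟨ℓ, by rw [hb, mul_comm]⟩)).1 h1
    have h3 : ℓ * ℓ ∣ r := by
      rw [hb]
      exact mul_dvd_mul_left ℓ (hdvd.trans h2)
    exact hℓ.one_lt.ne' (Nat.isUnit_iff.1 (hr ℓ h3))
  have hsq : Squarefree χ.conductor := hr.squarefree_of_dvd χ.conductor_dvd_level
  have h4 : χ.conductor ∣ M := by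
    rw [← Nat.prod_primeFactors_of_squarefree hsq]
    exact Finset.prod_primes_dvd M (fun p hp => (Nat.prime_of_mem_primeFactors hp).prime)
      fun p hp => hcond p (Nat.prime_of_mem_primeFactors hp) (Nat.dvd_of_mem_primeFactors hp)
  have h5 : χ.FactorsThrough M := (χ.mem_conductorSet_iff_conductor_dvd hMr).2 h4
  obtain ⟨_, ψ, hψ⟩ := h5
  exact hχ ψ hψ

lemma exists_crtUnits_ne_one {a b : ℕ} [NeZero a] [NeZero b] (h : a.Coprime b)
    (χ : DirichletCharacter ℂ (a * b)) (hχ : ¬ χ.FactorsThrough b) :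
    ∃ v : (ZMod a)ˣ, χ ((crtUnits h).symm (v, 1) : (ZMod (a * b))ˣ) ≠ 1 := by
  rw [χ.factorsThrough_iff_ker_unitsMap (Nat.dvd_mul_left b a), SetLike.not_le_iff_exists] at hχ
  obtain ⟨u, hu1, hu2⟩ := hχ
  refine ⟨(crtUnits h u).1, fun h1 => hu2 ?_⟩
  have h2 : (crtUnits h u).2 = 1 := by
    ext
    rw [crtUnits_snd]
    have := congrArg Units.val ((MonoidHom.mem_ker).1 hu1)
    rwa [ZMod.unitsMap_val] at this
  rw [← h2, Prod.mk.eta, MulEquiv.symm_apply_apply] at h1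
  rw [MonoidHom.mem_ker]
  ext
  exact h1

lemma dens_good_mul {W : ℤ[X]} {q a b : ℕ} [NeZero a] [NeZero b] (h : a.Coprime b) :
    dens (good W q (a * b)) = dens (good W q a) * dens (good W q b) := by
  unfold dens
  rw [card_good_mul h, Nat.totient_mul h]
  push_cast
  rw [mul_div_mul_comm]

lemma dens_good_one {W : ℤ[X]} {q : ℕ} : dens (good W q 1) = 1 := by
  have : good W q 1 = Finset.univ := by
    ext u
    simp only [mem_good, Finset.mem_univ, iff_true]
    intro ℓ h1 _ h2
    exact absurd (Nat.dvd_one.1 h2) h1.one_lt.ne'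
  rw [dens, this]
  simp

lemma prod_le_dens_good {W : ℤ[X]} {q : ℕ} (F : ℕ → ℝ) (S : Finset ℕ) (hS : ∀ ℓ ∈ S, ℓ.Prime)
    (hF0 : ∀ ℓ ∈ S, 0 ≤ F ℓ) (hF : ∀ ℓ ∈ S, ∀ [NeZero ℓ], F ℓ ≤ dens (good W q ℓ)) :
    ∀ r : ℕ, ∀ [NeZero r], r = ∏ ℓ ∈ S, ℓ → ∏ ℓ ∈ S, F ℓ ≤ dens (good W q r) := by
  induction S using Finset.induction_on with
  | empty =>
    intro r _ hr
    rw [Finset.prod_empty] at hr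
    subst hr
    rw [Finset.prod_empty, dens_good_one]
  | insert p S hp ih =>
    intro r _ hr
    rw [Finset.prod_insert hp] at hr ⊢
    have hpp := hS p (Finset.mem_insert_self _ _)
    have hpos : 0 < ∏ ℓ ∈ S, ℓ :=
      Finset.prod_pos fun ℓ hℓ => (hS ℓ (Finset.mem_insert_of_mem hℓ)).pos
    have : NeZero p := ⟨hpp.ne_zero⟩
    have : NeZero (∏ ℓ ∈ S, ℓ) := ⟨hpos.ne'⟩
    have hc : p.Coprime (∏ ℓ ∈ S, ℓ) := by
      refine Nat.Coprime.prod_right fun ℓ hℓ => ?_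
      rw [Nat.coprime_primes hpp (hS ℓ (Finset.mem_insert_of_mem hℓ))]
      rintro rfl
      exact hp hℓ
    subst hr
    rw [dens_good_mul hc]
    refine mul_le_mul (hF p (Finset.mem_insert_self _ _)) (ih (fun ℓ hℓ => hS ℓ
      (Finset.mem_insert_of_mem hℓ)) (fun ℓ hℓ => hF0 ℓ (Finset.mem_insert_of_mem hℓ))
      (fun ℓ hℓ => hF ℓ (Finset.mem_insert_of_mem hℓ)) _ rfl)
      (Finset.prod_nonneg fun ℓ hℓ => hF0 ℓ (Finset.mem_insert_of_mem hℓ)) (dens_nonneg _)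

lemma good_prime_of_not_dvd {W : ℤ[X]} {q ℓ : ℕ} [NeZero ℓ] (hℓ : ℓ.Prime) (h : ¬ ℓ ∣ q) :
    good W q ℓ = Finset.univ := by
  ext u
  simp only [mem_good, Finset.mem_univ, iff_true]
  intro p h1 h2 h3
  obtain rfl := (Nat.prime_dvd_prime_iff_eq h1 hℓ).1 h3
  exact absurd h2 h

lemma dens_univ {r : ℕ} [NeZero r] : dens (Finset.univ : Finset (ZMod r)ˣ) = 1 := by
  rw [dens, Finset.card_univ, ZMod.card_units_eq_totient]
  exact div_self (by exact_mod_cast (Nat.totient_pos.2 (NeZero.pos r)).ne')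

lemma one_div_le_dens_good {W : ℤ[X]} {q ℓ n : ℕ} [NeZero ℓ] (hℓ : ℓ.Prime)
    (hn : n.Coprime q) (hW : ∀ p : ℕ, p.Prime → p ∣ q → ¬ (p : ℤ) ∣ W.eval (n : ℤ)) :
    1 / (ℓ : ℝ) ≤ dens (good W q ℓ) := by
  have hℓ0 : (1 : ℝ) ≤ ℓ := by exact_mod_cast hℓ.one_lt.le
  by_cases h : ℓ ∣ q
  · have hc : n.Coprime ℓ := hn.coprime_dvd_right h
    have hmem : ZMod.unitOfCoprime n hc ∈ good W q ℓ := by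
      rw [mem_good]
      intro p h1 h2 h3
      rw [ZMod.coe_unitOfCoprime, ZMod.val_natCast, dvd_eval_congr W ((Nat.mod_modEq n ℓ).of_dvd h3)]
      exact hW p h1 h2
    have h1 : (1 : ℝ) ≤ (good W q ℓ).card := by exact_mod_cast Finset.card_pos.2 ⟨_, hmem⟩
    have h2 : (0 : ℝ) < ℓ.totient := by exact_mod_cast Nat.totient_pos.2 hℓ.pos
    have h3 : (ℓ.totient : ℝ) ≤ ℓ := by exact_mod_cast Nat.totient_le ℓ
    unfold dens
    gcongr
  · rw [good_prime_of_not_dvd hℓ h, dens_univ]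
    exact div_le_one_of_le₀ hℓ0 (by linarith)

lemma one_sub_le_dens_good {W : ℤ[X]} {q ℓ n : ℕ} [NeZero ℓ] (hℓ : ℓ.Prime)
    (hW : ∀ p : ℕ, p.Prime → p ∣ q → ¬ (p : ℤ) ∣ W.eval (n : ℤ)) :
    1 - W.natDegree / ((ℓ : ℝ) - 1) ≤ dens (good W q ℓ) := by
  have hℓ0 : (1 : ℝ) < ℓ := by exact_mod_cast hℓ.one_lt
  by_cases h : ℓ ∣ q
  · have h1 := le_card_good (q := q) hℓ (hW ℓ hℓ h)
    have h2 : ((ℓ - 1 : ℕ) : ℝ) ≤ (good W q ℓ).card + W.natDegree := by exact_mod_cast h1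
    rw [Nat.cast_sub hℓ.one_lt.le, Nat.cast_one] at h2
    rw [dens, Nat.totient_prime hℓ, Nat.cast_sub hℓ.one_lt.le, Nat.cast_one, le_div_iff₀
      (by linarith), sub_mul, div_mul_cancel₀ _ (by linarith)]
    linarith
  · rw [good_prime_of_not_dvd hℓ h, dens_univ]
    have : 0 ≤ W.natDegree / ((ℓ : ℝ) - 1) := div_nonneg (Nat.cast_nonneg _) (by linarith)
    linarith

lemma norm_setSum_good_le_card {W : ℤ[X]} {q r M C n : ℕ} [NeZero r] (hr : Squarefree r)
    (hMr : M ∣ r) (hC : ∀ ℓ : ℕ, ℓ.Prime → ℓ ∣ r → ¬ ℓ ∣ M → C < ℓ ∧ ℓ ∣ q)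
    (hD : 51201 * W.natDegree ≤ C)
    (hW : ∀ p : ℕ, p.Prime → p ∣ q → ¬ (p : ℤ) ∣ W.eval (n : ℤ))
    (χ : DirichletCharacter ℂ r) (hχ : ∀ ψ, χ ≠ DirichletCharacter.changeLevel hMr ψ) :
    ‖setSum (good W q r) χ‖ ≤ 1 / 51200 * (good W q r).card := by
  obtain ⟨ℓ, b, hℓ, rfl, hM, hb⟩ := exists_prime_not_factorsThrough hr hMr χ hχ
  have hne : ℓ * b ≠ 0 := NeZero.ne _
  have : NeZero ℓ := ⟨left_ne_zero_of_mul hne⟩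
  have : NeZero b := ⟨right_ne_zero_of_mul hne⟩
  have hc : ℓ.Coprime b := Nat.coprime_of_squarefree_mul hr
  obtain ⟨hℓC, hℓq⟩ := hC ℓ hℓ (Nat.dvd_mul_right ℓ b) hM
  obtain ⟨v, hv⟩ := exists_crtUnits_ne_one hc χ hb
  refine (norm_setSum_good_le hℓ hc (hW ℓ hℓ hℓq) χ hv).trans ?_
  have h1 := le_card_good (q := q) hℓ (hW ℓ hℓ hℓq)
  have h2 : 51200 * (W.natDegree : ℝ) ≤ (good W q ℓ).card := by
    have : 51200 * W.natDegree ≤ (good W q ℓ).card := by omega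
    exact_mod_cast this
  rw [card_good_mul hc]
  push_cast
  have h3 : (0 : ℝ) ≤ (good W q b).card := Nat.cast_nonneg _
  nlinarith

lemma exp_neg_two_mul_le {x : ℝ} (h0 : 0 ≤ x) (h1 : x ≤ 1 / 2) : Real.exp (-(2 * x)) ≤ 1 - x := by
  rw [Real.exp_neg, inv_le_comm₀ (Real.exp_pos _) (by linarith)]
  refine le_trans ?_ (Real.add_one_le_exp _)
  rw [inv_le_iff_one_le_mul₀ (by linarith)]
  nlinarith

lemma sum_log_primeFactors_le {q : ℕ} (hq : 0 < q) :
    ∑ ℓ ∈ q.primeFactors, Real.log ℓ ≤ Real.log q := by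
  rw [← Real.log_prod fun p hp => by exact_mod_cast (Nat.prime_of_mem_primeFactors hp).ne_zero]
  refine Real.log_le_log ?_ ?_
  · exact Finset.prod_pos fun p hp => by exact_mod_cast (Nat.prime_of_mem_primeFactors hp).pos
  · rw [← Nat.cast_prod]
    exact_mod_cast Nat.le_of_dvd hq (Nat.prod_primeFactors_dvd q)

lemma sum_inv_primeFactors_le {q C : ℕ} (hq : 0 < q) (hC : 2 ≤ C) :
    Real.log C * ∑ ℓ ∈ q.primeFactors.filter (fun ℓ => C < ℓ), 1 / (ℓ : ℝ) ≤
      Real.log (1 + Real.log q) + 7 := by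
  have hlq : 0 ≤ Real.log q := Real.log_natCast_nonneg q
  set w := 1 + Real.log q with hw
  have hw0 : 0 < w := by linarith
  have hlog : ∀ ℓ ∈ q.primeFactors, 0 ≤ Real.log ℓ := fun ℓ _ => Real.log_natCast_nonneg ℓ
  have h1 : ∀ ℓ ∈ q.primeFactors.filter (fun ℓ => C < ℓ), Real.log C * (1 / (ℓ : ℝ)) ≤
      (if (ℓ : ℝ) ≤ w then Λ ℓ / ℓ else 0) + Real.log ℓ / w := by
    intro ℓ hℓ
    obtain ⟨hℓ, hCℓ⟩ := Finset.mem_filter.1 hℓ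
    have hp := Nat.prime_of_mem_primeFactors hℓ
    have hℓ0 : (0 : ℝ) < ℓ := by exact_mod_cast hp.pos
    have h2 : Real.log C ≤ Real.log ℓ :=
      Real.log_le_log (by positivity) (by exact_mod_cast hCℓ.le)
    have h3 := hlog ℓ hℓ
    rw [mul_one_div]
    split_ifs with h
    · rw [vonMangoldt_apply_prime hp]
      have : 0 ≤ Real.log ℓ / w := by positivity
      have : Real.log C / ℓ ≤ Real.log ℓ / ℓ := by gcongr
      linarith
    · rw [zero_add]
      have : w ≤ ℓ := (not_le.1 h).le
      gcongr
  rw [Finset.mul_sum]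
  refine (Finset.sum_le_sum h1).trans ?_
  rw [Finset.sum_add_distrib, ← Finset.sum_filter]
  have h4 : ∑ ℓ ∈ (q.primeFactors.filter (fun ℓ => C < ℓ)).filter (fun ℓ : ℕ => (ℓ : ℝ) ≤ w),
      Λ ℓ / (ℓ : ℝ) ≤ Real.log w + 6 := by
    refine le_trans (Finset.sum_le_sum_of_subset_of_nonneg ?_ fun n _ _ =>
      vonMangoldt_div_nonneg n) (mertens_upper_floor (by linarith))
    intro ℓ hℓ
    simp only [Finset.mem_filter] at hℓ
    rw [Finset.mem_Ioc]
    exact ⟨(Nat.prime_of_mem_primeFactors hℓ.1.1).pos, Nat.le_floor hℓ.2⟩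
  have h5 : ∑ ℓ ∈ q.primeFactors.filter (fun ℓ => C < ℓ), Real.log ℓ / w ≤ 1 := by
    rw [← Finset.sum_div]
    refine div_le_one_of_le₀ ?_ hw0.le
    have := sum_log_primeFactors_le hq
    have h6 : ∑ ℓ ∈ q.primeFactors.filter (fun ℓ => C < ℓ), Real.log ℓ ≤
        ∑ ℓ ∈ q.primeFactors, Real.log ℓ :=
      Finset.sum_le_sum_of_subset_of_nonneg (Finset.filter_subset _ _) fun ℓ hℓ _ => hlog ℓ hℓ
    linarith
  linarith

/-- The primes up to `C` together with the prime factors of `q`. -/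
def modPrimes (C q : ℕ) : Finset ℕ :=
  (Finset.range (C + 1)).filter Nat.Prime ∪ q.primeFactors.filter (fun ℓ => C < ℓ)

lemma prime_of_mem_modPrimes {C q ℓ : ℕ} (h : ℓ ∈ modPrimes C q) : ℓ.Prime := by
  rcases Finset.mem_union.1 h with h | h
  · exact (Finset.mem_filter.1 h).2
  · exact Nat.prime_of_mem_primeFactors (Finset.mem_filter.1 h).1

lemma disjoint_modPrimes (C q : ℕ) : Disjoint ((Finset.range (C + 1)).filter Nat.Prime)
    (q.primeFactors.filter (fun ℓ => C < ℓ)) := by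
  rw [Finset.disjoint_left]
  intro ℓ h1 h2
  have := Finset.mem_range.1 (Finset.mem_filter.1 h1).1
  have := (Finset.mem_filter.1 h2).2
  omega

lemma exists_dens_good_ge (W : ℤ[X]) {η : ℝ} (hη : 0 < η) : ∃ (C : ℕ) (c : ℝ),
    51201 * W.natDegree ≤ C ∧ 0 < c ∧ ∀ q n : ℕ, 0 < q → n.Coprime q →
      (∀ p : ℕ, p.Prime → p ∣ q → ¬ (p : ℤ) ∣ W.eval (n : ℤ)) →
      ∀ r : ℕ, ∀ [NeZero r], r = ∏ ℓ ∈ modPrimes C q, ℓ →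
        c * (1 + Real.log q) ^ (-η) ≤ dens (good W q r) := by
  set D := W.natDegree
  obtain ⟨C, hC⟩ : ∃ C : ℕ, 51201 * (D : ℝ) + 2 + Real.exp (4 * D / η) ≤ C := exists_nat_ge _
  have hD0 : (0 : ℝ) ≤ D := Nat.cast_nonneg D
  have he := Real.exp_pos (4 * D / η)
  have hC2 : 2 ≤ C := by
    have : (2 : ℝ) ≤ C := by linarith
    exact_mod_cast this
  have hCD : 51201 * D ≤ C := by
    have : (51201 : ℝ) * D ≤ C := by linarith
    exact_mod_cast this
  have hlogC : 4 * D ≤ η * Real.log C := by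
    have := Real.log_le_log he (by linarith : Real.exp (4 * D / η) ≤ C)
    rw [Real.log_exp, div_le_iff₀ hη] at this
    linarith
  set P₀ := (Finset.range (C + 1)).filter Nat.Prime with hP₀
  have hP₀pos : 0 < ∏ ℓ ∈ P₀, 1 / (ℓ : ℝ) := Finset.prod_pos fun ℓ hℓ => by
    have : (0 : ℝ) < ℓ := by exact_mod_cast (Finset.mem_filter.1 hℓ).2.pos
    positivity
  refine ⟨C, (∏ ℓ ∈ P₀, 1 / (ℓ : ℝ)) * Real.exp (-(7 * η)), hCD, by positivity,
    fun q n hq hn hW r _ hr => ?_⟩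
  have hw : 0 < 1 + Real.log q := by
    have := Real.log_natCast_nonneg q
    linarith
  let F : ℕ → ℝ := fun ℓ => if ℓ ≤ C then 1 / (ℓ : ℝ) else 1 - D / ((ℓ : ℝ) - 1)
  have hbig : ∀ ℓ : ℕ, C < ℓ → Real.exp (-(4 * D * (1 / (ℓ : ℝ)))) ≤ 1 - D / ((ℓ : ℝ) - 1) := by
    intro ℓ hℓ
    have h1 : (C : ℝ) < ℓ := by exact_mod_cast hℓ
    have h2 : D / ((ℓ : ℝ) - 1) ≤ 2 * (D * (1 / (ℓ : ℝ))) := by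
      rw [div_le_iff₀ (by linarith)]
      have : (ℓ : ℝ) ≤ 2 * (ℓ - 1) := by linarith
      have hℓ0 : (ℓ : ℝ) ≠ 0 := by linarith
      calc (D : ℝ) = D * (1 / ℓ) * ℓ := by rw [mul_assoc, one_div_mul_cancel hℓ0, mul_one]
        _ ≤ D * (1 / ℓ) * (2 * (ℓ - 1)) := by gcongr
        _ = _ := by ring
    have h3 : D / ((ℓ : ℝ) - 1) ≤ 1 / 2 := by
      rw [div_le_iff₀ (by linarith)]
      linarith
    refine le_trans (Real.exp_le_exp.2 ?_) (exp_neg_two_mul_le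
      (div_nonneg hD0 (by linarith)) h3)
    linarith
  refine le_trans ?_ (prod_le_dens_good F (modPrimes C q) (fun ℓ h => prime_of_mem_modPrimes h)
    (fun ℓ h => ?_) (fun ℓ h _ => ?_) r hr)
  · rw [modPrimes, Finset.prod_union (disjoint_modPrimes C q), mul_assoc]
    have h1 : ∏ ℓ ∈ P₀, F ℓ = ∏ ℓ ∈ P₀, 1 / (ℓ : ℝ) := by
      refine Finset.prod_congr rfl fun ℓ hℓ => if_pos ?_
      have := Finset.mem_range.1 (Finset.mem_filter.1 hℓ).1
      omega
    rw [h1]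
    refine mul_le_mul_of_nonneg_left ?_ hP₀pos.le
    have h2 : ∏ ℓ ∈ q.primeFactors.filter (fun ℓ => C < ℓ), Real.exp (-(4 * D * (1 / (ℓ : ℝ)))) ≤
        ∏ ℓ ∈ q.primeFactors.filter (fun ℓ => C < ℓ), F ℓ := by
      refine Finset.prod_le_prod (fun _ _ => (Real.exp_pos _).le) fun ℓ hℓ => ?_
      have := (Finset.mem_filter.1 hℓ).2
      rw [show F ℓ = _ from if_neg (by omega)]
      exact hbig ℓ this
    refine le_trans ?_ h2
    rw [← Real.exp_sum, Real.rpow_def_of_pos hw, ← Real.exp_add, Real.exp_le_exp,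
      Finset.sum_neg_distrib, ← Finset.mul_sum]
    have h3 := sum_inv_primeFactors_le hq hC2
    set E₁ := ∑ ℓ ∈ q.primeFactors.filter (fun ℓ => C < ℓ), 1 / (ℓ : ℝ)
    have h4 : 0 ≤ E₁ := Finset.sum_nonneg fun ℓ _ => by positivity
    have h5 := mul_le_mul_of_nonneg_right hlogC h4
    have h6 := mul_le_mul_of_nonneg_left h3 hη.le
    linarith
  · by_cases h1 : ℓ ≤ C
    · rw [show F ℓ = _ from if_pos h1]
      positivity
    · rw [show F ℓ = _ from if_neg h1]
      exact (Real.exp_pos _).le.trans (hbig ℓ (not_le.1 h1))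
  · have hp := prime_of_mem_modPrimes h
    by_cases h1 : ℓ ≤ C
    · rw [show F ℓ = _ from if_pos h1]
      exact one_div_le_dens_good hp hn hW
    · rw [show F ℓ = _ from if_neg h1]
      exact one_sub_le_dens_good hp hW

/-- Primes `p` for which `p` and `W(p)` are both coprime to `q`. -/
def GoodPrime (W : ℤ[X]) (q p : ℕ) : Prop :=
  p.Prime ∧ ¬ p ∣ q ∧ ∀ ℓ : ℕ, ℓ.Prime → ℓ ∣ q → ¬ (ℓ : ℤ) ∣ W.eval (p : ℤ)

lemma sum_nonprime_le {Y X : ℝ} (hY : 0 < Y) (hX : 1 ≤ X) :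
    ∑ n ∈ (win Y X).filter (fun n : ℕ => ¬ n.Prime), Λ n / n ≤ 2 * √X * Real.log X / Y := by
  have h1 := (le_abs_self _).trans (Chebyshev.abs_psi_sub_theta_le_sqrt_mul_log hX)
  have h2 : Chebyshev.psi X - Chebyshev.theta X =
      ∑ n ∈ (Finset.Ioc 0 ⌊X⌋₊).filter (fun n : ℕ => ¬ n.Prime), Λ n := by
    rw [Chebyshev.psi, Chebyshev.theta, sub_eq_iff_eq_add',
      ← Finset.sum_filter_add_sum_filter_not (Finset.Ioc 0 ⌊X⌋₊) Nat.Prime]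
    congr 1
    exact Finset.sum_congr rfl fun p hp => vonMangoldt_apply_prime (Finset.mem_filter.1 hp).2
  rw [le_div_iff₀ hY, Finset.sum_mul]
  refine le_trans ?_ (h2 ▸ h1)
  refine le_trans (Finset.sum_le_sum (g := fun n : ℕ => Λ n) fun n hn => ?_)
    (Finset.sum_le_sum_of_subset_of_nonneg ?_ fun n _ _ => vonMangoldt_nonneg)
  · have h3 := (mem_win hY.le n).1 (Finset.mem_filter.1 hn).1
    rw [div_mul_eq_mul_div, div_le_iff₀ (hY.trans h3.1)]
    have : 0 ≤ Λ n := vonMangoldt_nonneg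
    have := h3.1.le
    gcongr
  · refine Finset.filter_subset_filter _ fun n hn => ?_
    have h3 := (mem_win hY.le n).1 hn
    rw [Finset.mem_Ioc]
    exact ⟨by exact_mod_cast hY.trans h3.1, Nat.le_floor h3.2⟩

lemma sum_clsSum_good_le {W : ℤ[X]} {q r : ℕ} [NeZero r] (hqr : ∀ p : ℕ, p.Prime → p ∣ q → p ∣ r)
    {Y X : ℝ} (hY : 0 < Y) (hX : 1 ≤ X) :
    ∑ a ∈ good W q r, clsSum r Λ Y X a ≤
      ∑ p ∈ (win Y X).filter (GoodPrime W q), Real.log p / p + 2 * √X * Real.log X / Y := by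
  rw [sum_units_clsSum, ← Finset.sum_filter_add_sum_filter_not _ Nat.Prime]
  refine add_le_add ?_ (le_trans (Finset.sum_le_sum_of_subset_of_nonneg ?_ fun n _ _ =>
    vonMangoldt_div_nonneg n) (sum_nonprime_le hY hX))
  · rw [Finset.sum_congr rfl fun p hp => by
      rw [vonMangoldt_apply_prime (Finset.mem_filter.1 hp).2]]
    refine Finset.sum_le_sum_of_subset_of_nonneg ?_ fun n _ _ =>
      div_nonneg (Real.log_natCast_nonneg n) (Nat.cast_nonneg n)
    intro p hp
    simp only [Finset.mem_filter] at hp ⊢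
    obtain ⟨⟨h1, a, ha, hpa⟩, hp⟩ := hp
    refine ⟨h1, hp, fun hpq => ?_, fun ℓ hℓ hℓq => ?_⟩
    · have h2 : IsUnit (p : ZMod r) := hpa ▸ a.isUnit
      rw [ZMod.isUnit_iff_coprime] at h2
      exact (hp.coprime_iff_not_dvd.1 h2) (hqr p hp hpq)
    · have h2 := mem_good.1 ha ℓ hℓ hℓq (hqr ℓ hℓ hℓq)
      rwa [← hpa, ZMod.val_natCast, dvd_eval_congr W ((Nat.mod_modEq p r).of_dvd (hqr ℓ hℓ hℓq))]
        at h2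
  · intro n hn
    simp only [Finset.mem_filter] at hn ⊢
    exact ⟨hn.1.1, hn.2⟩

lemma exists_rpow_le_exp (B s : ℝ) : ∃ T : ℝ, 1 ≤ T ∧ ∀ t, T ≤ t → B * t ^ s ≤ Real.exp (t / 2) := by
  have h := (isLittleO_rpow_exp_pos_mul_atTop s (show (0 : ℝ) < 1 / 2 by norm_num)).const_mul_left B
  have h1 := (h.bound one_pos).and (Filter.eventually_ge_atTop 1)
  obtain ⟨T, hT⟩ := Filter.eventually_atTop.1 h1
  refine ⟨max T 1, le_max_right _ _, fun t ht => ?_⟩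
  have h2 := (hT t (le_trans (le_max_left _ _) ht)).1
  rw [one_mul, Real.norm_of_nonneg (Real.exp_pos _).le] at h2
  rw [div_eq_inv_mul, ← one_div]
  exact (le_abs_self _).trans h2

/-- Good primes carry logarithmic mass at least a negligible power of `log q` in every window. -/
theorem exists_goodPrime_window (W : ℤ[X]) {η : ℝ} (hη : 0 < η) : ∃ L A c : ℝ,
    1 ≤ L ∧ 1 ≤ A ∧ 0 < c ∧ ∀ q n : ℕ, 0 < q → n.Coprime q →
      (∀ p : ℕ, p.Prime → p ∣ q → ¬ (p : ℤ) ∣ W.eval (n : ℤ)) →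
      ∀ Z : ℝ, 0 < Z → A * (1 + Real.log q) ^ 3 ≤ Real.log Z →
        c * (1 + Real.log q) ^ (-η) ≤
          ∑ p ∈ (win (Z * Real.exp (-L)) Z).filter (GoodPrime W q), Real.log p / p := by
  obtain ⟨C, c₁, hCD, hc₁, hdens⟩ := exists_dens_good_ge W hη
  set M := ∏ ℓ ∈ (Finset.range (C + 1)).filter Nat.Prime, ℓ with hM
  have hM0 : 0 < M := Finset.prod_pos fun ℓ hℓ => (Finset.mem_filter.1 hℓ).2.pos
  have : NeZero M := ⟨hM0.ne'⟩
  obtain ⟨L, hL, hmain⟩ := exists_sum_clsSum_ge M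
  have hlM : 0 ≤ Real.log M := Real.log_natCast_nonneg M
  set B := 9600 * Real.exp L * (4 + L) ^ 3 * (1 + Real.log M) ^ 3 with hB
  have hB0 : 0 < B := by positivity
  obtain ⟨T, hT1, hT⟩ := exists_rpow_le_exp (8 * Real.exp L / c₁) (1 + η)
  refine ⟨L, B + L + T, c₁ / 4, hL, by linarith, by positivity, fun q n hq hn hW Z hZ0 hZ => ?_⟩
  have hlq : 0 ≤ Real.log q := Real.log_natCast_nonneg q
  set w := 1 + Real.log q with hw
  have hw1 : 1 ≤ w := by linarith
  have hw3 : 1 ≤ w ^ 3 := one_le_pow₀ hw1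
  set r := ∏ ℓ ∈ modPrimes C q, ℓ with hr
  have hr0 : 0 < r := Finset.prod_pos fun ℓ hℓ => (prime_of_mem_modPrimes hℓ).pos
  have : NeZero r := ⟨hr0.ne'⟩
  have hrM : r = M * ∏ ℓ ∈ q.primeFactors.filter (fun ℓ => C < ℓ), ℓ :=
    Finset.prod_union (disjoint_modPrimes C q)
  have hMr : M ∣ r := ⟨_, hrM⟩
  have hrq : r ≤ M * q := by
    rw [hrM]
    refine Nat.mul_le_mul_left M (Nat.le_of_dvd hq ?_)
    exact (Finset.prod_dvd_prod_of_subset _ _ _ (Finset.filter_subset _ _)).trans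
      (Nat.prod_primeFactors_dvd q)
  have hlogr : 1 + Real.log r ≤ (1 + Real.log M) * w := by
    have h1 : Real.log r ≤ Real.log M + Real.log q := by
      rw [← Real.log_mul (by exact_mod_cast hM0.ne') (by exact_mod_cast hq.ne')]
      exact Real.log_le_log (by exact_mod_cast hr0) (by exact_mod_cast hrq)
    have := mul_nonneg hlM hlq
    rw [hw]
    linarith
  have hprime : ∀ p : ℕ, p.Prime → (p ∣ r ↔ p ∈ modPrimes C q) := by
    intro p hp
    rw [hr, hp.prime.dvd_finsetProd_iff]
    constructor
    · rintro ⟨ℓ, hℓ, h⟩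
      rwa [(Nat.prime_dvd_prime_iff_eq hp (prime_of_mem_modPrimes hℓ)).1 h]
    · exact fun h => ⟨p, h, dvd_rfl⟩
  have hqr : ∀ p : ℕ, p.Prime → p ∣ q → p ∣ r := by
    intro p hp hpq
    rw [hprime p hp, modPrimes, Finset.mem_union, Finset.mem_filter, Finset.mem_filter,
      Finset.mem_range, Nat.mem_primeFactors]
    by_cases h : C < p
    · exact Or.inr ⟨⟨hp, hpq, hq.ne'⟩, h⟩
    · exact Or.inl ⟨by omega, hp⟩
  have hsq : Squarefree r := by
    rw [hr]
    refine Finset.squarefree_prod_of_pairwise_isCoprime (fun a ha b hb hab => ?_)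
      fun a ha => (prime_of_mem_modPrimes ha).squarefree
    exact Nat.coprime_iff_isRelPrime.1 ((Nat.coprime_primes (prime_of_mem_modPrimes ha)
      (prime_of_mem_modPrimes hb)).2 hab)
  have hR := norm_setSum_good_le_card (q := q) (C := C) (n := n) hsq hMr (by
    intro ℓ hℓ hℓr hℓM
    rcases Finset.mem_union.1 ((hprime ℓ hℓ).1 hℓr) with h | h
    · exact absurd (Finset.dvd_prod_of_mem (fun ℓ : ℕ => ℓ) h) hℓM
    · rw [Finset.mem_filter] at h
      exact ⟨h.2, Nat.dvd_of_mem_primeFactors h.1⟩) hCD hW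
  set Y := Z * Real.exp (-L) with hY
  have hY0 : 0 < Y := by positivity
  have hYZ : Y * Real.exp L = Z := by rw [hY, mul_assoc, ← Real.exp_add]; simp
  have hlogY : Real.log Y = Real.log Z - L := by
    rw [hY, Real.log_mul hZ0.ne' (Real.exp_pos _).ne', Real.log_exp]
    ring
  have hthr : 960 * thr L r ≤ Real.log Y := by
    have h1 : 960 * thr L r ≤ B * w ^ 3 := by
      have h2 : (1 + Real.log r) ^ 3 ≤ ((1 + Real.log M) * w) ^ 3 := by
        have : 0 ≤ Real.log r := Real.log_natCast_nonneg r
        gcongr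
      calc 960 * thr L r = 9600 * Real.exp L * (4 + L) ^ 3 * (1 + Real.log r) ^ 3 := by
            unfold thr
            ring
        _ ≤ 9600 * Real.exp L * (4 + L) ^ 3 * ((1 + Real.log M) * w) ^ 3 := by gcongr
        _ = B * w ^ 3 := by rw [hB]; ring
    have h2 : (B + L + T) * w ^ 3 = B * w ^ 3 + L * w ^ 3 + T * w ^ 3 := by ring
    have h3 : L ≤ L * w ^ 3 := le_mul_of_one_le_right (by linarith) hw3
    have h4 : 0 ≤ T * w ^ 3 := by positivity
    linarith
  have hlogZT : T ≤ Real.log Z := by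
    have h3 : B + L + T ≤ (B + L + T) * w ^ 3 := le_mul_of_one_le_right (by linarith) hw3
    linarith
  have hZ1 : 1 ≤ Z := by
    by_contra! h
    have := Real.log_neg hZ0 h
    linarith
  have hwZ : w ≤ Real.log Z := by
    have h3 : w ≤ w ^ 3 := le_self_pow₀ hw1 (by norm_num)
    have h4 : w ^ 3 ≤ (B + L + T) * w ^ 3 := le_mul_of_one_le_left (by positivity) (by linarith)
    linarith
  have h1 := hmain r hMr (good W q r) hR Y hY0 hthr
  rw [hYZ] at h1
  have h2 := sum_clsSum_good_le (W := W) hqr hY0 hZ1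
  have h3 := hdens q n hq hn hW r hr
  set d := dens (good W q r)
  have hd0 : 0 ≤ d := dens_nonneg _
  have hw0 : 0 < w := by linarith
  have h4 : 2 * √Z * Real.log Z / Y ≤ c₁ / 4 * w ^ (-η) := by
    have h5 := hT (Real.log Z) hlogZT
    have hlZ : 0 < Real.log Z := by linarith
    have h6 : Real.exp (Real.log Z / 2) = √Z := by
      rw [Real.sqrt_eq_rpow, Real.rpow_def_of_pos hZ0]
      congr 1
      ring
    rw [h6, Real.rpow_add hlZ, Real.rpow_one] at h5
    have h7 : w ^ η ≤ Real.log Z ^ η := Real.rpow_le_rpow hw0.le hwZ hη.le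
    have hwη : 0 < w ^ η := Real.rpow_pos_of_pos hw0 η
    have hsZ : 0 < √Z := Real.sqrt_pos.2 hZ0
    have hYe : Y = √Z * √Z / Real.exp L := by
      rw [Real.mul_self_sqrt hZ0.le, hY, Real.exp_neg]
      rfl
    rw [Real.rpow_neg hw0.le, hYe, ← div_eq_mul_inv, le_div_iff₀ hwη, div_div_eq_mul_div,
      div_mul_eq_mul_div, div_le_iff₀ (by positivity)]
    have h8 : 8 * Real.exp L * (Real.log Z * w ^ η) ≤ c₁ * √Z := by
      have : 8 * Real.exp L / c₁ * (Real.log Z * w ^ η) ≤ √Z := by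
        refine le_trans ?_ h5
        gcongr
      rw [div_mul_eq_mul_div, div_le_iff₀ hc₁] at this
      linarith
    nlinarith
  have h5 : d * (1 / 2) ≤ d * (L / 2) := by gcongr
  linarith

/-- Every prime factor of `n` not dividing `q` divides `n` to at least the `k`-th power. -/
def Adm (k q n : ℕ) : Prop := ∀ p : ℕ, p.Prime → p ∣ n → ¬ p ∣ q → p ^ k ∣ n

/-- The function `n ↦ n ^ (-θ)` supported on positive `n` with `Adm k q n`. -/
def admPow (k q : ℕ) (θ : ℝ) (n : ℕ) : ℝ := if n ≠ 0 ∧ Adm k q n then (n : ℝ) ^ (-θ) else 0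

lemma admPow_nonneg (k q : ℕ) (θ : ℝ) (n : ℕ) : 0 ≤ admPow k q θ n := by
  unfold admPow
  split_ifs <;> positivity

lemma admPow_le (k q : ℕ) (θ : ℝ) (n : ℕ) : admPow k q θ n ≤ (n : ℝ) ^ (-θ) := by
  unfold admPow
  split_ifs
  · rfl
  · positivity

lemma adm_mul_iff {k q m n : ℕ} (h : Nat.Coprime m n) :
    Adm k q (m * n) ↔ Adm k q m ∧ Adm k q n := by
  constructor
  · refine fun H => ⟨fun p hp hpm hpq => ?_, fun p hp hpn hpq => ?_⟩
    · have h1 := H p hp (hpm.mul_right n) hpq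
      have : (p ^ k).Coprime n := (h.coprime_dvd_left hpm).pow_left k
      exact this.dvd_of_dvd_mul_right h1
    · have h1 := H p hp (hpn.mul_left m) hpq
      have : (p ^ k).Coprime m := (h.symm.coprime_dvd_left hpn).pow_left k
      exact this.dvd_of_dvd_mul_left h1
  · rintro ⟨h1, h2⟩ p hp hpmn hpq
    rcases (hp.dvd_mul).1 hpmn with h3 | h3
    · exact (h1 p hp h3 hpq).mul_right n
    · exact (h2 p hp h3 hpq).mul_left m

lemma admPow_one (k q : ℕ) (θ : ℝ) : admPow k q θ 1 = 1 := by
  have : Adm k q 1 := fun p hp h1 => absurd h1 hp.not_dvd_one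
  simp [admPow, this]

lemma admPow_mul {k q : ℕ} (θ : ℝ) {m n : ℕ} (h : Nat.Coprime m n) :
    admPow k q θ (m * n) = admPow k q θ m * admPow k q θ n := by
  unfold admPow
  rw [adm_mul_iff h, Nat.cast_mul, Real.mul_rpow (Nat.cast_nonneg m) (Nat.cast_nonneg n)]
  by_cases hm : m = 0
  · simp [hm]
  by_cases hn : n = 0
  · simp [hn]
  by_cases h1 : Adm k q m <;> by_cases h2 : Adm k q n <;> simp [hm, hn, h1, h2]

lemma rpow_neg_prime_le {k p : ℕ} (hk : 1 ≤ k) (hp : p.Prime) {θ : ℝ} (hθ : 1 / (2 * k : ℝ) ≤ θ)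
    (j : ℕ) : ((p ^ j : ℕ) : ℝ) ^ (-θ) ≤ ((2 : ℝ) ^ (-(1 / (2 * k : ℝ)))) ^ j := by
  have h2 : (2 : ℝ) ≤ p := by exact_mod_cast hp.two_le
  have hk' : (0 : ℝ) < k := by exact_mod_cast hk
  have h0 : (0 : ℝ) ≤ 1 / (2 * k : ℝ) := by positivity
  rw [Nat.cast_pow, ← Real.rpow_natCast, ← Real.rpow_mul (by positivity), mul_comm,
    Real.rpow_mul (by positivity), Real.rpow_natCast]
  refine pow_le_pow_left₀ (by positivity) ?_ j
  rw [Real.rpow_neg (by positivity), Real.rpow_neg (by positivity)]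
  refine inv_anti₀ (by positivity) ?_
  calc (2 : ℝ) ^ (1 / (2 * k : ℝ)) ≤ (p : ℝ) ^ (1 / (2 * k : ℝ)) :=
        Real.rpow_le_rpow (by positivity) h2 h0
    _ ≤ _ := Real.rpow_le_rpow_of_exponent_le (by linarith) hθ

lemma two_rpow_neg_lt_one {k : ℕ} (hk : 1 ≤ k) : (2 : ℝ) ^ (-(1 / (2 * k : ℝ))) < 1 := by
  have hk' : (0 : ℝ) < k := by exact_mod_cast hk
  refine Real.rpow_lt_one_of_one_lt_of_neg (by norm_num) ?_
  have : 0 < 1 / (2 * k : ℝ) := by positivity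
  linarith

lemma summable_admPow_prime {k p : ℕ} (q : ℕ) (hk : 1 ≤ k) (hp : p.Prime) {θ : ℝ}
    (hθ : 1 / (2 * k : ℝ) ≤ θ) : Summable fun j : ℕ => admPow k q θ (p ^ j) :=
  Summable.of_nonneg_of_le (fun j => admPow_nonneg k q θ _)
    (fun j => (admPow_le k q θ _).trans (rpow_neg_prime_le hk hp hθ j))
    (summable_geometric_of_lt_one (by positivity) (two_rpow_neg_lt_one hk))

lemma tsum_admPow_prime_le {k p : ℕ} (q : ℕ) (hk : 1 ≤ k) (hp : p.Prime) {θ : ℝ}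
    (hθ : 1 / (2 * k : ℝ) ≤ θ) :
    ∑' j : ℕ, admPow k q θ (p ^ j) ≤ (1 - (2 : ℝ) ^ (-(1 / (2 * k : ℝ))))⁻¹ := by
  rw [← tsum_geometric_of_lt_one (by positivity) (two_rpow_neg_lt_one hk)]
  exact (summable_admPow_prime q hk hp hθ).tsum_le_tsum
    (fun j => (admPow_le k q θ _).trans (rpow_neg_prime_le hk hp hθ j))
    (summable_geometric_of_lt_one (by positivity) (two_rpow_neg_lt_one hk))

lemma tsum_admPow_prime_le' {k p q : ℕ} (hk : 1 ≤ k) (hp : p.Prime) (hpq : ¬ p ∣ q) {θ : ℝ}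
    (hθ : 1 / (2 * k : ℝ) ≤ θ) (hθ2 : (1 - k * θ) * Real.log p ≤ 1) :
    ∑' j : ℕ, admPow k q θ (p ^ j) ≤
      1 + Real.exp 1 / p * (1 - (2 : ℝ) ^ (-(1 / (2 * k : ℝ))))⁻¹ := by
  have hp0 : (0 : ℝ) < p := by exact_mod_cast hp.pos
  have hsplit := Summable.sum_add_tsum_nat_add (f := fun j : ℕ => admPow k q θ (p ^ j)) k
    (summable_admPow_prime q hk hp hθ)
  refine hsplit.symm.le.trans ?_
  refine add_le_add ?_ ?_
  · rw [Finset.sum_eq_single_of_mem 0 (Finset.mem_range.2 hk)]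
    · rw [pow_zero, admPow_one]
    · intro j hj hj0
      rw [admPow, if_neg]
      rintro ⟨-, h⟩
      have := (Nat.pow_dvd_pow_iff_le_right hp.one_lt).1 (h p hp (dvd_pow_self p hj0) hpq)
      rw [Finset.mem_range] at hj
      omega
  · rw [← tsum_geometric_of_lt_one (by positivity) (two_rpow_neg_lt_one hk), ← tsum_mul_left]
    refine Summable.tsum_le_tsum (fun j => ?_)
      ((summable_nat_add_iff (f := fun j : ℕ => admPow k q θ (p ^ j)) k).2 (summable_admPow_prime q hk hp hθ))
      ((summable_geometric_of_lt_one (by positivity) (two_rpow_neg_lt_one hk)).mul_left _)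
    refine (admPow_le k q θ _).trans ?_
    rw [pow_add, Nat.cast_mul, Real.mul_rpow (by positivity) (by positivity), mul_comm]
    refine mul_le_mul ?_ (rpow_neg_prime_le hk hp hθ j) (by positivity) (by positivity)
    rw [Nat.cast_pow, le_div_iff₀ hp0]
    nth_rewrite 2 [← Real.rpow_one (p : ℝ)]
    rw [← Real.rpow_natCast, ← Real.rpow_mul hp0.le, ← Real.rpow_add hp0,
      Real.rpow_def_of_pos hp0]
    refine Real.exp_le_exp.2 ?_
    linarith

/-- Rankin-type bound for smooth numbers satisfying `Adm`. -/
theorem exists_sum_smooth_le {k : ℕ} (hk : 1 ≤ k) : ∃ C : ℝ, 0 < C ∧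
    ∀ (q : ℕ), 0 < q → ∀ (θ w : ℝ), 1 / (2 * k : ℝ) ≤ θ → θ ≤ 1 / (k : ℝ) →
    (1 - k * θ) * Real.log w ≤ 1 → ∀ S : Finset ℕ,
    (∀ n ∈ S, 0 < n ∧ Adm k q n ∧ ∀ p : ℕ, p.Prime → p ∣ n → (p : ℝ) ≤ w) →
    ∑ n ∈ S, (n : ℝ) ^ (-θ) ≤
      Real.exp (C * (∑ p ∈ (Finset.Ioc 0 ⌊w⌋₊).filter Nat.Prime, 1 / (p : ℝ) + Real.log q)) := by
  have hk' : (0 : ℝ) < k := by exact_mod_cast hk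
  set b : ℝ := (1 - (2 : ℝ) ^ (-(1 / (2 * k : ℝ))))⁻¹ with hb
  have hr := two_rpow_neg_lt_one hk
  have hr0 : 0 < (2 : ℝ) ^ (-(1 / (2 * k : ℝ))) := by positivity
  have hb1 : 1 ≤ b := (one_le_inv₀ (by linarith)).2 (by linarith)
  have hlb : 0 ≤ Real.log b := Real.log_nonneg hb1
  have hl2 : 0 < Real.log 2 := Real.log_pos (by norm_num)
  refine ⟨Real.exp 1 * b + Real.log b / Real.log 2, by positivity, ?_⟩
  intro q hq θ w hθ hθk hw S hS
  set s : Finset ℕ := (Finset.Ioc 0 ⌊w⌋₊).filter Nat.Prime with hs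
  obtain ⟨hsum, hE⟩ := EulerProduct.summable_and_hasSum_factoredNumbers_prod_filter_prime_tsum
    (f := admPow k q θ) (admPow_one k q θ) (fun {m n} h => admPow_mul θ h)
    (fun {p} hp => by
      refine (summable_admPow_prime q hk hp hθ).congr fun j => ?_
      rw [Real.norm_of_nonneg (admPow_nonneg k q θ _)]) s
  have hmem : ∀ n ∈ S, n ∈ Nat.factoredNumbers s := by
    intro n hn
    obtain ⟨h0, -, h2⟩ := hS n hn
    rw [Nat.mem_factoredNumbers']
    intro p hp hpn
    rw [hs, Finset.mem_filter, Finset.mem_Ioc]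
    exact ⟨⟨hp.pos, Nat.le_floor (h2 p hp hpn)⟩, hp⟩
  have hstep : ∑ n ∈ S, (n : ℝ) ^ (-θ) ≤ ∏ p ∈ s with p.Prime, ∑' j : ℕ, admPow k q θ (p ^ j) := by
    rw [← hE.tsum_eq, ← Finset.sum_attach]
    let e : {n // n ∈ S} → Nat.factoredNumbers s := fun n => ⟨n.1, hmem n.1 n.2⟩
    have he : Function.Injective e := fun a b h => Subtype.ext (by simpa [e] using h)
    calc ∑ n ∈ S.attach, (n.1 : ℝ) ^ (-θ) = ∑ n ∈ S.attach, admPow k q θ (e n).1 := by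
          refine Finset.sum_congr rfl fun n _ => ?_
          obtain ⟨h0, h1, -⟩ := hS n.1 n.2
          rw [admPow, if_pos ⟨h0.ne', h1⟩]
      _ = ∑ m ∈ S.attach.map ⟨e, he⟩, admPow k q θ m.1 := by rw [Finset.sum_map]; rfl
      _ ≤ _ := hE.summable.sum_le_tsum _ fun m _ => admPow_nonneg k q θ m
  refine hstep.trans ?_
  have hfac : ∀ p ∈ s.filter Nat.Prime, ∑' j : ℕ, admPow k q θ (p ^ j) ≤
      Real.exp (Real.exp 1 * b * (1 / (p : ℝ)) + if p ∣ q then Real.log b else 0) := by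
    intro p hps
    have hps' := hps
    rw [Finset.mem_filter, hs, Finset.mem_filter, Finset.mem_Ioc] at hps'
    obtain ⟨⟨⟨hp0, hpw⟩, hp⟩, -⟩ := hps'
    have hp0' : (0 : ℝ) < p := by exact_mod_cast hp0
    by_cases hpq : p ∣ q
    · rw [if_pos hpq, Real.exp_add, Real.exp_log (by linarith)]
      refine (tsum_admPow_prime_le q hk hp hθ).trans ?_
      rw [← hb]
      have : 1 ≤ Real.exp (Real.exp 1 * b * (1 / (p : ℝ))) := Real.one_le_exp (by positivity)
      nlinarith
    · rw [if_neg hpq, add_zero]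
      have hw2 : (p : ℝ) ≤ w := (Nat.le_floor_iff' hp0.ne').1 hpw
      have h1 : (1 - k * θ) * Real.log p ≤ 1 := by
        refine le_trans (mul_le_mul_of_nonneg_left (Real.log_le_log hp0' hw2) ?_) hw
        have := mul_le_mul_of_nonneg_left hθk hk'.le
        rw [mul_one_div_cancel hk'.ne'] at this
        linarith
      refine (tsum_admPow_prime_le' hk hp hpq hθ h1).trans ?_
      rw [← hb]
      have := Real.add_one_le_exp (Real.exp 1 * b * (1 / (p : ℝ)))
      calc _ = Real.exp 1 * b * (1 / (p : ℝ)) + 1 := by ring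
        _ ≤ _ := this
  refine (Finset.prod_le_prod (fun p _ => tsum_nonneg fun j => admPow_nonneg k q θ _) hfac).trans ?_
  rw [← Real.exp_sum]
  refine Real.exp_le_exp.2 ?_
  rw [Finset.sum_add_distrib, ← Finset.mul_sum]
  have hss : s.filter Nat.Prime = s := by
    rw [hs, Finset.filter_filter]
    simp
  rw [hss]
  have h2 : ∑ p ∈ s, (if p ∣ q then Real.log b else 0) ≤ Real.log b / Real.log 2 * Real.log q := by
    rw [← Finset.sum_filter]
    calc ∑ p ∈ s.filter (· ∣ q), Real.log b
        ≤ ∑ p ∈ s.filter (· ∣ q), Real.log b / Real.log 2 * Real.log p := by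
          refine Finset.sum_le_sum fun p hp => ?_
          rw [Finset.mem_filter, hs, Finset.mem_filter] at hp
          rw [div_mul_eq_mul_div, le_div_iff₀ hl2]
          refine mul_le_mul_of_nonneg_left (Real.log_le_log (by norm_num) ?_) hlb
          exact_mod_cast hp.1.2.two_le
      _ ≤ ∑ p ∈ q.primeFactors, Real.log b / Real.log 2 * Real.log p := by
          refine Finset.sum_le_sum_of_subset_of_nonneg ?_ fun p _ _ =>
            mul_nonneg (by positivity) (Real.log_natCast_nonneg p)
          intro p hp
          rw [Finset.mem_filter, hs, Finset.mem_filter] at hp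
          exact Nat.mem_primeFactors.2 ⟨hp.1.2, hp.2, hq.ne'⟩
      _ ≤ _ := by
          rw [← Finset.mul_sum]
          exact mul_le_mul_of_nonneg_left (sum_log_primeFactors_le hq) (by positivity)
  have h3 : 0 ≤ ∑ p ∈ s, 1 / (p : ℝ) := Finset.sum_nonneg fun p _ => by positivity
  have h4 : 0 ≤ Real.log q := Real.log_natCast_nonneg q
  have h5 : 0 ≤ Real.log b / Real.log 2 * ∑ p ∈ s, 1 / (p : ℝ) := by positivity
  have h6 : 0 ≤ Real.exp 1 * b * Real.log q := by positivity
  nlinarith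

lemma inv_prime_sum_window_le (i : ℕ) :
    ∑ p ∈ win (Real.exp (i * 1)) (Real.exp (i * 1 + 1)), (if p.Prime then 1 / (p : ℝ) else 0) ≤
      18 * (1 / ((i + 1 : ℕ) : ℝ)) := by
  have h0 := mertens_win_le (Real.exp_pos ((i : ℝ) * 1)) (Real.exp_le_exp.2 (by linarith) :
    Real.exp ((i : ℝ) * 1) ≤ Real.exp (i * 1 + 1))
  rw [← Real.exp_sub, Real.log_exp] at h0
  have hi : (0 : ℝ) ≤ i := Nat.cast_nonneg i
  have h1 : ∀ p ∈ win (Real.exp (i * 1)) (Real.exp (i * 1 + 1)),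
      (if p.Prime then 1 / (p : ℝ) else 0) ≤ 2 / ((i + 1 : ℕ) : ℝ) * (Λ p / p) := by
    intro p hp
    split_ifs with hpp
    · have hp0 : (0 : ℝ) < p := by exact_mod_cast hpp.pos
      rw [vonMangoldt_apply_prime hpp]
      have h2 : ((i + 1 : ℕ) : ℝ) / 2 ≤ Real.log p := by
        rcases Nat.eq_zero_or_pos i with rfl | hi0
        · have h3 : Real.log 2 ≤ Real.log p :=
            Real.log_le_log (by norm_num) (by exact_mod_cast hpp.two_le)
          have := Real.log_two_gt_d9
          norm_num
          linarith
        · have h3 := ((mem_win (Real.exp_pos _).le p).1 hp).1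
          have h4 : (i : ℝ) * 1 < Real.log p := (Real.lt_log_iff_exp_lt hp0).2 h3
          have h5 : (1 : ℝ) ≤ i := by exact_mod_cast hi0
          push_cast
          linarith
      have h3 : 1 ≤ 2 / ((i + 1 : ℕ) : ℝ) * Real.log p := by
        have : (0 : ℝ) < ((i + 1 : ℕ) : ℝ) := by positivity
        rw [div_mul_eq_mul_div, le_div_iff₀ this]
        linarith
      calc 1 / (p : ℝ) ≤ (2 / ((i + 1 : ℕ) : ℝ) * Real.log p) / p := by gcongr
        _ = _ := by ring
    · exact mul_nonneg (by positivity) (vonMangoldt_div_nonneg p)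
  refine (Finset.sum_le_sum h1).trans ?_
  rw [← Finset.mul_sum]
  have : 0 < 2 / ((i + 1 : ℕ) : ℝ) := by positivity
  calc 2 / ((i + 1 : ℕ) : ℝ) * ∑ p ∈ win (Real.exp (i * 1)) (Real.exp (i * 1 + 1)), Λ p / p
      ≤ 2 / ((i + 1 : ℕ) : ℝ) * 9 := by gcongr; linarith
    _ = _ := by ring

theorem sum_inv_prime_le {x : ℝ} (hx : 1 ≤ x) :
    ∑ p ∈ (Finset.Ioc 0 ⌊x⌋₊).filter Nat.Prime, 1 / (p : ℝ) ≤
      18 * (1 + Real.log (1 + Real.log x)) := by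
  have hlx := Real.log_nonneg hx
  rcases hx.eq_or_lt with rfl | hx1
  · simp only [Nat.floor_one, Real.log_one, add_zero]
    rw [Finset.sum_eq_zero]
    · norm_num
    · intro p hp
      simp only [Finset.mem_filter, Finset.mem_Ioc] at hp
      have := hp.2.two_le
      omega
  have hlx' := Real.log_pos hx1
  set N := ⌈Real.log x⌉₊ with hN
  have hN1 : 1 ≤ N := Nat.one_le_ceil_iff.2 hlx'
  have hNle : (N : ℝ) ≤ 1 + Real.log x := by
    have := (Nat.ceil_lt_add_one hlx).le
    linarith
  have hN0 : (0 : ℝ) < N := by exact_mod_cast hN1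
  have h1 : ∑ p ∈ (Finset.Ioc 0 ⌊x⌋₊).filter Nat.Prime, 1 / (p : ℝ) ≤
      ∑ p ∈ win (Real.exp ((0 : ℕ) * 1)) (Real.exp (N * 1)),
        (if p.Prime then 1 / (p : ℝ) else 0) := by
    rw [← Finset.sum_filter]
    refine Finset.sum_le_sum_of_subset_of_nonneg ?_ fun p _ _ => by positivity
    intro p hp
    rw [Finset.mem_filter, Finset.mem_Ioc] at hp
    rw [Finset.mem_filter, mem_win (Real.exp_pos _).le]
    refine ⟨⟨?_, ?_⟩, hp.2⟩
    · have := hp.2.one_lt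
      simp only [Nat.cast_zero, zero_mul, Real.exp_zero]
      exact_mod_cast this
    · have h2 : (p : ℝ) ≤ x := (Nat.le_floor_iff' hp.1.1.ne').1 hp.1.2
      refine h2.trans ?_
      rw [← Real.log_le_iff_le_exp (by linarith), mul_one]
      exact Nat.le_ceil _
  refine h1.trans ?_
  rw [← sum_win_blocks (by norm_num) 0 N (Nat.zero_le N)]
  refine (Finset.sum_le_sum fun i _ => inv_prime_sum_window_le i).trans ?_
  rw [← Finset.mul_sum]
  refine mul_le_mul_of_nonneg_left ?_ (by norm_num)
  have h2 := sum_inv_Ioc_le N hN1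
  have h3 : ∑ i ∈ Finset.Ico 0 N, 1 / ((i + 1 : ℕ) : ℝ) = ∑ m ∈ Finset.Ioc 0 N, 1 / (m : ℝ) := by
    rw [← Finset.range_eq_Ico, Finset.range_eq_Ico, Finset.sum_Ico_add' (fun m : ℕ => 1 / (m : ℝ)) 0 N 1]
    refine Finset.sum_congr ?_ fun _ _ => rfl
    ext m
    simp only [Finset.mem_Ico, Finset.mem_Ioc]
    omega
  rw [h3]
  refine h2.trans ?_
  have := Real.log_le_log hN0 hNle
  linarith

lemma log_div_le_sum_inv {a b : ℕ} (hab : a ≤ b) :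
    Real.log ((b + 1 : ℝ) / (a + 1)) ≤ ∑ i ∈ Finset.Ico a b, 1 / ((i : ℝ) + 1) := by
  induction b, hab using Nat.le_induction with
  | base => simp [div_self (by positivity : (a : ℝ) + 1 ≠ 0)]
  | succ b hab ih =>
    rw [Finset.sum_Ico_succ_top hab]
    have hb : (0 : ℝ) < b + 1 := by positivity
    have ha : (0 : ℝ) < a + 1 := by positivity
    have h1 : Real.log ((b + 2 : ℝ) / (b + 1)) ≤ (b + 2 : ℝ) / (b + 1) - 1 :=
      Real.log_le_sub_one_of_pos (by positivity)
    have h2 : (b + 2 : ℝ) / (b + 1) - 1 = 1 / ((b : ℝ) + 1) := by field_simp; ring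
    rw [Real.log_div (by positivity) (by positivity)] at h1 ih ⊢
    push_cast
    rw [show (b : ℝ) + 1 + 1 = b + 2 by ring]
    linarith

/-- The mass of good primes in `(exp u, exp (u * ρ)]`. -/
theorem exists_goodPrime_mass (W : ℤ[X]) {η : ℝ} (hη : 0 < η) : ∃ A c : ℝ, 1 ≤ A ∧ 0 < c ∧
    ∀ q n : ℕ, 0 < q → n.Coprime q →
    (∀ p : ℕ, p.Prime → p ∣ q → ¬ (p : ℤ) ∣ W.eval (n : ℤ)) → ∀ u ρ : ℝ,
    A * (1 + Real.log q) ^ 3 ≤ u → 9 ≤ ρ →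
    c * (1 + Real.log q) ^ (-η) * Real.log ρ ≤
      ∑ p ∈ (win (Real.exp u) (Real.exp (u * ρ))).filter (GoodPrime W q), 1 / (p : ℝ) := by
  obtain ⟨L, A, c, hL, hA, hc, H⟩ := exists_goodPrime_window W hη
  refine ⟨A + L, c / (2 * L), by linarith, by positivity, ?_⟩
  intro q n hq hn hW u ρ hu hρ
  have hlq : 0 ≤ Real.log q := Real.log_natCast_nonneg q
  set w := 1 + Real.log q with hw
  have hw1 : 1 ≤ w := by linarith
  have hw3 : 1 ≤ w ^ 3 := one_le_pow₀ hw1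
  have huA : A * w ^ 3 ≤ u := by nlinarith
  have huL : L ≤ u := by nlinarith
  have hL0 : 0 < L := by linarith
  have hu0 : 0 < u := by linarith
  have huρ : u ≤ u * ρ := by nlinarith
  set a := ⌈u / L⌉₊ with ha
  set b := ⌊u * ρ / L⌋₊ with hb
  have hau : u / L ≤ a := Nat.le_ceil _
  have hau' : (a : ℝ) < u / L + 1 := Nat.ceil_lt_add_one (by positivity)
  have hbu : (b : ℝ) ≤ u * ρ / L := Nat.floor_le (by positivity)
  have hbu' : u * ρ / L < b + 1 := Nat.lt_floor_add_one _
  have huL1 : 1 ≤ u / L := (one_le_div hL0).2 huL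
  have hab : a ≤ b := by
    have : (a : ℝ) < b + 1 := by
      have h2 : u * ρ / L = u / L * ρ := by ring
      rw [h2] at hbu'
      nlinarith
    have : (a : ℝ) < ((b + 1 : ℕ) : ℝ) := by exact_mod_cast this
    have := Nat.cast_lt.1 this
    omega
  have hsub : win (Real.exp (a * L)) (Real.exp (b * L)) ⊆ win (Real.exp u) (Real.exp (u * ρ)) := by
    refine win_subset_win (Real.exp_le_exp.2 ?_) (Real.exp_le_exp.2 ?_)
    · rwa [div_le_iff₀ hL0] at hau
    · rwa [le_div_iff₀ hL0] at hbu
  have h1 : ∑ i ∈ Finset.Ico a b, ∑ p ∈ win (Real.exp (i * L)) (Real.exp (i * L + L)),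
      (if GoodPrime W q p then 1 / (p : ℝ) else 0) ≤
      ∑ p ∈ (win (Real.exp u) (Real.exp (u * ρ))).filter (GoodPrime W q), 1 / (p : ℝ) := by
    rw [sum_win_blocks hL0.le a b hab, ← Finset.sum_filter]
    exact Finset.sum_le_sum_of_subset_of_nonneg (Finset.filter_subset_filter _ hsub)
      fun p _ _ => by positivity
  refine le_trans ?_ h1
  have h2 : ∀ i ∈ Finset.Ico a b, c * w ^ (-η) / L * (1 / ((i : ℝ) + 1)) ≤
      ∑ p ∈ win (Real.exp (i * L)) (Real.exp (i * L + L)),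
      (if GoodPrime W q p then 1 / (p : ℝ) else 0) := by
    intro i hi
    rw [Finset.mem_Ico] at hi
    have hai : (a : ℝ) ≤ i := by exact_mod_cast hi.1
    have hiL : u ≤ i * L := by
      rw [div_le_iff₀ hL0] at hau
      nlinarith
    have h3 := H q n hq hn hW (Real.exp (i * L + L)) (Real.exp_pos _) (by
      rw [Real.log_exp]; linarith)
    rw [← Real.exp_add, add_neg_cancel_right] at h3
    have hi0 : (0 : ℝ) < i + 1 := by positivity
    rw [← Finset.sum_filter]
    calc c * w ^ (-η) / L * (1 / ((i : ℝ) + 1)) = c * w ^ (-η) * (1 / (i * L + L)) := by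
          field_simp
      _ ≤ (∑ p ∈ (win (Real.exp (i * L)) (Real.exp (i * L + L))).filter (GoodPrime W q),
          Real.log p / p) * (1 / (i * L + L)) := by gcongr
      _ ≤ _ := by
          rw [Finset.sum_mul]
          refine Finset.sum_le_sum fun p hp => ?_
          rw [Finset.mem_filter, mem_win (Real.exp_pos _).le] at hp
          have hp0 : (0 : ℝ) < p := by exact_mod_cast hp.2.1.pos
          have h4 : Real.log p ≤ i * L + L := (Real.log_le_iff_le_exp hp0).2 hp.1.2
          have h5 : 0 < i * L + L := by positivity
          calc Real.log p / p * (1 / (i * L + L)) ≤ (i * L + L) / p * (1 / (i * L + L)) := by gcongr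
            _ = _ := by field_simp
  refine le_trans ?_ (Finset.sum_le_sum h2)
  rw [← Finset.mul_sum]
  have h6 : Real.log ρ / 2 ≤ ∑ i ∈ Finset.Ico a b, 1 / ((i : ℝ) + 1) := by
    refine le_trans ?_ (log_div_le_sum_inv hab)
    have h7 : ρ / 3 ≤ (b + 1 : ℝ) / (a + 1) := by
      have ha0 : (0 : ℝ) < a + 1 := by positivity
      rw [le_div_iff₀ ha0]
      have h2 : u * ρ / L = u / L * ρ := by ring
      rw [h2] at hbu'
      nlinarith
    refine le_trans ?_ (Real.log_le_log (by linarith) h7)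
    rw [Real.log_div (by linarith) (by norm_num)]
    have h9 : Real.log 9 = 2 * Real.log 3 := by
      rw [show (9 : ℝ) = 3 ^ 2 by norm_num, Real.log_pow]; norm_num
    have := Real.log_le_log (by norm_num) hρ
    linarith
  calc c / (2 * L) * w ^ (-η) * Real.log ρ = c * w ^ (-η) / L * (Real.log ρ / 2) := by
        field_simp
    _ ≤ _ := by gcongr

lemma good_prod_pow {Gd : ℕ → Prop} (h1 : Gd 1)
    (hmul : ∀ m n : ℕ, m.Coprime n → Gd m → Gd n → Gd (m * n)) {k : ℕ} {ι : Type*} (s : Finset ι)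
    (f : ι → ℕ) (hf : ∀ i ∈ s, (f i).Prime ∧ Gd (f i ^ k))
    (hinj : ∀ i ∈ s, ∀ j ∈ s, i ≠ j → f i ≠ f j) : Gd (∏ i ∈ s, f i ^ k) := by
  induction s using Finset.induction_on with
  | empty => simpa using h1
  | insert a s ha ih =>
    rw [Finset.prod_insert ha]
    refine hmul _ _ (Nat.Coprime.prod_right fun i hi => ?_) (hf a (Finset.mem_insert_self a s)).2
      (ih (fun i hi => hf i (Finset.mem_insert_of_mem hi)) fun i hi j hj =>
        hinj i (Finset.mem_insert_of_mem hi) j (Finset.mem_insert_of_mem hj))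
    refine Nat.Coprime.pow k k ((Nat.coprime_primes (hf a (Finset.mem_insert_self a s)).1
      (hf i (Finset.mem_insert_of_mem hi)).1).2 (hinj a (Finset.mem_insert_self a s) i
        (Finset.mem_insert_of_mem hi) ?_))
    rintro rfl
    exact ha hi

lemma card_window_ge {G : ℕ → Prop} {Z L c x : ℝ} (hZ : 1 < Z) (hZx : Z ≤ x)
    (h : c ≤ ∑ p ∈ (win (Z * Real.exp (-L)) Z).filter G, Real.log p / p) :
    c * Real.exp (-L) / Real.log x * Z ≤ (((win (Z * Real.exp (-L)) Z).filter G).card : ℝ) := by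
  have hlx : 0 < Real.log x := Real.log_pos (by linarith)
  have hZe : 0 < Z * Real.exp (-L) := by positivity
  have h2 : ∑ p ∈ (win (Z * Real.exp (-L)) Z).filter G, Real.log p / p ≤
      (((win (Z * Real.exp (-L)) Z).filter G).card : ℝ) * (Real.log x / (Z * Real.exp (-L))) := by
    rw [← nsmul_eq_mul]
    refine Finset.sum_le_card_nsmul _ _ _ fun p hp => ?_
    rw [Finset.mem_filter, mem_win hZe.le] at hp
    have hp0 : (0 : ℝ) < p := hZe.trans hp.1.1
    have := Real.log_le_log hp0 (hp.1.2.trans hZx)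
    have := hp.1.1.le
    gcongr
  have h3 := h.trans h2
  rw [mul_div_assoc', le_div_iff₀ hZe] at h3
  rw [div_mul_eq_mul_div, div_le_iff₀ hlx]
  linarith

/-- Lower bound for the number of `n ≤ x` with `Gd n`, obtained from the products of a `y`-smooth
number, the `k`-th powers of one prime from each of several disjoint groups, and the `k`-th power
of a large prime. -/
theorem card_good_ge {k : ℕ} (hk : 1 ≤ k) {Gd : ℕ → Prop} (h1 : Gd 1)
    (hmul : ∀ m n : ℕ, m.Coprime n → Gd m → Gd n → Gd (m * n)) {G : ℕ → Prop}
    (hG : ∀ p, G p → p.Prime ∧ Gd (p ^ k)) {x y v L c M : ℝ} {r : ℕ} (S : Fin r → Finset ℕ)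
    (hS : ∀ i, ∀ p ∈ S i, G p ∧ y < (p : ℝ) ∧ (p : ℝ) ≤ v)
    (hdisj : ∀ i j, i ≠ j → Disjoint (S i) (S j)) (Ms : Finset ℕ)
    (hMs : ∀ m ∈ Ms, 0 < m ∧ (m : ℝ) ≤ M ∧ Gd m ∧ ∀ p : ℕ, p.Prime → p ∣ m → (p : ℝ) ≤ y)
    (hx : 1 < x) (hv : 1 ≤ v) (hyv : y ≤ v) (hL : 0 < L) (hM : 0 < M)
    (hwin : ∀ Z, (x / M) ^ (1 / (k : ℝ)) / v ^ r ≤ Z →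
      c ≤ ∑ p ∈ (win (Z * Real.exp (-L)) Z).filter G, Real.log p / p)
    (hbig : v * Real.exp L ≤ (x / M) ^ (1 / (k : ℝ)) / v ^ r) :
    c * Real.exp (-L) / Real.log x * x ^ (1 / (k : ℝ)) * (∑ m ∈ Ms, (m : ℝ) ^ (-(1 / (k : ℝ)))) *
      ∏ i, ∑ p ∈ S i, 1 / (p : ℝ) ≤ (((Finset.Ioc 0 ⌊x⌋₊).filter Gd).card : ℝ) := by
  have hx0 : 0 < x := by linarith
  have hk' : (0 : ℝ) < k := by exact_mod_cast hk
  have hk0 : k ≠ 0 := by omega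
  let Z : ℕ → (Fin r → ℕ) → ℝ := fun m g => (x / m) ^ (1 / (k : ℝ)) / ((∏ i, g i : ℕ) : ℝ)
  let w : ℕ → (Fin r → ℕ) → Finset ℕ := fun m g =>
    (win (Z m g * Real.exp (-L)) (Z m g)).filter G
  have hmemS : ∀ g ∈ Fintype.piFinset S, ∀ i, g i ∈ S i := fun g hg i =>
    (Fintype.mem_piFinset.1 hg) i
  have hgpos : ∀ g ∈ Fintype.piFinset S, 0 < ∏ i, g i := fun g hg =>
    Finset.prod_pos fun i _ => (hG _ (hS i _ (hmemS g hg i)).1).1.pos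
  have hgle : ∀ g ∈ Fintype.piFinset S, ((∏ i, g i : ℕ) : ℝ) ≤ v ^ r := by
    intro g hg
    rw [Nat.cast_prod]
    refine (Finset.prod_le_prod (fun i _ => Nat.cast_nonneg _)
      fun i _ => (hS i _ (hmemS g hg i)).2.2).trans ?_
    simp
  have hvr : 0 < v ^ r := by positivity
  have hZmin : ∀ m ∈ Ms, ∀ g ∈ Fintype.piFinset S,
      (x / M) ^ (1 / (k : ℝ)) / v ^ r ≤ Z m g := by
    intro m hm g hg
    have hm0 : (0 : ℝ) < m := by exact_mod_cast (hMs m hm).1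
    have h2 : (0 : ℝ) < ((∏ i, g i : ℕ) : ℝ) := by exact_mod_cast hgpos g hg
    have h3 := (hMs m hm).2.1
    have h4 := hgle g hg
    simp only [Z]
    gcongr
  have hZv : ∀ m ∈ Ms, ∀ g ∈ Fintype.piFinset S, v * Real.exp L ≤ Z m g := fun m hm g hg =>
    hbig.trans (hZmin m hm g hg)
  have hw : ∀ m ∈ Ms, ∀ g ∈ Fintype.piFinset S, ∀ p ∈ w m g,
      G p ∧ v < (p : ℝ) ∧ (p : ℝ) ≤ Z m g := by
    intro m hm g hg p hp
    have h2 := hZv m hm g hg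
    have h3 : v ≤ Z m g * Real.exp (-L) := by
      rw [Real.exp_neg, ← div_eq_mul_inv, le_div_iff₀ (Real.exp_pos L)]
      exact h2
    rw [Finset.mem_filter, mem_win (by linarith)] at hp
    exact ⟨hp.2, by linarith [hp.1.1], hp.1.2⟩
  have hcard : ∀ m ∈ Ms, ∀ g ∈ Fintype.piFinset S,
      c * Real.exp (-L) / Real.log x * Z m g ≤ ((w m g).card : ℝ) := by
    intro m hm g hg
    refine card_window_ge ?_ ?_ (hwin _ (hZmin m hm g hg))
    · refine lt_of_lt_of_le ?_ (hZv m hm g hg)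
      have := Real.one_lt_exp_iff.2 hL
      nlinarith
    · have hm1 : (1 : ℝ) ≤ m := by exact_mod_cast (hMs m hm).1
      have hg1 : (1 : ℝ) ≤ ((∏ i, g i : ℕ) : ℝ) := by exact_mod_cast hgpos g hg
      have hk1 : (1 : ℝ) ≤ k := by exact_mod_cast hk
      calc Z m g ≤ (x / m) ^ (1 / (k : ℝ)) := div_le_self (by positivity) hg1
        _ ≤ x ^ (1 / (k : ℝ)) := by
            refine Real.rpow_le_rpow (by positivity) (div_le_self hx0.le hm1) (by positivity)
        _ ≤ x ^ (1 : ℝ) := Real.rpow_le_rpow_of_exponent_le hx.le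
            ((div_le_one hk').2 hk1)
        _ = x := Real.rpow_one x
  let A : Finset (Σ _ : ℕ, Σ _ : Fin r → ℕ, ℕ) :=
    Ms.sigma fun m => (Fintype.piFinset S).sigma fun g => w m g
  have hA : (A.card : ℝ) = ∑ m ∈ Ms, ∑ g ∈ Fintype.piFinset S, ((w m g).card : ℝ) := by
    simp only [A, Finset.card_sigma]
    push_cast
    rfl
  have hAle : A.card ≤ ((Finset.Ioc 0 ⌊x⌋₊).filter Gd).card := by
    refine Finset.card_le_card_of_injOn (fun a => a.1 * ((∏ i, a.2.1 i) * a.2.2) ^ k) ?_ ?_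
    · rintro ⟨m, g, p⟩ ha
      simp only [A, Finset.coe_sigma] at ha
      obtain ⟨hm, hg, hp⟩ := ha
      have hp' := hw m hm g hg p hp
      have hpp := hG p hp'.1
      obtain ⟨hm0, hmM, hmG, hmy⟩ := hMs m hm
      have hm0' : (0 : ℝ) < m := by exact_mod_cast hm0
      have hg0 : (0 : ℝ) < ((∏ i, g i : ℕ) : ℝ) := by exact_mod_cast hgpos g hg
      simp only [Finset.mem_coe, Finset.mem_filter, Finset.mem_Ioc]
      refine ⟨⟨Nat.mul_pos hm0 (pow_pos (Nat.mul_pos (hgpos g hg) hpp.1.pos) k), ?_⟩, ?_⟩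
      · refine Nat.le_floor ?_
        push_cast
        rw [← Nat.cast_prod]
        have h2 : ((∏ i, g i : ℕ) : ℝ) * p ≤ (x / m) ^ (1 / (k : ℝ)) := by
          have := hp'.2.2
          simp only [Z] at this
          rw [le_div_iff₀ hg0] at this
          linarith
        calc (m : ℝ) * (((∏ i, g i : ℕ) : ℝ) * p) ^ k ≤ m * ((x / m) ^ (1 / (k : ℝ))) ^ k := by
              gcongr
          _ = x := by
              rw [one_div, Real.rpow_inv_natCast_pow (by positivity) hk0]
              field_simp
      · have hgprime : ∀ i, (g i).Prime := fun i => (hG _ (hS i _ (hmemS g hg i)).1).1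
        have hgi : ∀ i, (g i : ℝ) < p := fun i =>
          ((hS i _ (hmemS g hg i)).2.2).trans_lt hp'.2.1
        rw [mul_pow, ← Finset.prod_pow]
        have hcop : ∀ u : ℕ, u.Prime → y < (u : ℝ) → m.Coprime u := by
          intro u hu huy
          refine (Nat.Coprime.symm ?_)
          rw [hu.coprime_iff_not_dvd]
          intro h
          linarith [hmy u hu h]
        refine hmul _ _ ?_ hmG (hmul _ _ ?_ ?_ hpp.2)
        · refine Nat.Coprime.mul_right (Nat.Coprime.prod_right fun i _ => ?_) ?_
          · exact (hcop _ (hgprime i) (hS i _ (hmemS g hg i)).2.1).pow_right k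
          · exact (hcop p hpp.1 (by linarith [hp'.2.1])).pow_right k
        · refine Nat.Coprime.prod_left fun i _ => ?_
          refine Nat.Coprime.pow k k ((Nat.coprime_primes (hgprime i) hpp.1).2 ?_)
          intro h
          have := hgi i
          rw [h] at this
          exact lt_irrefl _ this
        · refine good_prod_pow h1 hmul _ _ (fun i _ => hG _ (hS i _ (hmemS g hg i)).1) ?_
          intro i _ j _ hij h
          exact Finset.disjoint_left.1 (hdisj i j hij) (hmemS g hg i) (h ▸ hmemS g hg j)
    · rintro ⟨m, g, p⟩ ha ⟨m', g', p'⟩ ha' heq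
      simp only [A, Finset.coe_sigma] at ha ha'
      obtain ⟨hm, hg, hp⟩ := ha
      obtain ⟨hm', hg', hp'⟩ := ha'
      have hp1 := hw m hm g hg p hp
      have hp1' := hw m' hm' g' hg' p' hp'
      have hpp := (hG p hp1.1).1
      have hpp' := (hG p' hp1'.1).1
      simp only at heq
      have hdiv : ∀ u : ℕ, u.Prime → y < (u : ℝ) → u ∣ m' * ((∏ i, g' i) * p') ^ k →
          (∃ i, u = g' i) ∨ u = p' := by
        intro u hu huy hud
        rcases (hu.dvd_mul).1 hud with h | h
        · linarith [(hMs m' hm').2.2.2 u hu h]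
        · rcases (hu.dvd_mul).1 (hu.dvd_of_dvd_pow h) with h | h
          · left
            obtain ⟨i, -, hi⟩ := (hu.prime.dvd_finsetProd_iff _).1 h
            exact ⟨i, (Nat.prime_dvd_prime_iff_eq hu (hG _ (hS i _ (hmemS g' hg' i)).1).1).1 hi⟩
          · right
            exact (Nat.prime_dvd_prime_iff_eq hu hpp').1 h
      have hpe : p = p' := by
        rcases hdiv p hpp (by linarith [hp1.2.1]) (heq ▸ Dvd.dvd.mul_left
          (dvd_pow (Dvd.intro_left _ rfl) hk0) _) with ⟨i, hi⟩ | h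
        · have h2 := (hS i _ (hmemS g' hg' i)).2.2
          rw [← hi] at h2
          linarith [hp1.2.1]
        · exact h
      have hge : g = g' := by
        funext i
        have hgi := hS i _ (hmemS g hg i)
        rcases hdiv (g i) (hG _ hgi.1).1 hgi.2.1 (heq ▸ Dvd.dvd.mul_left
          (dvd_pow (Dvd.dvd.mul_right (Finset.dvd_prod_of_mem g (Finset.mem_univ i)) _) hk0) _)
          with ⟨j, hj⟩ | h
        · by_cases hij : i = j
          · rw [hij, ← hij, hj, hij]
          · exact absurd (hj ▸ hmemS g' hg' j) (Finset.disjoint_left.1 (hdisj i j hij)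
              (hmemS g hg i))
        · have h2 := hgi.2.2
          rw [h] at h2
          linarith [hp1'.2.1]
      subst hpe hge
      have hme : m = m' := Nat.eq_of_mul_eq_mul_right
        (pow_pos (Nat.mul_pos (hgpos g hg) hpp.pos) k) heq
      subst hme
      rfl
  have hAle' : (A.card : ℝ) ≤ (((Finset.Ioc 0 ⌊x⌋₊).filter Gd).card : ℝ) := by exact_mod_cast hAle
  refine le_trans ?_ hAle'
  rw [hA, Finset.prod_univ_sum, mul_assoc, Finset.sum_mul, Finset.mul_sum]
  refine Finset.sum_le_sum fun m hm => ?_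
  rw [Finset.mul_sum, Finset.mul_sum]
  refine Finset.sum_le_sum fun g hg => ?_
  refine le_trans (le_of_eq ?_) (hcard m hm g hg)
  have hm0 : (0 : ℝ) < m := by exact_mod_cast (hMs m hm).1
  simp only [Z]
  rw [Real.div_rpow hx0.le hm0.le, Real.rpow_neg hm0.le, Finset.prod_div_distrib,
    Finset.prod_const_one, Nat.cast_prod]
  ring

lemma sum_powerset_prod_le (P : Finset ℕ) (J : ℕ) {l : ℝ} (hl : 1 ≤ l)
    (hP : ∑ p ∈ P, 1 / (p : ℝ) ≤ l) :
    ∑ s ∈ P.powerset.filter (fun s => s.card ≤ J), ∏ p ∈ s, 1 / (p : ℝ) ≤ Real.exp 1 * l ^ J := by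
  have hl0 : 0 < l := by linarith
  have h1 : ∀ s ∈ P.powerset.filter (fun s => s.card ≤ J), ∏ p ∈ s, 1 / (p : ℝ) ≤
      l ^ J * ∏ p ∈ s, (1 / (p : ℝ) / l) := by
    intro s hs
    rw [Finset.mem_filter] at hs
    have e : ∏ p ∈ s, (1 / (p : ℝ) / l) = (∏ p ∈ s, 1 / (p : ℝ)) / l ^ s.card := by
      rw [Finset.prod_div_distrib (f := fun p : ℕ => 1 / (p : ℝ)) (g := fun _ => l),
        Finset.prod_const]
    rw [e, mul_div_assoc', le_div_iff₀ (by positivity), mul_comm]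
    exact mul_le_mul_of_nonneg_right (pow_le_pow_right₀ hl hs.2)
      (Finset.prod_nonneg fun p _ => by positivity)
  refine (Finset.sum_le_sum h1).trans ?_
  rw [← Finset.mul_sum, mul_comm]
  refine mul_le_mul_of_nonneg_right ?_ (by positivity)
  refine (Finset.sum_le_sum_of_subset_of_nonneg (Finset.filter_subset _ _) fun s _ _ =>
    Finset.prod_nonneg fun p _ => by positivity).trans ?_
  rw [← Finset.prod_one_add]
  calc ∏ p ∈ P, (1 + 1 / (p : ℝ) / l) ≤ ∏ p ∈ P, Real.exp (1 / (p : ℝ) / l) :=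
        Finset.prod_le_prod (fun p _ => by positivity) fun p _ => by
          have := Real.add_one_le_exp (1 / (p : ℝ) / l)
          linarith
    _ ≤ Real.exp 1 := by
        rw [← Real.exp_sum, ← Finset.sum_div]
        exact Real.exp_le_exp.2 ((div_le_one hl0).2 hP)

lemma card_primes_le {z Z : ℝ} (hz : 1 < z) (hZ : 0 ≤ Z) :
    (((Finset.Ioc 0 ⌊Z⌋₊).filter (fun p : ℕ => p.Prime ∧ z < p)).card : ℝ) ≤
      2 * Z / Real.log z := by
  have hlz : 0 < Real.log z := Real.log_pos hz
  rw [le_div_iff₀ hlz, ← nsmul_eq_mul]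
  have h1 := Chebyshev.theta_le_log4_mul_x hZ
  have h2 : Real.log 4 ≤ 2 := by
    rw [show (4 : ℝ) = 2 ^ 2 by norm_num, Real.log_pow]
    have := Real.log_two_lt_d9
    push_cast
    linarith
  refine le_trans ?_ (h1.trans (mul_le_mul_of_nonneg_right h2 hZ))
  rw [Chebyshev.theta]
  refine (Finset.card_nsmul_le_sum _ (fun p : ℕ => Real.log p) _ fun p hp => ?_).trans
    (Finset.sum_le_sum_of_subset_of_nonneg ?_ fun p _ _ => Real.log_natCast_nonneg p)
  · rw [Finset.mem_filter] at hp
    exact Real.log_le_log (by linarith) hp.2.2.le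
  · intro p hp
    rw [Finset.mem_filter] at hp ⊢
    exact ⟨hp.1, hp.2.1⟩

/-- Upper bound for the number of `n ≤ x` of the form `m * (p * ∏ s) ^ k` with a large prime `p`
and a small set `s`. -/
theorem card_large_prime_le {k : ℕ} (hk : 1 ≤ k) {x z l : ℝ} (hx : 0 < x) (hz : 1 < z)
    (Ms P T : Finset ℕ) (J : ℕ) (hMs : ∀ m ∈ Ms, 0 < m) (hP : ∀ p ∈ P, 0 < p) (hl : 1 ≤ l)
    (hPl : ∑ p ∈ P, 1 / (p : ℝ) ≤ l)
    (hT : ∀ n ∈ T, (n : ℝ) ≤ x ∧ ∃ m ∈ Ms, ∃ s ⊆ P, s.card ≤ J ∧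
      ∃ p : ℕ, p.Prime ∧ z < p ∧ n = m * ((∏ i ∈ s, i) * p) ^ k) :
    (T.card : ℝ) ≤ 2 * x ^ (1 / (k : ℝ)) / Real.log z * (∑ m ∈ Ms, (m : ℝ) ^ (-(1 / (k : ℝ)))) *
      (Real.exp 1 * l ^ J) := by
  have hk' : (0 : ℝ) < k := by exact_mod_cast hk
  have hk0 : k ≠ 0 := by omega
  have hlz : 0 < Real.log z := Real.log_pos hz
  let Z : ℕ → Finset ℕ → ℝ := fun m s => (x / m) ^ (1 / (k : ℝ)) / ((∏ i ∈ s, i : ℕ) : ℝ)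
  let Q := P.powerset.filter (fun s => s.card ≤ J)
  have hsub : T ⊆ Ms.biUnion fun m => Q.biUnion fun s =>
      ((Finset.Ioc 0 ⌊Z m s⌋₊).filter (fun p : ℕ => p.Prime ∧ z < p)).image
        fun p => m * ((∏ i ∈ s, i) * p) ^ k := by
    intro n hn
    obtain ⟨hnx, m, hm, s, hs, hsJ, p, hp, hzp, rfl⟩ := hT n hn
    have hm0 : (0 : ℝ) < m := by exact_mod_cast hMs m hm
    have hs0 : (0 : ℝ) < ((∏ i ∈ s, i : ℕ) : ℝ) := by
      exact_mod_cast Finset.prod_pos fun i hi => hP i (hs hi)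
    simp only [Finset.mem_biUnion, Finset.mem_image]
    refine ⟨m, hm, s, Finset.mem_filter.2 ⟨Finset.mem_powerset.2 hs, hsJ⟩, p, ?_, rfl⟩
    rw [Finset.mem_filter, Finset.mem_Ioc]
    refine ⟨⟨hp.pos, Nat.le_floor ?_⟩, hp, hzp⟩
    simp only [Z]
    rw [le_div_iff₀ hs0, one_div]
    rw [Nat.cast_mul, Nat.cast_pow, Nat.cast_mul] at hnx
    have h2 : ((p : ℝ) * ((∏ i ∈ s, i : ℕ) : ℝ)) ^ k ≤ x / m := by
      rw [le_div_iff₀ hm0, mul_comm (p : ℝ)]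
      linarith
    calc (p : ℝ) * ((∏ i ∈ s, i : ℕ) : ℝ)
        = (((p : ℝ) * ((∏ i ∈ s, i : ℕ) : ℝ)) ^ k) ^ ((k : ℝ)⁻¹) := by
          rw [Real.pow_rpow_inv_natCast (by positivity) hk0]
      _ ≤ _ := Real.rpow_le_rpow (by positivity) h2 (by positivity)
  have h1 : (T.card : ℝ) ≤ ∑ m ∈ Ms, ∑ s ∈ Q, 2 * Z m s / Real.log z := by
    refine le_trans (Nat.cast_le.2 (Finset.card_le_card hsub)) ?_
    refine le_trans (Nat.cast_le.2 Finset.card_biUnion_le) ?_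
    push_cast
    refine Finset.sum_le_sum fun m _ => ?_
    refine le_trans (Nat.cast_le.2 Finset.card_biUnion_le) ?_
    push_cast
    refine Finset.sum_le_sum fun s _ => ?_
    refine le_trans (Nat.cast_le.2 Finset.card_image_le) ?_
    exact card_primes_le hz (by positivity)
  refine h1.trans ?_
  have h2 : ∀ m ∈ Ms, ∑ s ∈ Q, 2 * Z m s / Real.log z =
      2 * x ^ (1 / (k : ℝ)) / Real.log z * (m : ℝ) ^ (-(1 / (k : ℝ))) *
        ∑ s ∈ Q, ∏ p ∈ s, 1 / (p : ℝ) := by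
    intro m hm
    have hm0 : (0 : ℝ) < m := by exact_mod_cast hMs m hm
    rw [Finset.mul_sum]
    refine Finset.sum_congr rfl fun s _ => ?_
    simp only [Z]
    rw [Real.div_rpow hx.le hm0.le, Real.rpow_neg hm0.le, Finset.prod_div_distrib,
      Finset.prod_const_one, Nat.cast_prod]
    ring
  rw [Finset.sum_congr rfl h2, ← Finset.sum_mul, ← Finset.mul_sum]
  refine mul_le_mul_of_nonneg_left (sum_powerset_prod_le P J hl hPl) ?_
  exact mul_nonneg (by positivity) (Finset.sum_nonneg fun m _ => by positivity)

lemma card_le_rpow_mul_sum {x θ : ℝ} (hθ : 0 ≤ θ) (T : Finset ℕ)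
    (hT : ∀ n ∈ T, 0 < n ∧ (n : ℝ) ≤ x) :
    (T.card : ℝ) ≤ x ^ θ * ∑ n ∈ T, (n : ℝ) ^ (-θ) := by
  rw [Finset.mul_sum, Finset.card_eq_sum_ones, Nat.cast_sum]
  refine Finset.sum_le_sum fun n hn => ?_
  have hn0 : (0 : ℝ) < n := by exact_mod_cast (hT n hn).1
  have h2 := Real.rpow_le_rpow hn0.le (hT n hn).2 hθ
  rw [Real.rpow_neg hn0.le, ← div_eq_mul_inv, Nat.cast_one]
  exact (one_le_div (by positivity)).2 h2

/-- The contribution of `n` divisible by `p ^ (k + 1)` for a large prime `p`. -/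
theorem sum_pow_succ_dvd_le {k q : ℕ} (hk : 1 ≤ k) {x y : ℝ} (hx : 2 ≤ x) (hy : 0 < y)
    (T : Finset ℕ) (hT : ∀ n ∈ T, 0 < n ∧ (n : ℝ) ≤ x ∧ Adm k q n ∧
      ∃ p : ℕ, p.Prime ∧ y < p ∧ p ^ (k + 1) ∣ n) :
    ∑ n ∈ T, (n : ℝ) ^ (-(1 / (k : ℝ))) ≤ 2 * Real.log x * (1 + Real.log x) * y ^ (-(1 / (k : ℝ))) *
      ∑ n ∈ (Finset.Ioc 0 ⌊x⌋₊).filter (Adm k q), (n : ℝ) ^ (-(1 / (k : ℝ))) := by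
  have hk' : (0 : ℝ) < k := by exact_mod_cast hk
  have hx0 : 0 < x := by linarith
  have hfac : ∀ n ∈ T, ∃ p j m : ℕ, n = p ^ j * m ∧ p.Prime ∧ y < p ∧ (p : ℝ) ≤ x ∧ k + 1 ≤ j ∧
      (j : ℝ) ≤ 2 * Real.log x ∧ 0 < m ∧ (m : ℝ) ≤ x ∧ Adm k q m := by
    intro n hn
    obtain ⟨hn0, hnx, hna, p, hp, hyp, hpn⟩ := hT n hn
    have hle : ∀ d : ℕ, d ∣ n → (d : ℝ) ≤ x := fun d hd =>
      le_trans (by exact_mod_cast Nat.le_of_dvd hn0 hd) hnx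
    have hmul : n = p ^ (n.factorization p) * (n / p ^ (n.factorization p)) :=
      (Nat.ordProj_mul_ordCompl_eq_self n p).symm
    have hcop : (p ^ (n.factorization p)).Coprime (n / p ^ (n.factorization p)) :=
      (Nat.coprime_ordCompl hp hn0.ne').pow_left _
    refine ⟨p, n.factorization p, n / p ^ (n.factorization p), hmul, hp, hyp,
      hle p ((dvd_pow_self p (by omega)).trans hpn), ?_, ?_, Nat.ordCompl_pos p hn0.ne',
      hle _ (Nat.ordCompl_dvd n p), ?_⟩
    · exact (hp.pow_dvd_iff_le_factorization hn0.ne').1 hpn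
    · have h1 := hle _ (Nat.ordProj_dvd n p)
      have h2 : (2 : ℝ) ^ (n.factorization p) ≤ x := by
        refine le_trans ?_ h1
        push_cast
        exact pow_le_pow_left₀ (by norm_num) (by exact_mod_cast hp.two_le) _
      have h3 := Real.log_le_log (by positivity) h2
      rw [Real.log_pow] at h3
      have := Real.log_two_gt_d9
      have h4 : (0 : ℝ) ≤ n.factorization p := Nat.cast_nonneg _
      nlinarith
    · rw [hmul] at hna
      exact ((adm_mul_iff hcop).1 hna).2
  choose! p j m hn hp hyp hpx hj hjx hm hmx hma using hfac
  let R := (Finset.Ioc 0 ⌊x⌋₊).filter (fun p : ℕ => y < p) ×ˢ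
    ((Finset.Ioc 0 ⌊2 * Real.log x⌋₊).filter (fun j => k + 1 ≤ j) ×ˢ
      (Finset.Ioc 0 ⌊x⌋₊).filter (Adm k q))
  have hlx : 0 < Real.log x := Real.log_pos (by linarith)
  have h1 : ∑ n ∈ T, (n : ℝ) ^ (-(1 / (k : ℝ))) ≤
      ∑ a ∈ R, y ^ (-(1 / (k : ℝ))) * (1 / (a.1 : ℝ)) * (a.2.2 : ℝ) ^ (-(1 / (k : ℝ))) := by
    refine sum_le_sum_of_injOn (fun n => (p n, j n, m n)) ?_ ?_ ?_ ?_
    · intro n hnT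
      simp only [R, Finset.mem_product, Finset.mem_filter, Finset.mem_Ioc]
      exact ⟨⟨⟨(hp n hnT).pos, Nat.le_floor (hpx n hnT)⟩, hyp n hnT⟩,
        ⟨⟨by have := hj n hnT; omega, Nat.le_floor (hjx n hnT)⟩, hj n hnT⟩,
        ⟨hm n hnT, Nat.le_floor (hmx n hnT)⟩, hma n hnT⟩
    · intro a ha b hb hab
      simp only [Prod.mk.injEq] at hab
      rw [hn a ha, hn b hb, hab.1, hab.2.1, hab.2.2]
    · intro n hnT
      have hp0 : (0 : ℝ) < p n := by exact_mod_cast (hp n hnT).pos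
      have hp1 : (1 : ℝ) ≤ p n := by exact_mod_cast (hp n hnT).pos
      nth_rewrite 1 [hn n hnT]
      rw [Nat.cast_mul, Nat.cast_pow, Real.mul_rpow (by positivity) (by positivity)]
      refine mul_le_mul_of_nonneg_right ?_ (by positivity)
      have h2 : ((k + 1 : ℕ) : ℝ) ≤ j n := by exact_mod_cast hj n hnT
      rw [← Real.rpow_natCast, ← Real.rpow_mul hp0.le]
      calc (p n : ℝ) ^ ((j n : ℝ) * -(1 / (k : ℝ))) ≤ (p n : ℝ) ^ (-(1 / (k : ℝ)) + -1) := by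
            refine Real.rpow_le_rpow_of_exponent_le hp1 ?_
            have h3 : ((k + 1 : ℕ) : ℝ) / k ≤ j n / k := by gcongr
            have h4 : ((k + 1 : ℕ) : ℝ) / k = 1 + 1 / k := by push_cast; field_simp
            have h5 : (j n : ℝ) * -(1 / (k : ℝ)) = -(j n / k) := by ring
            rw [h5]
            linarith
        _ = (p n : ℝ) ^ (-(1 / (k : ℝ))) * (1 / (p n : ℝ)) := by
            rw [Real.rpow_add hp0, Real.rpow_neg_one, one_div (p n : ℝ)]
        _ ≤ _ := by
            refine mul_le_mul_of_nonneg_right ?_ (by positivity)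
            refine Real.rpow_le_rpow_of_nonpos hy (hyp n hnT).le ?_
            have : 0 < 1 / (k : ℝ) := by positivity
            linarith
    · intro a _
      positivity
  refine h1.trans ?_
  set Φ := ∑ n ∈ (Finset.Ioc 0 ⌊x⌋₊).filter (Adm k q), (n : ℝ) ^ (-(1 / (k : ℝ))) with hΦ
  have hΦ0 : 0 ≤ Φ := Finset.sum_nonneg fun n _ => by positivity
  have h2 : ∑ a ∈ R, y ^ (-(1 / (k : ℝ))) * (1 / (a.1 : ℝ)) * (a.2.2 : ℝ) ^ (-(1 / (k : ℝ))) =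
      y ^ (-(1 / (k : ℝ))) * (∑ p ∈ (Finset.Ioc 0 ⌊x⌋₊).filter (fun p : ℕ => y < p), 1 / (p : ℝ)) *
        ((((Finset.Ioc 0 ⌊2 * Real.log x⌋₊).filter (fun j => k + 1 ≤ j)).card : ℝ) * Φ) := by
    simp only [R]
    rw [Finset.sum_product, Finset.mul_sum, Finset.sum_mul]
    refine Finset.sum_congr rfl fun p _ => ?_
    rw [Finset.sum_product, ← nsmul_eq_mul, ← Finset.sum_const, Finset.mul_sum]
    refine Finset.sum_congr rfl fun j _ => ?_
    rw [hΦ, Finset.mul_sum]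
  rw [h2]
  have h3 : ∑ p ∈ (Finset.Ioc 0 ⌊x⌋₊).filter (fun p : ℕ => y < p), 1 / (p : ℝ) ≤
      1 + Real.log x := by
    have h4 : 1 ≤ ⌊x⌋₊ := Nat.le_floor (by push_cast; linarith)
    refine (Finset.sum_le_sum_of_subset_of_nonneg (Finset.filter_subset _ _) fun p _ _ => by
      positivity).trans ((sum_inv_Ioc_le _ h4).trans ?_)
    have := Real.log_le_log (by exact_mod_cast h4) (Nat.floor_le hx0.le)
    linarith
  have h5 : (((Finset.Ioc 0 ⌊2 * Real.log x⌋₊).filter (fun j => k + 1 ≤ j)).card : ℝ) ≤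
      2 * Real.log x := by
    refine le_trans ?_ (Nat.floor_le (by positivity))
    have h6 := Finset.card_filter_le (Finset.Ioc 0 ⌊2 * Real.log x⌋₊) (fun j => k + 1 ≤ j)
    rw [Nat.card_Ioc, Nat.sub_zero] at h6
    exact_mod_cast h6
  calc _ ≤ y ^ (-(1 / (k : ℝ))) * (1 + Real.log x) * (2 * Real.log x * Φ) := by gcongr
    _ = _ := by ring

lemma exists_eq_mul_prod_pow {k n : ℕ} (t : Finset ℕ)
    (ht : ∀ p ∈ t, p.Prime ∧ p ^ k ∣ n ∧ ¬ p ^ (k + 1) ∣ n) :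
    ∃ m, n = m * (∏ p ∈ t, p) ^ k ∧ ∀ p ∈ t, ¬ p ∣ m := by
  have h1 : ∏ p ∈ t, p ^ k ∣ n := by
    refine Finset.prod_dvd_of_isRelPrime (fun a ha b hb hab => ?_) fun p hp => (ht p hp).2.1
    exact Nat.coprime_iff_isRelPrime.1 (Nat.Coprime.pow k k
      ((Nat.coprime_primes (ht a ha).1 (ht b hb).1).2 hab))
  obtain ⟨m, hm⟩ := h1
  refine ⟨m, by rw [hm, Finset.prod_pow, mul_comm], fun p hp hpm => (ht p hp).2.2 ?_⟩
  rw [hm, pow_succ]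
  exact mul_dvd_mul (Finset.dvd_prod_of_mem (fun p => p ^ k) hp) hpm

lemma convenient_of_le_card {k J n : ℕ} {y : ℝ} (hn : 0 < n)
    (H : ∀ p : ℕ, p.Prime → p ∣ n → y < p → p ^ k ∣ n ∧ ¬ p ^ (k + 1) ∣ n)
    (hJ : J ≤ (n.primeFactors.filter (fun p : ℕ => y < p)).card) : Convenient k y J n := by
  set s := n.primeFactors.filter (fun p : ℕ => y < p) with hs
  set c := s.card with hc
  let e := s.orderEmbOfFin hc.symm
  have hes : ∀ i, e i ∈ s := fun i => s.orderEmbOfFin_mem hc.symm i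
  have hsp : ∀ p ∈ s, p.Prime ∧ p ∣ n ∧ y < p := by
    intro p hp
    rw [hs, Finset.mem_filter, Nat.mem_primeFactors] at hp
    exact ⟨hp.1.1, hp.1.2.1, hp.2⟩
  let P : Fin J → ℕ := fun t => e ⟨c - 1 - t, by have := t.2; omega⟩
  have hPs : ∀ t, P t ∈ s := fun t => hes _
  have hPanti : ∀ a b : Fin J, a < b → P b < P a := by
    intro a b hab
    refine e.strictMono ?_
    rw [Fin.mk_lt_mk]
    have h1 := a.2
    have h2 := b.2
    have : (a : ℕ) < b := hab
    omega
  have hPinj : Function.Injective P := by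
    intro a b hab
    rcases lt_trichotomy a b with h | h | h
    · exact absurd hab (hPanti a b h).ne'
    · exact h
    · exact absurd hab (hPanti b a h).ne
  obtain ⟨m, hm, hmP⟩ := exists_eq_mul_prod_pow (k := k) (n := n) (Finset.univ.image P) (by
    intro p hp
    obtain ⟨t, -, rfl⟩ := Finset.mem_image.1 hp
    obtain ⟨h1, h2, h3⟩ := hsp _ (hPs t)
    exact ⟨h1, H _ h1 h2 h3⟩)
  rw [Finset.prod_image fun a _ b _ h => hPinj h] at hm
  have hm0 : 0 < m := by
    rcases Nat.eq_zero_or_pos m with rfl | h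
    · simp at hm
      omega
    · exact h
  refine ⟨m, P, hm0, fun t => (hsp _ (hPs t)).1, hPanti, fun t => ⟨(hsp _ (hPs t)).2.2, ?_⟩, hm⟩
  have hPj : Pj 1 m = 1 ∨ ((Pj 1 m).Prime ∧ Pj 1 m ∣ m) := by
    unfold Pj
    rcases h : m.primeFactorsList.reverse with _ | ⟨a, l⟩
    · left; simp
    · right
      have : a ∈ m.primeFactorsList := by
        rw [← List.mem_reverse, h]
        simp
      simpa using ⟨Nat.prime_of_mem_primeFactorsList this, Nat.dvd_of_mem_primeFactorsList this⟩
  rcases hPj with h | ⟨h1, h2⟩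
  · rw [h]
    exact (hsp _ (hPs t)).1.one_lt
  · by_cases hyl : y < (Pj 1 m : ℝ)
    · have h3 : Pj 1 m ∈ s := by
        rw [hs, Finset.mem_filter, Nat.mem_primeFactors]
        exact ⟨⟨h1, h2.trans (Dvd.intro _ hm.symm), hn.ne'⟩, hyl⟩
      obtain ⟨i, hi⟩ : ∃ i, e i = Pj 1 m := by
        have : Pj 1 m ∈ Set.range e := by
          rw [Finset.range_orderEmbOfFin]
          exact h3
        exact this
      rw [← hi]
      refine e.strictMono ?_
      rw [Fin.lt_def]
      by_contra hcon
      push Not at hcon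
      simp only at hcon
      have ht := t.2
      have hi2 := i.2
      refine hmP (e i) (Finset.mem_image.2 ⟨⟨c - 1 - i, by omega⟩, Finset.mem_univ _, ?_⟩) (hi ▸ h2)
      simp only [P]
      congr 1
      ext
      simp only
      omega
    · push Not at hyl
      have := (hsp _ (hPs t)).2.2
      exact_mod_cast hyl.trans_lt this

section Arithmetic

variable {K V : ℕ} {f : Fin K → ℕ → ℤ} {W : Fin K → ℕ → Polynomial ℤ} {k q : ℕ}

lemma gcd_mul_iff (hf : ∀ i, IsMultFn (f i)) {m n : ℕ} (h : m.Coprime n) :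
    Int.gcd (∏ i, f i (m * n)) (q : ℤ) = 1 ↔
      Int.gcd (∏ i, f i m) (q : ℤ) = 1 ∧ Int.gcd (∏ i, f i n) (q : ℤ) = 1 := by
  simp only [← Int.isCoprime_iff_gcd_eq_one]
  rw [Finset.prod_congr rfl fun i _ => (hf i).2 m n h, Finset.prod_mul_distrib,
    IsCoprime.mul_left_iff]

lemma gcd_one (hf : ∀ i, IsMultFn (f i)) : Int.gcd (∏ i, f i 1) (q : ℤ) = 1 := by
  rw [Finset.prod_congr rfl fun i _ => (hf i).1]
  simp

lemma prod_prime_pow_eq (hfW : ∀ (i : Fin K) (v : ℕ), 1 ≤ v → v ≤ V → ∀ p : ℕ, p.Prime →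
    f i (p ^ v) = (W i v).eval (p : ℤ)) {v p : ℕ} (h1 : 1 ≤ v) (hv : v ≤ V) (hp : p.Prime) :
    ∏ i, f i (p ^ v) = (∏ i, W i v).eval (p : ℤ) := by
  rw [Polynomial.eval_prod]
  exact Finset.prod_congr rfl fun i _ => hfW i v h1 hv p hp

lemma isUnit_aeval_natCast_iff (P : ℤ[X]) (n : ℕ) :
    IsUnit (aeval (n : ZMod q) P) ↔ Int.gcd (P.eval (n : ℤ)) (q : ℤ) = 1 := by
  have h : aeval (n : ZMod q) P = ((P.eval (n : ℤ) : ℤ) : ZMod q) := by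
    have := Polynomial.aeval_algebraMap_apply (ZMod q) (n : ℤ) P
    simpa using this
  rw [h, ZMod.coe_int_isUnit_iff_isCoprime, Int.isCoprime_iff_gcd_eq_one, Int.gcd_comm]

lemma adm_of_gcd (hf : ∀ i, IsMultFn (f i))
    (hfW : ∀ (i : Fin K) (v : ℕ), 1 ≤ v → v ≤ V → ∀ p : ℕ, p.Prime →
      f i (p ^ v) = (W i v).eval (p : ℤ)) (hkV : k ≤ V)
    (hq : KAdmissible (fun v => ∏ i, W i v) k q) {n : ℕ} (hn : 0 < n)
    (h : Int.gcd (∏ i, f i n) (q : ℤ) = 1) : Adm k q n := by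
  intro p hp hpn hpq
  by_contra hcon
  rw [hp.pow_dvd_iff_le_factorization hn.ne'] at hcon
  push Not at hcon
  have hv : 1 ≤ n.factorization p := (hp.dvd_iff_one_le_factorization hn.ne').1 hpn
  refine hq.2 _ hv hcon ⟨ZMod.unitOfCoprime p ((hp.coprime_iff_not_dvd).2 hpq), ?_⟩
  rw [ZMod.coe_unitOfCoprime, isUnit_aeval_natCast_iff,
    ← prod_prime_pow_eq hfW hv (by omega) hp]
  rw [← Nat.ordProj_mul_ordCompl_eq_self n p,
    gcd_mul_iff hf ((Nat.coprime_ordCompl hp hn.ne').pow_left _)] at h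
  exact h.1

lemma gcd_of_goodPrime
    (hfW : ∀ (i : Fin K) (v : ℕ), 1 ≤ v → v ≤ V → ∀ p : ℕ, p.Prime →
      f i (p ^ v) = (W i v).eval (p : ℤ)) (hk1 : 1 ≤ k) (hkV : k ≤ V) {p : ℕ}
    (hp : GoodPrime (∏ i, W i k) q p) : Int.gcd (∏ i, f i (p ^ k)) (q : ℤ) = 1 := by
  rw [prod_prime_pow_eq hfW hk1 hkV hp.1]
  rw [Nat.eq_one_iff_not_exists_prime_dvd]
  intro ℓ hℓ h
  have h1 : (ℓ : ℤ) ∣ ((Int.gcd ((∏ i, W i k).eval (p : ℤ)) (q : ℤ) : ℕ) : ℤ) :=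
    Int.natCast_dvd_natCast.2 h
  exact hp.2.2 ℓ hℓ (Int.natCast_dvd_natCast.1 (h1.trans (Int.gcd_dvd_right _ _)))
    (h1.trans (Int.gcd_dvd_left _ _))

lemma exists_coprime_eval (hq0 : 0 < q) (hq : KAdmissible (fun v => ∏ i, W i v) k q) :
    ∃ n : ℕ, n.Coprime q ∧
      ∀ p : ℕ, p.Prime → p ∣ q → ¬ (p : ℤ) ∣ (∏ i, W i k).eval (n : ℤ) := by
  obtain ⟨u, hu⟩ := hq.1
  have : NeZero q := ⟨hq0.ne'⟩
  refine ⟨(u : ZMod q).val, ZMod.val_coe_unit_coprime u, ?_⟩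
  intro p hp hpq hdvd
  rw [← ZMod.natCast_zmod_val (u : ZMod q), isUnit_aeval_natCast_iff] at hu
  have := Int.dvd_coe_gcd hdvd (Int.natCast_dvd_natCast.2 hpq)
  rw [hu] at this
  have h2 : p ∣ 1 := Int.natCast_dvd_natCast.1 this
  exact hp.not_dvd_one h2

end Arithmetic

/-- Uniform bound `E` for the weighted sums over `w`-smooth numbers with `w ≤ x`. -/
def SmoothBound (k q : ℕ) (x E : ℝ) : Prop :=
  ∀ θ w : ℝ, 1 / (2 * k : ℝ) ≤ θ → θ ≤ 1 / (k : ℝ) → (1 - k * θ) * Real.log w ≤ 1 → w ≤ x →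
    ∀ S : Finset ℕ, (∀ n ∈ S, 0 < n ∧ Adm k q n ∧ ∀ p : ℕ, p.Prime → p ∣ n → (p : ℝ) ≤ w) →
      ∑ n ∈ S, (n : ℝ) ^ (-θ) ≤ E

lemma exists_smoothBound {k : ℕ} (hk : 1 ≤ k) : ∃ C : ℝ, 0 < C ∧ ∀ q : ℕ, 0 < q → ∀ x : ℝ, 1 ≤ x →
    SmoothBound k q x (Real.exp (C * (18 * (1 + Real.log (1 + Real.log x)) + Real.log q))) := by
  obtain ⟨C, hC, H⟩ := exists_sum_smooth_le hk
  refine ⟨C, hC, fun q hq x hx θ w h1 h2 h3 h4 S hS => (H q hq θ w h1 h2 h3 S hS).trans ?_⟩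
  refine Real.exp_le_exp.2 (mul_le_mul_of_nonneg_left (add_le_add_left ?_ _) hC.le)
  refine le_trans (Finset.sum_le_sum_of_subset_of_nonneg ?_ fun p _ _ => by positivity)
    (sum_inv_prime_le hx)
  exact Finset.filter_subset_filter _ (Finset.Ioc_subset_Ioc_right (Nat.floor_mono h4))

lemma rankin_exponent {k : ℕ} (hk : 1 ≤ k) {l : ℝ} (hl : 2 ≤ l) :
    1 / (2 * k : ℝ) ≤ 1 / (k : ℝ) - 1 / (k * l) ∧ 1 / (k : ℝ) - 1 / (k * l) ≤ 1 / (k : ℝ) ∧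
      (1 - k * (1 / (k : ℝ) - 1 / (k * l))) * l ≤ 1 := by
  have hk' : (0 : ℝ) < k := by exact_mod_cast hk
  have hl0 : 0 < l := by linarith
  refine ⟨?_, ?_, ?_⟩
  · have h1 : 1 / (k * l) ≤ 1 / (k * 2) := by gcongr
    have h2 : 1 / (2 * k : ℝ) = 1 / k - 1 / (k * 2) := by field_simp; norm_num
    linarith
  · have : 0 < 1 / (k * l) := by positivity
    linarith
  · refine le_of_eq ?_
    field_simp
    ring

lemma card_smooth_le {k q : ℕ} (hk : 1 ≤ k) {x E z : ℝ} (hE : SmoothBound k q x E) (hx : 0 < x)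
    (hz : 2 ≤ Real.log z) (hzx : z ≤ x) (T : Finset ℕ)
    (hT : ∀ n ∈ T, 0 < n ∧ (n : ℝ) ≤ x ∧ Adm k q n ∧ ∀ p : ℕ, p.Prime → p ∣ n → (p : ℝ) ≤ z) :
    (T.card : ℝ) ≤ x ^ (1 / (k : ℝ)) * Real.exp (-(Real.log x / (k * Real.log z))) * E := by
  have hk' : (0 : ℝ) < k := by exact_mod_cast hk
  obtain ⟨h1, h2, h3⟩ := rankin_exponent hk hz
  have hθ : 0 ≤ 1 / (k : ℝ) - 1 / (k * Real.log z) := le_trans (by positivity) h1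
  refine (card_le_rpow_mul_sum hθ T fun n hn => ⟨(hT n hn).1, (hT n hn).2.1⟩).trans ?_
  have h4 : x ^ (1 / (k : ℝ) - 1 / (k * Real.log z)) =
      x ^ (1 / (k : ℝ)) * Real.exp (-(Real.log x / (k * Real.log z))) := by
    rw [sub_eq_add_neg, Real.rpow_add hx, Real.rpow_def_of_pos hx (-(1 / (k * Real.log z)))]
    congr 2
    ring
  rw [h4]
  exact mul_le_mul_of_nonneg_left (hE _ z h1 h2 h3 hzx T fun n hn =>
    ⟨(hT n hn).1, (hT n hn).2.2⟩) (by positivity)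

lemma sum_smooth_tail_le {k q : ℕ} (hk : 1 ≤ k) {x E y X : ℝ} (hE : SmoothBound k q x E)
    (hy : 2 ≤ Real.log y) (hyx : y ≤ x) (hX : 0 < X) (T : Finset ℕ)
    (hT : ∀ n ∈ T, X < n ∧ Adm k q n ∧ ∀ p : ℕ, p.Prime → p ∣ n → (p : ℝ) ≤ y) :
    ∑ n ∈ T, (n : ℝ) ^ (-(1 / (k : ℝ))) ≤ Real.exp (-(Real.log X / (k * Real.log y))) * E := by
  have hk' : (0 : ℝ) < k := by exact_mod_cast hk
  obtain ⟨h1, h2, h3⟩ := rankin_exponent hk hy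
  refine le_trans ?_ (mul_le_mul_of_nonneg_left (hE _ y h1 h2 h3 hyx T fun n hn =>
    ⟨by exact_mod_cast hX.trans (hT n hn).1, (hT n hn).2⟩) (Real.exp_pos _).le)
  rw [Finset.mul_sum]
  refine Finset.sum_le_sum fun n hn => ?_
  have hXn := (hT n hn).1
  have hn0 : (0 : ℝ) < n := hX.trans hXn
  have h4 : (n : ℝ) ^ (-(1 / (k : ℝ))) = (n : ℝ) ^ (-(1 / (k * Real.log y))) *
      (n : ℝ) ^ (-(1 / (k : ℝ) - 1 / (k * Real.log y))) := by
    rw [← Real.rpow_add hn0]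
    congr 1
    ring
  rw [h4]
  refine mul_le_mul_of_nonneg_right ?_ (by positivity)
  rw [Real.rpow_def_of_pos hn0]
  refine Real.exp_le_exp.2 ?_
  have h5 := Real.log_le_log hX hXn.le
  have h6 : 0 < 1 / (k * Real.log y) := by positivity
  have h7 : Real.log X / (k * Real.log y) = Real.log X * (1 / (k * Real.log y)) := by ring
  rw [h7]
  nlinarith

lemma card_pow_succ_dvd_le {k q : ℕ} (hk : 1 ≤ k) {x E y : ℝ} (hE : SmoothBound k q x E)
    (hx : 2 ≤ x) (hy : 0 < y) (T : Finset ℕ) (hT : ∀ n ∈ T, 0 < n ∧ (n : ℝ) ≤ x ∧ Adm k q n ∧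
      ∃ p : ℕ, p.Prime ∧ y < p ∧ p ^ (k + 1) ∣ n) :
    (T.card : ℝ) ≤ x ^ (1 / (k : ℝ)) * (2 * Real.log x * (1 + Real.log x) *
      y ^ (-(1 / (k : ℝ))) * E) := by
  have hk' : (0 : ℝ) < k := by exact_mod_cast hk
  have hlx : 0 < Real.log x := Real.log_pos (by linarith)
  refine (card_le_rpow_mul_sum (by positivity : 0 ≤ 1 / (k : ℝ)) T
    fun n hn => ⟨(hT n hn).1, (hT n hn).2.1⟩).trans ?_
  refine mul_le_mul_of_nonneg_left ?_ (by positivity)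
  refine (sum_pow_succ_dvd_le hk hx hy T hT).trans ?_
  refine mul_le_mul_of_nonneg_left ?_ (by positivity)
  refine hE _ x ?_ le_rfl ?_ le_rfl _ fun n hn => ?_
  · rw [mul_comm]
    gcongr
    linarith
  · rw [mul_one_div_cancel hk'.ne']
    simp
  · rw [Finset.mem_filter, Finset.mem_Ioc] at hn
    refine ⟨hn.1.1, hn.2, fun p _ hpn => ?_⟩
    have h1 : (n : ℝ) ≤ x := (Nat.le_floor_iff' hn.1.1.ne').1 hn.1.2
    exact le_trans (by exact_mod_cast Nat.le_of_dvd hn.1.1 hpn) h1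

/-- The integers `n ≤ X` with `Gd n` and no prime factor exceeding `y`. -/
def smoothGood (Gd : ℕ → Prop) (y X : ℝ) : Finset ℕ :=
  (Finset.Ioc 0 ⌊X⌋₊).filter fun n => Gd n ∧ ∀ p : ℕ, p.Prime → p ∣ n → (p : ℝ) ≤ y

lemma mem_smoothGood {Gd : ℕ → Prop} {y X : ℝ} {n : ℕ} : n ∈ smoothGood Gd y X ↔
    0 < n ∧ (n : ℝ) ≤ X ∧ Gd n ∧ ∀ p : ℕ, p.Prime → p ∣ n → (p : ℝ) ≤ y := by
  rw [smoothGood, Finset.mem_filter, Finset.mem_Ioc]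
  constructor
  · rintro ⟨⟨h1, h2⟩, h3⟩
    exact ⟨h1, (Nat.le_floor_iff' h1.ne').1 h2, h3⟩
  · rintro ⟨h1, h2, h3⟩
    exact ⟨⟨h1, Nat.le_floor h2⟩, h3⟩

lemma one_le_sum_smoothGood {Gd : ℕ → Prop} (h1 : Gd 1) (y : ℝ) {X : ℝ} (hX : 1 ≤ X) (s : ℝ) :
    1 ≤ ∑ m ∈ smoothGood Gd y X, (m : ℝ) ^ s := by
  have : (1 : ℕ) ∈ smoothGood Gd y X :=
    mem_smoothGood.2 ⟨one_pos, by simpa using hX, h1, fun p hp h => absurd h hp.not_dvd_one⟩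
  have h2 := Finset.single_le_sum (f := fun m : ℕ => (m : ℝ) ^ s) (fun m _ => by positivity) this
  simpa using h2

lemma sum_smoothGood_le {k q : ℕ} (hk : 1 ≤ k) {Gd : ℕ → Prop} (h1 : Gd 1)
    (hadm : ∀ n, 0 < n → Gd n → Adm k q n) {x E y X : ℝ} (hE : SmoothBound k q x E)
    (hy : 2 ≤ Real.log y) (hyx : y ≤ x) (hX : 1 ≤ X)
    (hXE : Real.exp (-(Real.log X / (k * Real.log y))) * E ≤ 1) :
    ∑ m ∈ smoothGood Gd y x, (m : ℝ) ^ (-(1 / (k : ℝ))) ≤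
      2 * ∑ m ∈ smoothGood Gd y X, (m : ℝ) ^ (-(1 / (k : ℝ))) := by
  rw [← Finset.sum_filter_add_sum_filter_not _ (fun m : ℕ => (m : ℝ) ≤ X), two_mul]
  refine add_le_add (Finset.sum_le_sum_of_subset_of_nonneg ?_ fun m _ _ => by positivity) ?_
  · intro m hm
    rw [Finset.mem_filter, mem_smoothGood] at hm
    exact mem_smoothGood.2 ⟨hm.1.1, hm.2, hm.1.2.2⟩
  · refine le_trans ?_ (hXE.trans (one_le_sum_smoothGood h1 y hX _))
    refine sum_smooth_tail_le hk hE hy hyx (by linarith) _ fun n hn => ?_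
    rw [Finset.mem_filter, mem_smoothGood] at hn
    exact ⟨not_le.1 hn.2, hadm n hn.1.1 hn.1.2.2.1, hn.1.2.2.2⟩

/-- The contribution of `n` with fewer than `J` prime factors exceeding `y`, one of them large. -/
lemma card_few_large_primes_le {k : ℕ} (hk : 1 ≤ k) {Gd : ℕ → Prop}
    (hmul : ∀ m n : ℕ, m.Coprime n → Gd (m * n) → Gd m) {x y z l : ℝ} (hx : 0 < x)
    (hz : 1 < z) (hyz : y ≤ z) (J : ℕ) (hl : 1 ≤ l)
    (hPl : ∑ p ∈ (Finset.Ioc 0 ⌊x⌋₊).filter Nat.Prime, 1 / (p : ℝ) ≤ l) (T : Finset ℕ)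
    (hT : ∀ n ∈ T, 0 < n ∧ (n : ℝ) ≤ x ∧ Gd n ∧
      (∀ p : ℕ, p.Prime → p ∣ n → y < p → p ^ k ∣ n ∧ ¬ p ^ (k + 1) ∣ n) ∧
      (n.primeFactors.filter (fun p : ℕ => y < p)).card < J ∧
      ∃ p : ℕ, p.Prime ∧ p ∣ n ∧ z < p) :
    (T.card : ℝ) ≤ 2 * x ^ (1 / (k : ℝ)) / Real.log z *
      (∑ m ∈ smoothGood Gd y x, (m : ℝ) ^ (-(1 / (k : ℝ)))) * (Real.exp 1 * l ^ J) := by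
  refine card_large_prime_le hk hx hz _ ((Finset.Ioc 0 ⌊x⌋₊).filter Nat.Prime) T J
    (fun m hm => (mem_smoothGood.1 hm).1) (fun p hp => (Finset.mem_filter.1 hp).2.pos) hl hPl ?_
  intro n hn
  obtain ⟨hn0, hnx, hG, hpow, hcard, p, hp, hpn, hzp⟩ := hT n hn
  set s := n.primeFactors.filter (fun p : ℕ => y < p) with hs
  have hsp : ∀ p ∈ s, p.Prime ∧ p ∣ n ∧ y < p := by
    intro p hp
    rw [hs, Finset.mem_filter, Nat.mem_primeFactors] at hp
    exact ⟨hp.1.1, hp.1.2.1, hp.2⟩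
  have hps : p ∈ s := by
    rw [hs, Finset.mem_filter, Nat.mem_primeFactors]
    exact ⟨⟨hp, hpn, hn0.ne'⟩, by linarith⟩
  obtain ⟨m, hm, hms⟩ := exists_eq_mul_prod_pow (k := k) (n := n) s fun p hp =>
    ⟨(hsp p hp).1, hpow p (hsp p hp).1 (hsp p hp).2.1 (hsp p hp).2.2⟩
  have hle : ∀ d : ℕ, d ∣ n → (d : ℝ) ≤ x := fun d hd =>
    le_trans (by exact_mod_cast Nat.le_of_dvd hn0 hd) hnx
  have hmn : m ∣ n := Dvd.intro _ hm.symm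
  refine ⟨hnx, m, mem_smoothGood.2 ⟨Nat.pos_of_dvd_of_pos hmn hn0, hle m hmn, ?_, ?_⟩,
    s.erase p, ?_, ?_, p, hp, hzp, ?_⟩
  · refine hmul m ((∏ p ∈ s, p) ^ k) ?_ (hm ▸ hG)
    refine Nat.Coprime.pow_right k (Nat.Coprime.prod_right fun r hr => ?_)
    exact (((hsp r hr).1.coprime_iff_not_dvd).2 (hms r hr)).symm
  · intro r hr hrm
    by_contra hcon
    push Not at hcon
    refine hms r ?_ hrm
    rw [hs, Finset.mem_filter, Nat.mem_primeFactors]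
    exact ⟨⟨hr, hrm.trans hmn, hn0.ne'⟩, hcon⟩
  · intro r hr
    have h2 := hsp r (Finset.mem_of_mem_erase hr)
    rw [Finset.mem_filter, Finset.mem_Ioc]
    exact ⟨⟨h2.1.pos, Nat.le_floor (hle r h2.2.1)⟩, h2.1⟩
  · exact (Finset.card_erase_le).trans hcard.le
  · rw [mul_comm (∏ i ∈ s.erase p, i) p, Finset.mul_prod_erase s (fun i => i) hps]
    exact hm

/-- Lower bound for the number of good `n ≤ x`, in terms of `t = log log x`. -/
theorem card_good_lower {k : ℕ} (hk : 1 ≤ k) {Gd : ℕ → Prop} (h1 : Gd 1)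
    (hmul : ∀ m n : ℕ, m.Coprime n → Gd m → Gd n → Gd (m * n)) {G : ℕ → Prop}
    (hG : ∀ p, G p → p.Prime ∧ Gd (p ^ k)) {x t u V L B₁ B₂ c₁ c₂ : ℝ} {J : ℕ} (hJ : 1 ≤ J)
    (hx : 1 < x) (hxt : Real.log x = Real.exp t) (hL : 0 < L) (hu : 0 < u)
    (hc₂ : 0 < c₂) (ht : 0 < t)
    (hwin : ∀ Z, 0 < Z → B₁ ≤ Real.log Z →
      c₁ ≤ ∑ p ∈ (win (Z * Real.exp (-L)) Z).filter G, Real.log p / p)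
    (hmass : ∀ u ρ, B₂ ≤ u → 9 ≤ ρ → c₂ * Real.log ρ ≤
      ∑ p ∈ (win (Real.exp u) (Real.exp (u * ρ))).filter G, 1 / (p : ℝ))
    (hB₂ : B₂ ≤ u) (hρ : 9 ≤ Real.exp (t / (32 * J))) (huV : u * Real.exp (t / 4) ≤ V)
    (hB₁ : 0 ≤ B₁) (hbig : (8 * J + 1) * V + L + B₁ ≤ 3 / 4 * Real.exp t / k) :
    0 ≤ c₁ → c₁ * Real.exp (-L) / Real.exp t * x ^ (1 / (k : ℝ)) *
      (∑ m ∈ smoothGood Gd (Real.exp u) (x ^ (1 / 4 : ℝ)), (m : ℝ) ^ (-(1 / (k : ℝ)))) *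
      (c₂ * (t / (32 * J))) ^ (8 * J) ≤ (((Finset.Ioc 0 ⌊x⌋₊).filter Gd).card : ℝ) := by
  intro hc₁
  have hx0 : 0 < x := by linarith
  have hk' : (0 : ℝ) < k := by exact_mod_cast hk
  have hJ' : (0 : ℝ) < J := by exact_mod_cast hJ
  set ρ := Real.exp (t / (32 * J)) with hρdef
  have hρ1 : 1 ≤ ρ := by linarith
  have hρ0 : 0 < ρ := by linarith
  have hV0 : 0 < V := lt_of_lt_of_le (by positivity) huV
  have hρpow : ρ ^ (8 * J) = Real.exp (t / 4) := by
    rw [hρdef, ← Real.exp_nat_mul]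
    congr 1
    push_cast
    field_simp
    norm_num
  let S : Fin (8 * J) → Finset ℕ := fun i =>
    (win (Real.exp (u * ρ ^ (i : ℕ))) (Real.exp (u * ρ ^ (i : ℕ) * ρ))).filter G
  have hmemS : ∀ i, ∀ p ∈ S i, G p ∧ Real.exp (u * ρ ^ (i : ℕ)) < p ∧
      (p : ℝ) ≤ Real.exp (u * ρ ^ ((i : ℕ) + 1)) := by
    intro i p hp
    rw [Finset.mem_filter, mem_win (Real.exp_pos _).le, mul_assoc, ← pow_succ] at hp
    exact ⟨hp.2, hp.1⟩
  have huρ : ∀ i : ℕ, u ≤ u * ρ ^ i := fun i => le_mul_of_one_le_right hu.le (one_le_pow₀ hρ1)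
  have hmono : ∀ i j : ℕ, i ≤ j → u * ρ ^ i ≤ u * ρ ^ j := fun i j hij =>
    mul_le_mul_of_nonneg_left (pow_le_pow_right₀ hρ1 hij) hu.le
  have hdisj' : ∀ i j : Fin (8 * J), i < j → Disjoint (S i) (S j) := by
    intro i j hij
    rw [Finset.disjoint_left]
    intro p hpi hpj
    have h2 := (hmemS i p hpi).2.2
    have h3 := (hmemS j p hpj).2.1
    have h4 := Real.exp_le_exp.2 (hmono (i + 1) j hij)
    linarith
  have hM : 0 < x ^ (1 / 4 : ℝ) := by positivity
  have hZ0 : (x / x ^ (1 / 4 : ℝ)) ^ (1 / (k : ℝ)) / Real.exp V ^ (8 * J) =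
      Real.exp (3 / 4 * Real.exp t / k - 8 * J * V) := by
    have h2 : x / x ^ (1 / 4 : ℝ) = x ^ (3 / 4 : ℝ) := by
      rw [div_eq_iff hM.ne', ← Real.rpow_add hx0]
      norm_num
    rw [h2, ← Real.rpow_mul hx0.le, Real.rpow_def_of_pos hx0, hxt, ← Real.exp_nat_mul,
      ← Real.exp_sub]
    congr 1
    push_cast
    ring
  have key := card_good_ge hk h1 hmul hG (x := x) (y := Real.exp u) (v := Real.exp V) (L := L)
    (c := c₁) (M := x ^ (1 / 4 : ℝ)) S ?_ ?_ (smoothGood Gd (Real.exp u) (x ^ (1 / 4 : ℝ))) ?_ hx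
    (Real.one_le_exp hV0.le) ?_ hL hM ?_ ?_
  · rw [hxt] at key
    refine le_trans (mul_le_mul_of_nonneg_left ?_ ?_) key
    · have h2 : ∏ _i : Fin (8 * J), (c₂ * (t / (32 * J))) = (c₂ * (t / (32 * J))) ^ (8 * J) := by
        simp
      rw [← h2]
      refine Finset.prod_le_prod (fun i _ => by positivity) fun i _ => ?_
      have h3 := hmass (u * ρ ^ (i : ℕ)) ρ (hB₂.trans (huρ i)) hρ
      rwa [hρdef, Real.log_exp, ← hρdef] at h3
    · exact mul_nonneg (by positivity) (Finset.sum_nonneg fun m _ => by positivity)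
  · intro i p hp
    obtain ⟨h2, h3, h4⟩ := hmemS i p hp
    refine ⟨h2, lt_of_le_of_lt (Real.exp_le_exp.2 (huρ i)) h3, h4.trans (Real.exp_le_exp.2 ?_)⟩
    refine (hmono (i + 1) (8 * J) i.2).trans ?_
    rw [hρpow]
    exact huV
  · intro i j hij
    rcases lt_or_gt_of_ne hij with h | h
    · exact hdisj' i j h
    · exact (hdisj' j i h).symm
  · intro m hm
    exact mem_smoothGood.1 hm
  · refine Real.exp_le_exp.2 (le_trans ?_ huV)
    exact le_mul_of_one_le_right hu.le (Real.one_le_exp (by positivity))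
  · intro Z hZ
    rw [hZ0] at hZ
    refine hwin Z (lt_of_lt_of_le (Real.exp_pos _) hZ) ?_
    rw [Real.le_log_iff_exp_le (lt_of_lt_of_le (Real.exp_pos _) hZ)]
    refine le_trans (Real.exp_le_exp.2 ?_) hZ
    nlinarith
  · rw [hZ0, ← Real.exp_add]
    refine Real.exp_le_exp.2 ?_
    nlinarith

open Filter in
lemma eventually_mul_pow_le_exp (C : ℝ) (n : ℕ) {b : ℝ} (hb : 0 < b) :
    ∀ᶠ t : ℝ in atTop, C * t ^ n ≤ Real.exp (b * t) := by
  have h := (isLittleO_pow_exp_pos_mul_atTop n hb).def (c := 1 / (|C| + 1)) (by positivity)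
  filter_upwards [h, eventually_ge_atTop 0] with t ht ht0
  rw [Real.norm_of_nonneg (by positivity), Real.norm_of_nonneg (Real.exp_pos _).le] at ht
  calc C * t ^ n ≤ (|C| + 1) * t ^ n := by
        gcongr
        linarith [le_abs_self C]
    _ ≤ (|C| + 1) * (1 / (|C| + 1) * Real.exp (b * t)) := by gcongr
    _ = Real.exp (b * t) := by field_simp

/-- The conditions on `t = log log x` under which the counting estimates combine. -/
structure LargeParam (k : ℕ) (ε κ A A₁ A₂ c L d t : ℝ) : Prop where
  le_t : 40 ≤ t
  two_le_J : 2 ≤ ⌊Real.log t⌋₊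
  kappa_le : κ * t ≤ Real.exp (ε / 2 * t)
  mass_le : A₂ * (κ * t) ^ 3 ≤ Real.exp (ε / 2 * t)
  rho_ge : 9 ≤ Real.exp (t / (32 * ⌊Real.log t⌋₊))
  base_ge : t ^ (1 / 2 : ℝ) ≤ c * (κ * t) ^ (-(1 / 4) : ℝ) * (t / (32 * ⌊Real.log t⌋₊))
  win_le : (8 * ⌊Real.log t⌋₊ + 1) * Real.exp (3 / 4 * t) + L + A₁ * (κ * t) ^ 3 ≤
    3 / 4 * Real.exp t / k
  smooth_le : 4 * k * (A * t) ≤ Real.exp (t / 2)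
  smooth_small : Real.exp (-(t ^ 2 / k)) * Real.exp (A * t) * (t * Real.exp t) ≤ d
  pow_small : 2 * Real.exp t * (1 + Real.exp t) * Real.exp (-(Real.exp (ε / 2 * t) / k)) *
    Real.exp (A * t) * (t * Real.exp t) ≤ d
  few_small : 4 * Real.exp 1 ≤ d * t
  log_z_ge : Real.exp (ε / 2 * t) ≤ Real.exp t / t ^ 2
  log_y_ge : 2 ≤ Real.exp (ε / 2 * t)

open Filter in
lemma eventually_largeParam {k : ℕ} (hk : 1 ≤ k) {ε κ A A₁ A₂ c L d : ℝ} (hε : 0 < ε)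
    (hε1 : ε ≤ 1) (hκ : 1 ≤ κ) (hc : 0 < c) (hd : 0 < d) :
    ∀ᶠ t in atTop, LargeParam k ε κ A A₁ A₂ c L d t := by
  have hk' : (0 : ℝ) < k := by exact_mod_cast hk
  have hε2 : 0 < ε / 2 := by positivity
  have hlog : ∀ᶠ t : ℝ in atTop, (32 * Real.log 9 + 32 * κ / c) * Real.log t ≤ t ^ (1 / 4 : ℝ) := by
    have h0 : 0 < 32 * Real.log 9 + 32 * κ / c := by
      have := Real.log_pos (by norm_num : (1 : ℝ) < 9)
      positivity
    have h := (isLittleO_log_rpow_atTop (r := 1 / 4) (by norm_num)).def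
      (c := 1 / (32 * Real.log 9 + 32 * κ / c)) (by positivity)
    filter_upwards [h, eventually_ge_atTop 1] with t ht ht1
    rw [Real.norm_of_nonneg (Real.log_nonneg ht1), Real.norm_of_nonneg (by positivity)] at ht
    rw [one_div, inv_mul_eq_div, le_div_iff₀ h0] at ht
    linarith
  have hsmall : ∀ᶠ t : ℝ in atTop, 4 * Real.exp (-t) ≤ d := by
    have : Tendsto (fun t : ℝ => 4 * Real.exp (-t)) atTop (nhds (4 * 0)) :=
      (Real.tendsto_exp_neg_atTop_nhds_zero).const_mul 4
    rw [mul_zero] at this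
    exact (this.eventually (gt_mem_nhds hd)).mono fun t h => h.le
  filter_upwards [eventually_ge_atTop 40, Real.tendsto_log_atTop.eventually_ge_atTop 2,
    eventually_mul_pow_le_exp κ 1 hε2, eventually_mul_pow_le_exp (A₂ * κ ^ 3) 3 hε2, hlog,
    eventually_mul_pow_le_exp (4 * k * 9) 1 (b := 1 / 4) (by norm_num),
    eventually_mul_pow_le_exp (4 * k * L) 0 (b := 1) (by norm_num),
    eventually_mul_pow_le_exp (4 * k * A₁ * κ ^ 3) 3 (b := 1) (by norm_num),
    eventually_mul_pow_le_exp (4 * k * A) 1 (b := 1 / 2) (by norm_num), hsmall,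
    eventually_ge_atTop (k * (|A| + 5)), eventually_mul_pow_le_exp (k * (|A| + 5)) 1 hε2,
    eventually_ge_atTop (4 * Real.exp 1 / d),
    eventually_mul_pow_le_exp 1 2 (b := 1 / 2) (by norm_num),
    eventually_mul_pow_le_exp 2 0 hε2]
    with t h40 hl2 e1 e2 hlg e3 e4 e5 e6 hsm hkA e7 hfew e8 e9
  have ht0 : 0 < t := by linarith
  set J := ⌊Real.log t⌋₊ with hJ
  have hJ2 : 2 ≤ J := Nat.le_floor (by exact_mod_cast hl2)
  have hJ0 : (0 : ℝ) < J := by exact_mod_cast (by omega : 0 < J)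
  have hJl : (J : ℝ) ≤ Real.log t := Nat.floor_le (by linarith)
  have hlt : Real.log t ≤ t := (Real.log_le_sub_one_of_pos ht0).trans (by linarith)
  have hl9 : 0 < Real.log 9 := Real.log_pos (by norm_num)
  have htexp : t ≤ Real.exp t := by linarith [Real.add_one_le_exp t]
  have hq1 : t ^ (1 / 4 : ℝ) ≤ t := by
    calc t ^ (1 / 4 : ℝ) ≤ t ^ (1 : ℝ) := Real.rpow_le_rpow_of_exponent_le (by linarith) (by norm_num)
      _ = t := Real.rpow_one t
  rw [pow_one] at e1 e3 e6 e7
  rw [pow_zero, mul_one] at e4 e9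
  rw [one_mul] at e4 e5 e8
  refine ⟨h40, hJ2, e1, by rw [mul_pow, ← mul_assoc]; exact e2, ?_, ?_, ?_, ?_, ?_, ?_, ?_, ?_, e9⟩
  · rw [← Real.exp_log (by norm_num : (0 : ℝ) < 9)]
    refine Real.exp_le_exp.2 ?_
    rw [le_div_iff₀ (by positivity)]
    calc Real.log 9 * (32 * J) ≤ Real.log 9 * (32 * Real.log t) := by gcongr
      _ ≤ (32 * Real.log 9 + 32 * κ / c) * Real.log t := by
        have : 0 ≤ 32 * κ / c * Real.log t := by positivity
        linarith
      _ ≤ t := hlg.trans hq1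
  · have h1 : κ⁻¹ * t ^ (-(1 / 4) : ℝ) ≤ (κ * t) ^ (-(1 / 4) : ℝ) := by
      rw [Real.mul_rpow (by linarith) ht0.le]
      gcongr
      rw [← Real.rpow_neg_one]
      exact Real.rpow_le_rpow_of_exponent_le hκ (by norm_num)
    have h2 : 32 * κ / c * J ≤ t ^ (1 / 4 : ℝ) := by
      calc 32 * κ / c * J ≤ 32 * κ / c * Real.log t := by gcongr
        _ ≤ (32 * Real.log 9 + 32 * κ / c) * Real.log t := by
          have : 0 ≤ 32 * Real.log 9 * Real.log t := by positivity
          linarith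
        _ ≤ _ := hlg
    refine le_trans ?_ (mul_le_mul_of_nonneg_right (mul_le_mul_of_nonneg_left h1 hc.le)
      (by positivity))
    have h3 : t ^ (-(1 / 4) : ℝ) * t = t ^ (1 / 2 : ℝ) * t ^ (1 / 4 : ℝ) := by
      nth_rewrite 2 [← Real.rpow_one t]
      rw [← Real.rpow_add ht0, ← Real.rpow_add ht0]
      norm_num
    have h4 : c * (κ⁻¹ * t ^ (-(1 / 4) : ℝ)) * (t / (32 * J)) =
        t ^ (1 / 2 : ℝ) * (t ^ (1 / 4 : ℝ) / (32 * κ / c * J)) := by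
      calc c * (κ⁻¹ * t ^ (-(1 / 4) : ℝ)) * (t / (32 * J)) =
          c * κ⁻¹ / (32 * J) * (t ^ (-(1 / 4) : ℝ) * t) := by ring
        _ = _ := by
          rw [h3]
          field_simp
    rw [h4]
    refine le_mul_of_one_le_right (by positivity) ?_
    rwa [one_le_div (by positivity)]
  · have h1 : Real.exp t = Real.exp (1 / 4 * t) * Real.exp (3 / 4 * t) := by
      rw [← Real.exp_add]
      ring_nf
    have h2 : 4 * k * ((8 * J + 1) * Real.exp (3 / 4 * t)) ≤ Real.exp t := by
      rw [h1, ← mul_assoc]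
      refine mul_le_mul_of_nonneg_right (le_trans ?_ e3) (Real.exp_pos _).le
      rw [mul_assoc (4 * (k : ℝ))]
      gcongr
      linarith
    rw [le_div_iff₀ hk', mul_pow]
    linarith
  · rw [← mul_assoc, show t / 2 = 1 / 2 * t by ring]
    exact e6
  · rw [← Real.exp_add]
    calc Real.exp (-(t ^ 2 / k) + A * t) * (t * Real.exp t) ≤
        Real.exp (-(t ^ 2 / k) + A * t) * (Real.exp t * Real.exp t) := by gcongr
      _ = Real.exp (-(t ^ 2 / k) + A * t + t + t) := by
        rw [← Real.exp_add, ← Real.exp_add]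
        ring_nf
      _ ≤ Real.exp (-t) := by
        refine Real.exp_le_exp.2 ?_
        have h1 : (|A| + 5) * t ≤ t ^ 2 / k := by
          rw [le_div_iff₀ hk']
          nlinarith
        nlinarith [le_abs_self A]
      _ ≤ d := by linarith [Real.exp_pos (-t)]
  · calc 2 * Real.exp t * (1 + Real.exp t) * Real.exp (-(Real.exp (ε / 2 * t) / k)) *
          Real.exp (A * t) * (t * Real.exp t) ≤
        2 * Real.exp t * (Real.exp t + Real.exp t) * Real.exp (-(Real.exp (ε / 2 * t) / k)) *
          Real.exp (A * t) * (Real.exp t * Real.exp t) := by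
          gcongr
          exact Real.one_le_exp ht0.le
      _ = 4 * Real.exp (-(Real.exp (ε / 2 * t) / k) + A * t + t + t + t + t) := by
        simp only [Real.exp_add]
        ring
      _ ≤ 4 * Real.exp (-t) := by
        gcongr
        have h1 : (|A| + 5) * t ≤ Real.exp (ε / 2 * t) / k := by
          rw [le_div_iff₀ hk']
          linarith
        nlinarith [le_abs_self A]
      _ ≤ d := hsm
  · rw [div_le_iff₀ hd] at hfew
    linarith
  · rw [le_div_iff₀ (by positivity)]
    calc Real.exp (ε / 2 * t) * t ^ 2 ≤ Real.exp (1 / 2 * t) * Real.exp (1 / 2 * t) := by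
          gcongr
      _ = Real.exp t := by
        rw [← Real.exp_add]
        ring_nf

section
variable {k q : ℕ} {Gd : ℕ → Prop} {ε κ A A₁ A₂ c L d t x : ℝ}

lemma card_inconvenient_le (hk : 1 ≤ k) (h1 : Gd 1)
    (hmul : ∀ m n : ℕ, m.Coprime n → Gd (m * n) → Gd m) (hadm : ∀ n, 0 < n → Gd n → Adm k q n)
    (hε1 : ε ≤ 1) (hd : 0 < d) (H : LargeParam k ε κ A A₁ A₂ c L d t) (hx1 : 1 < x)
    (hxt : Real.log x = Real.exp t) (hE : SmoothBound k q x (Real.exp (A * t)))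
    (hPl : ∑ p ∈ (Finset.Ioc 0 ⌊x⌋₊).filter Nat.Prime, 1 / (p : ℝ) ≤ 40 * t)
    (hq0 : 0 < q) (hq : (q : ℝ) ≤ Real.exp (Real.exp (ε / 2 * t))) (T : Finset ℕ)
    (hT : ∀ n ∈ T, 0 < n ∧ (n : ℝ) ≤ x ∧ Gd n ∧
      ¬ Convenient k (Real.exp (Real.exp (ε / 2 * t))) ⌊Real.log t⌋₊ n) :
    T.card * (t * Real.exp t) ≤ 3 * d * (x ^ (1 / (k : ℝ)) *
      (∑ m ∈ smoothGood Gd (Real.exp (Real.exp (ε / 2 * t))) (x ^ (1 / 4 : ℝ)),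
        (m : ℝ) ^ (-(1 / (k : ℝ)))) * t ^ (4 * ⌊Real.log t⌋₊)) := by
  have hk' : (0 : ℝ) < k := by exact_mod_cast hk
  have hx0 : 0 < x := by linarith
  have h40 := H.le_t
  have ht0 : 0 < t := by linarith
  have ht1 : 1 ≤ t := by linarith
  set J := ⌊Real.log t⌋₊ with hJ
  have hJ2 : 2 ≤ J := H.two_le_J
  set u := Real.exp (ε / 2 * t) with hu
  set y := Real.exp u with hy
  set z := Real.exp (Real.exp t / t ^ 2) with hz
  have hu0 : 0 < u := Real.exp_pos _
  have hy0 : 0 < y := Real.exp_pos _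
  have hlz : Real.log z = Real.exp t / t ^ 2 := Real.log_exp _
  have hly : Real.log y = u := Real.log_exp _
  have hu2 : 2 ≤ u := H.log_y_ge
  have hyz : y ≤ z := Real.exp_le_exp.2 H.log_z_ge
  have hxe : x = Real.exp (Real.exp t) := by rw [← hxt, Real.exp_log hx0]
  have hzx : z ≤ x := by
    rw [hxe]
    refine Real.exp_le_exp.2 (div_le_self (Real.exp_pos _).le (one_le_pow₀ ht1))
  have hx2 : 2 ≤ x := by
    have : u ≤ y := by
      rw [hy]
      linarith [Real.add_one_le_exp u]
    linarith
  set X := x ^ (1 / 4 : ℝ) with hX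
  have hX1 : 1 ≤ X := Real.one_le_rpow hx1.le (by norm_num)
  have hlX : Real.log X = Real.exp t / 4 := by
    rw [hX, Real.log_rpow hx0, hxt]
    ring
  set M := ∑ m ∈ smoothGood Gd y X, (m : ℝ) ^ (-(1 / (k : ℝ))) with hM
  have hM1 : 1 ≤ M := one_le_sum_smoothGood h1 y hX1 _
  set R := x ^ (1 / (k : ℝ)) with hR
  have hR0 : 0 < R := by positivity
  have hpow1 : 1 ≤ t ^ (4 * J) := one_le_pow₀ ht1
  have hone : R ≤ R * M * t ^ (4 * J) := by
    calc R ≤ R * (M * t ^ (4 * J)) :=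
          le_mul_of_one_le_right hR0.le (one_le_mul_of_one_le_of_one_le hM1 hpow1)
      _ = _ := by ring
  set T₁ := T.filter (fun n => ∃ p : ℕ, p.Prime ∧ y < p ∧ p ^ (k + 1) ∣ n) with hT₁
  set T₂ := T.filter (fun n => ∀ p : ℕ, p.Prime → p ∣ n → (p : ℝ) ≤ z) with hT₂
  set T₃ := T.filter (fun n => (¬ ∃ p : ℕ, p.Prime ∧ y < p ∧ p ^ (k + 1) ∣ n) ∧
    ¬ ∀ p : ℕ, p.Prime → p ∣ n → (p : ℝ) ≤ z) with hT₃
  have hsub : T ⊆ T₁ ∪ T₂ ∪ T₃ := by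
    intro n hn
    simp only [hT₁, hT₂, hT₃, Finset.mem_union, Finset.mem_filter]
    by_cases ha : ∃ p : ℕ, p.Prime ∧ y < p ∧ p ^ (k + 1) ∣ n
    · exact Or.inl (Or.inl ⟨hn, ha⟩)
    · by_cases hb : ∀ p : ℕ, p.Prime → p ∣ n → (p : ℝ) ≤ z
      · exact Or.inl (Or.inr ⟨hn, hb⟩)
      · exact Or.inr ⟨hn, ha, hb⟩
  have b₁ : (T₁.card : ℝ) * (t * Real.exp t) ≤ d * (R * M * t ^ (4 * J)) := by
    have h := card_pow_succ_dvd_le hk hE hx2 hy0 T₁ fun n hn => by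
      rw [hT₁, Finset.mem_filter] at hn
      obtain ⟨h1, h2, h3, -⟩ := hT n hn.1
      exact ⟨h1, h2, hadm n h1 h3, hn.2⟩
    have hyk : y ^ (-(1 / (k : ℝ))) = Real.exp (-(u / k)) := by
      rw [hy, ← Real.exp_mul]
      congr 1
      ring
    rw [hxt, hyk] at h
    calc (T₁.card : ℝ) * (t * Real.exp t) ≤ R * (2 * Real.exp t * (1 + Real.exp t) *
          Real.exp (-(u / k)) * Real.exp (A * t)) * (t * Real.exp t) := by gcongr
      _ = R * (2 * Real.exp t * (1 + Real.exp t) *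
          Real.exp (-(u / k)) * Real.exp (A * t) * (t * Real.exp t)) := by ring
      _ ≤ R * d := mul_le_mul_of_nonneg_left H.pow_small hR0.le
      _ = d * R := mul_comm _ _
      _ ≤ _ := by gcongr
  have b₂ : (T₂.card : ℝ) * (t * Real.exp t) ≤ d * (R * M * t ^ (4 * J)) := by
    have h := card_smooth_le hk hE hx0 (z := z) (by rw [hlz]; exact hu2.trans H.log_z_ge) hzx T₂
      fun n hn => by
        rw [hT₂, Finset.mem_filter] at hn
        obtain ⟨h1, h2, h3, -⟩ := hT n hn.1
        exact ⟨h1, h2, hadm n h1 h3, hn.2⟩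
    have he : Real.log x / (k * Real.log z) = t ^ 2 / k := by
      rw [hlz, hxt]
      field_simp
    rw [he] at h
    calc (T₂.card : ℝ) * (t * Real.exp t) ≤
          R * Real.exp (-(t ^ 2 / k)) * Real.exp (A * t) * (t * Real.exp t) := by gcongr
      _ = R * (Real.exp (-(t ^ 2 / k)) * Real.exp (A * t) * (t * Real.exp t)) := by ring
      _ ≤ R * d := mul_le_mul_of_nonneg_left H.smooth_small hR0.le
      _ = d * R := mul_comm _ _
      _ ≤ _ := by gcongr
  have b₃ : (T₃.card : ℝ) * (t * Real.exp t) ≤ d * (R * M * t ^ (4 * J)) := by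
    have h := card_few_large_primes_le hk hmul hx0 (z := z) (l := 40 * t)
      (Real.one_lt_exp_iff.2 (by positivity)) hyz J (by linarith) hPl T₃ fun n hn => by
        rw [hT₃, Finset.mem_filter] at hn
        obtain ⟨hnT, hn1, hn2⟩ := hn
        obtain ⟨h1, h2, h3, h4⟩ := hT n hnT
        have hp : ∀ p : ℕ, p.Prime → p ∣ n → y < p → p ^ k ∣ n ∧ ¬ p ^ (k + 1) ∣ n := by
          intro p hp hpn hyp
          refine ⟨hadm n h1 h3 p hp hpn fun hpq => ?_, fun hdvd => hn1 ⟨p, hp, hyp, hdvd⟩⟩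
          have : (p : ℝ) ≤ q := by exact_mod_cast Nat.le_of_dvd hq0 hpq
          linarith
        refine ⟨h1, h2, h3, hp, ?_, ?_⟩
        · by_contra hcon
          exact h4 (convenient_of_le_card h1 hp (not_lt.1 hcon))
        · push Not at hn2
          exact hn2
    have hS := sum_smoothGood_le hk h1 hadm hE (y := y) (by rw [hly]; exact hu2) (hyz.trans hzx)
      hX1 (by
        rw [hlX, hly, ← Real.exp_add, Real.exp_le_one_iff]
        have h2 : A * t ≤ Real.exp t / 4 / (k * u) := by
          rw [le_div_iff₀ (by positivity)]
          have h3 : u ≤ Real.exp (t / 2) := by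
            refine Real.exp_le_exp.2 ?_
            nlinarith
          have h4 : Real.exp t = Real.exp (t / 2) * Real.exp (t / 2) := by
            rw [← Real.exp_add, add_halves]
          have h5 := mul_le_mul H.smooth_le h3 hu0.le (Real.exp_pos _).le
          rw [h4]
          linarith
        linarith)
    rw [hlz] at h
    have hpow : (40 * t) ^ J ≤ t ^ (2 * J) := by
      rw [pow_mul]
      exact pow_le_pow_left₀ (by positivity) (by nlinarith) J
    calc (T₃.card : ℝ) * (t * Real.exp t) ≤ 2 * R / (Real.exp t / t ^ 2) * (2 * M) *
          (Real.exp 1 * t ^ (2 * J)) * (t * Real.exp t) := by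
          refine mul_le_mul_of_nonneg_right (h.trans ?_) (by positivity)
          gcongr
      _ = R * M * (4 * Real.exp 1 * t ^ (2 * J + 3)) := by
        field_simp
        ring
      _ ≤ R * M * (d * t * t ^ (2 * J + 3)) := by
        exact mul_le_mul_of_nonneg_left
          (mul_le_mul_of_nonneg_right H.few_small (by positivity)) (by positivity)
      _ = d * (R * M * t ^ (2 * J + 4)) := by ring
      _ ≤ _ := by
        have := pow_le_pow_right₀ ht1 (by omega : 2 * J + 4 ≤ 4 * J)
        gcongr
  have hcard : (T.card : ℝ) ≤ T₁.card + T₂.card + T₃.card := by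
    have := (Finset.card_le_card hsub).trans ((Finset.card_union_le _ _).trans
      (Nat.add_le_add_right (Finset.card_union_le _ _) _))
    exact_mod_cast this
  calc (T.card : ℝ) * (t * Real.exp t) ≤ (T₁.card + T₂.card + T₃.card) * (t * Real.exp t) := by
        gcongr
    _ ≤ 3 * d * (R * M * t ^ (4 * J)) := by linarith

lemma const_mul_le_card_good {G : ℕ → Prop} {c₁ : ℝ} (hk : 1 ≤ k) (h1 : Gd 1)
    (hmul : ∀ m n : ℕ, m.Coprime n → Gd m → Gd n → Gd (m * n))
    (hG : ∀ p, G p → p.Prime ∧ Gd (p ^ k)) (hε1 : ε ≤ 1) (hκ : 1 ≤ κ) (hA₁ : 0 ≤ A₁)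
    (hc₁ : 0 < c₁) (hc : 0 < c) (hL : 0 < L)
    (H : LargeParam k ε κ A A₁ A₂ c L d t) (hx1 : 1 < x) (hxt : Real.log x = Real.exp t)
    (hwin : ∀ Z, 0 < Z → A₁ * (κ * t) ^ 3 ≤ Real.log Z → c₁ * (κ * t) ^ (-(1 / 4) : ℝ) ≤
      ∑ p ∈ (win (Z * Real.exp (-L)) Z).filter G, Real.log p / p)
    (hmass : ∀ u ρ, A₂ * (κ * t) ^ 3 ≤ u → 9 ≤ ρ → c * (κ * t) ^ (-(1 / 4) : ℝ) * Real.log ρ ≤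
      ∑ p ∈ (win (Real.exp u) (Real.exp (u * ρ))).filter G, 1 / (p : ℝ)) :
    c₁ * Real.exp (-L) / κ * (x ^ (1 / (k : ℝ)) *
      (∑ m ∈ smoothGood Gd (Real.exp (Real.exp (ε / 2 * t))) (x ^ (1 / 4 : ℝ)),
        (m : ℝ) ^ (-(1 / (k : ℝ)))) * t ^ (4 * ⌊Real.log t⌋₊)) ≤
      ((Finset.Ioc 0 ⌊x⌋₊).filter Gd).card * (t * Real.exp t) := by
  have h40 := H.le_t
  have ht0 : 0 < t := by linarith
  have hx0 : 0 < x := by linarith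
  have hJ2 := H.two_le_J
  set J := ⌊Real.log t⌋₊ with hJ
  have hκt : 1 ≤ κ * t := by nlinarith
  have h := card_good_lower hk h1 hmul hG (u := Real.exp (ε / 2 * t)) (V := Real.exp (3 / 4 * t))
    (by omega : 1 ≤ J) hx1 hxt hL (Real.exp_pos _) (by positivity) ht0 hwin hmass H.mass_le
    H.rho_ge (by
      rw [← Real.exp_add]
      refine Real.exp_le_exp.2 ?_
      nlinarith) (by positivity) H.win_le (by positivity)
  set M := ∑ m ∈ smoothGood Gd (Real.exp (Real.exp (ε / 2 * t))) (x ^ (1 / 4 : ℝ)),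
    (m : ℝ) ^ (-(1 / (k : ℝ))) with hM
  have hM0 : 0 ≤ M := Finset.sum_nonneg fun m _ => by positivity
  have hpow : t ^ (4 * J) ≤ (c * (κ * t) ^ (-(1 / 4) : ℝ) * (t / (32 * J))) ^ (8 * J) := by
    refine le_trans (le_of_eq ?_) (pow_le_pow_left₀ (by positivity) H.base_ge (8 * J))
    rw [← Real.rpow_natCast, ← Real.rpow_natCast, ← Real.rpow_mul ht0.le]
    congr 1
    push_cast
    ring
  have hκ1 : (κ * t)⁻¹ ≤ (κ * t) ^ (-(1 / 4) : ℝ) := by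
    rw [← Real.rpow_neg_one]
    exact Real.rpow_le_rpow_of_exponent_le hκt (by norm_num)
  have h2 : c₁ * (κ * t)⁻¹ * Real.exp (-L) / Real.exp t * x ^ (1 / (k : ℝ)) * M * t ^ (4 * J) ≤
      ((Finset.Ioc 0 ⌊x⌋₊).filter Gd).card := by
    refine le_trans ?_ h
    gcongr
  calc c₁ * Real.exp (-L) / κ * (x ^ (1 / (k : ℝ)) * M * t ^ (4 * J)) =
      c₁ * (κ * t)⁻¹ * Real.exp (-L) / Real.exp t * x ^ (1 / (k : ℝ)) * M * t ^ (4 * J) *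
        (t * Real.exp t) := by
        field_simp
    _ ≤ _ := by gcongr

end

end Nark

open Nark
theorem inconvenient_n_negligible
    (K V : ℕ) (hK : 1 ≤ K) (hV : 1 ≤ V)
    (K₀ : ℝ) (hK₀ : 0 < K₀)
    (f : Fin K → ℕ → ℤ) (hf : ∀ i, IsMultFn (f i))
    (W : Fin K → ℕ → Polynomial ℤ)
    (hfW : ∀ (i : Fin K) (v : ℕ), 1 ≤ v → v ≤ V → ∀ p : ℕ, p.Prime →
      f i (p ^ v) = (W i v).eval (p : ℤ))
    (k : ℕ) (hk1 : 1 ≤ k) (hkV : k ≤ V)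
    (hWnc : ∀ i, 0 < (W i k).natDegree)
    (ε : ℝ) (hε : 0 < ε) (hε1 : ε ≤ 1) :
    ∀ δ : ℝ, 0 < δ → ∃ X : ℝ, ∀ x : ℝ, X < x →
      ∀ q : ℕ, 0 < q → (q : ℝ) ≤ Real.log x ^ K₀ →
        KAdmissible (fun v => ∏ i, W i v) k q →
        (Nat.card {n : ℕ | 0 < n ∧ (n : ℝ) ≤ x ∧
            ¬ Convenient k (Real.exp (Real.log x ^ (ε / 2)))
                (Nat.floor (Real.log (Real.log (Real.log x)))) n ∧
            Int.gcd (∏ i, f i n) (q : ℤ) = 1} : ℝ) ≤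
          δ * (Nat.card {n : ℕ | 0 < n ∧ (n : ℝ) ≤ x ∧
            Int.gcd (∏ i, f i n) (q : ℤ) = 1} : ℝ) := by
  intro δ hδ
  obtain ⟨L, A₁, c₁, hL, hA₁, hc₁, hwin⟩ :=
    exists_goodPrime_window (∏ i, W i k) (by norm_num : (0 : ℝ) < 1 / 4)
  obtain ⟨A₂, c₂, hA₂, hc₂, hmass⟩ :=
    exists_goodPrime_mass (∏ i, W i k) (by norm_num : (0 : ℝ) < 1 / 4)
  obtain ⟨C, hC, hsmooth⟩ := exists_smoothBound hk1
  set κ := 1 + K₀ with hκ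
  set c₄ := c₁ * Real.exp (-L) / κ with hc₄
  have hκ0 : 0 < κ := by positivity
  have hκ1 : 1 ≤ κ := by linarith
  have hc₄0 : 0 < c₄ := by positivity
  have hev := (Real.tendsto_log_atTop.comp Real.tendsto_log_atTop).eventually
    (eventually_largeParam hk1 (A := C * (40 + K₀)) (A₁ := A₁) (A₂ := A₂) (L := L)
      (d := δ * c₄ / 3) hε hε1 hκ1 hc₂ (by positivity))
  obtain ⟨X, hX⟩ := (hev.and (Filter.eventually_gt_atTop (Real.exp 1))).exists_forall_of_atTop
  refine ⟨X, fun x hXx q hq0 hq hadm => ?_⟩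
  obtain ⟨H, hxe⟩ := hX x hXx.le
  simp only [Function.comp_apply] at H
  have hx1 : 1 < x := lt_trans (Real.one_lt_exp_iff.2 one_pos) hxe
  have hlx1 : 1 < Real.log x := (Real.lt_log_iff_exp_lt (by linarith)).2 hxe
  have hlx0 : 0 < Real.log x := by linarith
  set t := Real.log (Real.log x) with ht
  have hxt : Real.log x = Real.exp t := (Real.exp_log hlx0).symm
  have h40 := H.le_t
  have ht0 : 0 < t := by linarith
  have hu : Real.log x ^ (ε / 2) = Real.exp (ε / 2 * t) := by
    rw [Real.rpow_def_of_pos hlx0, mul_comm]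
  rw [Real.rpow_def_of_pos hlx0, ← ht] at hq
  have hq0' : (0 : ℝ) < q := by exact_mod_cast hq0
  have hq1 : (1 : ℝ) ≤ q := by exact_mod_cast hq0
  have hlq : Real.log q ≤ t * K₀ := (Real.log_le_iff_le_exp hq0').2 hq
  have hlq0 : 0 ≤ Real.log q := Real.log_nonneg hq1
  have hw : 1 + Real.log q ≤ κ * t := by
    rw [hκ]
    linarith
  have hprime : 18 * (1 + Real.log (1 + Real.log x)) ≤ 40 * t := by
    have : Real.log (1 + Real.log x) ≤ 1 + t := by
      rw [Real.log_le_iff_le_exp (by linarith), Real.exp_add, ← hxt]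
      nlinarith [Real.add_one_le_exp (1 : ℝ)]
    linarith
  have hE : SmoothBound k q x (Real.exp (C * (40 + K₀) * t)) := by
    intro θ w h1 h2 h3 h4 S hS
    refine (hsmooth q hq0 x hx1.le θ w h1 h2 h3 h4 S hS).trans (Real.exp_le_exp.2 ?_)
    rw [mul_assoc]
    exact mul_le_mul_of_nonneg_left (by linarith) hC.le
  have hqy : (q : ℝ) ≤ Real.exp (Real.exp (ε / 2 * t)) := by
    refine hq.trans (Real.exp_le_exp.2 (le_trans ?_ H.kappa_le))
    rw [hκ]
    linarith
  obtain ⟨n₀, hn₀, hn₀W⟩ := exists_coprime_eval hq0 hadm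
  set Gd : ℕ → Prop := fun n => Int.gcd (∏ i, f i n) (q : ℤ) = 1 with hGd
  have hrpow : (κ * t) ^ (-(1 / 4) : ℝ) ≤ (1 + Real.log q) ^ (-(1 / 4) : ℝ) :=
    Real.rpow_le_rpow_of_nonpos (by linarith) hw (by norm_num)
  have hcube : (1 + Real.log q) ^ 3 ≤ (κ * t) ^ 3 := by gcongr
  have hlow := const_mul_le_card_good (Gd := Gd) (G := GoodPrime (∏ i, W i k) q) hk1
    (gcd_one hf) (fun m n hmn hm hn => (gcd_mul_iff hf hmn).2 ⟨hm, hn⟩)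
    (fun p hp => ⟨hp.1, gcd_of_goodPrime hfW hk1 hkV hp⟩) hε1 hκ1 (by linarith) hc₁ hc₂
    (by linarith) H hx1 hxt
    (fun Z hZ hZ1 => (mul_le_mul_of_nonneg_left hrpow hc₁.le).trans
      (hwin q n₀ hq0 hn₀ hn₀W Z hZ
        ((mul_le_mul_of_nonneg_left hcube (by linarith)).trans hZ1)))
    (fun u ρ hu hρ => (mul_le_mul_of_nonneg_right (mul_le_mul_of_nonneg_left hrpow hc₂.le)
      (Real.log_nonneg (by linarith))).trans (hmass q n₀ hq0 hn₀ hn₀W u ρ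
        ((mul_le_mul_of_nonneg_left hcube (by linarith)).trans hu) hρ))
  set T := ((Finset.Ioc 0 ⌊x⌋₊).filter fun n : ℕ =>
    ¬ Convenient k (Real.exp (Real.exp (ε / 2 * t))) ⌊Real.log t⌋₊ n ∧ Gd n) with hT
  have hmem : ∀ n : ℕ, n ∈ Finset.Ioc 0 ⌊x⌋₊ ↔ 0 < n ∧ (n : ℝ) ≤ x := by
    intro n
    rw [Finset.mem_Ioc, Nat.le_floor_iff (by linarith)]
  have hup := card_inconvenient_le (Gd := Gd) hk1 (gcd_one hf)
    (fun m n hmn h => ((gcd_mul_iff hf hmn).1 h).1)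
    (fun n hn h => adm_of_gcd hf hfW hkV hadm hn h) hε1 (by positivity) H hx1 hxt hE
    ((sum_inv_prime_le hx1.le).trans hprime) hq0 hqy T fun n hn => by
      rw [hT, Finset.mem_filter, hmem] at hn
      exact ⟨hn.1.1, hn.1.2, hn.2.2, hn.2.1⟩
  have e₁ : {n : ℕ | 0 < n ∧ (n : ℝ) ≤ x ∧
      ¬ Convenient k (Real.exp (Real.log x ^ (ε / 2))) ⌊Real.log t⌋₊ n ∧
        Int.gcd (∏ i, f i n) (q : ℤ) = 1} = (T : Set ℕ) := by
    ext n
    rw [hT, Finset.mem_coe, Finset.mem_filter, hmem, hu, Set.mem_ofPred_eq, and_assoc]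
  have e₂ : {n : ℕ | 0 < n ∧ (n : ℝ) ≤ x ∧ Int.gcd (∏ i, f i n) (q : ℤ) = 1} =
      (((Finset.Ioc 0 ⌊x⌋₊).filter Gd : Finset ℕ) : Set ℕ) := by
    ext n
    rw [Finset.mem_coe, Finset.mem_filter, hmem, Set.mem_ofPred_eq, and_assoc]
  rw [e₁, e₂, Nat.card_coe_set_eq, Nat.card_coe_set_eq, Set.ncard_coe_finset,
    Set.ncard_coe_finset]
  refine le_of_mul_le_mul_right (a := t * Real.exp t) (hup.trans ?_) (by positivity)
  refine le_trans (le_of_eq ?_) ((mul_le_mul_of_nonneg_left hlow hδ.le).trans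
    (le_of_eq (by rw [mul_assoc]; congr!)))
  rw [hc₄]
  ring
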